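/- (Lemma B.2: large deviation estimate for skew-shift ergodic averages of separately subharmonic functions) Let h₁, h₂ > 0 and let u : 𝕋² → ℝ extend as a separately subharmonic function to 𝒟_{h₁} × 𝒟_{h₂} with sup |u| ≤ 1 there. Fix ε > 0 small and let ω ∈ Ω_ε. Then for any δ > 0 there exist constants c, C > 0 (depending only on h₁, h₂, δ, ε) such that for every positive integer K: mes[(x,y) ∈ 𝕋² : |(1/K)·Σ_{k=1}^{K} u(T_ω^k(x,y)) − ⟨u⟩| > K^{2δ−1/12}] ≤ C·exp(−c·K^δ). -/

import Mathlib

open MeasureTheory Complex Filter Matrix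

noncomputable section

/-- The circle `𝕋 = ℝ/ℤ`. -/
abbrev Torus : Type := AddCircle (1 : ℝ)

/-- The two-torus `𝕋² = (ℝ/ℤ)²`. -/
abbrev Torus2 : Type := Torus × Torus

/-- The skew-shift `T_ω(x,y) = (x+y, y+ω)`. -/
def skewShift (ω : Torus) (p : Torus2) : Torus2 := (p.1 + p.2, p.2 + ω)

/-- The set `Ω_ε` of Diophantine frequencies:
`‖nω‖ ≥ ε · n⁻¹ · (1 + log n)⁻²` for every positive integer `n`. -/
def DiophSet (ε : ℝ) : Set Torus :=
  {ω | ∀ n : ℕ, 0 < n → ε * (n : ℝ)⁻¹ * ((1 + Real.log n) ^ 2)⁻¹ ≤ ‖(n : ℤ) • ω‖}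

/-- The annulus `𝒟_h = {w ∈ ℂ : 1 − h < |w| < 1 + h}`. -/
def annulusD (h : ℝ) : Set ℂ := {w : ℂ | 1 - h < ‖w‖ ∧ ‖w‖ < 1 + h}

/-- `v` is subharmonic on `U`: upper semicontinuous and satisfying the sub-mean value
inequality on every closed disc contained in `U`. -/
def SubharmonicOn (v : ℂ → ℝ) (U : Set ℂ) : Prop :=
  UpperSemicontinuousOn v U ∧
  ∀ w ∈ U, ∀ r : ℝ, 0 < r → Metric.closedBall w r ⊆ U →
    v w ≤ (2 * Real.pi)⁻¹ * ∫ θ in (0:ℝ)..(2 * Real.pi), v (w + r * Complex.exp (θ * Complex.I))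

/-- `U : ℂ × ℂ → ℝ` is a separately subharmonic extension of `u : 𝕋² → ℝ` to
`𝒟_{h₁} × 𝒟_{h₂}`, via the identification `(x,y) ↦ (e^{2πix}, e^{2πiy})`. -/
def SepSubharmonicExt (u : Torus2 → ℝ) (h₁ h₂ : ℝ) (U : ℂ × ℂ → ℝ) : Prop :=
  (∀ w₂ ∈ annulusD h₂, SubharmonicOn (fun w₁ => U (w₁, w₂)) (annulusD h₁)) ∧
  (∀ w₁ ∈ annulusD h₁, SubharmonicOn (fun w₂ => U (w₁, w₂)) (annulusD h₂)) ∧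
  ∀ p : Torus2, U ((AddCircle.toCircle p.1 : ℂ), (AddCircle.toCircle p.2 : ℂ)) = u p

open scoped Topology ENNReal

instance isProbabilityMeasure_torus : IsProbabilityMeasure (volume : Measure Torus) :=
  ⟨by simp⟩

/-- The character `x ↦ e^{2πix}` of the circle, as a complex number. -/
abbrev expT (x : Torus) : ℂ := (AddCircle.toCircle x : ℂ)

lemma norm_expT (x : Torus) : ‖expT x‖ = 1 := Circle.norm_coe _

lemma expT_add (x y : Torus) : expT (x + y) = expT x * expT y := by
  simp [expT, AddCircle.toCircle_add]

lemma continuous_expT : Continuous expT :=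
  continuous_subtype_val.comp AddCircle.continuous_toCircle

lemma isOpen_annulusD (h : ℝ) : IsOpen (annulusD h) :=
  (isOpen_lt continuous_const continuous_norm).inter (isOpen_lt continuous_norm continuous_const)

lemma mul_mem_annulusD {h : ℝ} {w c : ℂ} (hc : ‖c‖ = 1) : w * c ∈ annulusD h ↔ w ∈ annulusD h := by
  simp [annulusD, hc]

lemma expT_mem_annulusD {h : ℝ} (hh : 0 < h) (x : Torus) : expT x ∈ annulusD h := by
  simp only [annulusD, Set.mem_ofPred_eq, norm_expT]; constructor <;> linarith

lemma SubharmonicOn.le_circleAverage {v : ℂ → ℝ} {D : Set ℂ} (h : SubharmonicOn v D) {w : ℂ}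
    (hw : w ∈ D) {r : ℝ} (hr : 0 < r) (hs : Metric.closedBall w r ⊆ D) :
    v w ≤ Real.circleAverage v w r := by
  simpa [Real.circleAverage_def, circleMap] using h.2 w hw r hr hs

lemma SubharmonicOn.mono {v : ℂ → ℝ} {D D' : Set ℂ} (h : SubharmonicOn v D) (hD : D' ⊆ D) :
    SubharmonicOn v D' :=
  ⟨h.1.mono hD, fun w hw r hr hs => h.2 w (hD hw) r hr (hs.trans hD)⟩

lemma SubharmonicOn.congr {v v' : ℂ → ℝ} {D : Set ℂ} (h : SubharmonicOn v D)
    (hv : ∀ w ∈ D, v w = v' w) : SubharmonicOn v' D := by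
  refine ⟨fun w hw y hy => ?_, fun w hw r hr hs => ?_⟩
  · change v' w < y at hy
    rw [← hv w hw] at hy
    filter_upwards [h.1 w hw y hy, self_mem_nhdsWithin] with z hz hzD
    change v' z < y
    rwa [← hv z hzD]
  · rw [← hv w hw]
    refine (h.2 w hw r hr hs).trans_eq ?_
    congr 1
    refine intervalIntegral.integral_congr fun θ _ => hv _ (hs ?_)
    simp [Complex.norm_exp_ofReal_mul_I, abs_of_pos hr]

lemma SubharmonicOn.comp_mul_right {v : ℂ → ℝ} {h : ℝ} (hv : SubharmonicOn v (annulusD h))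
    (x : Torus) : SubharmonicOn (fun w => v (w * expT x)) (annulusD h) := by
  have hx := norm_expT x
  refine ⟨fun w hw y hy => ?_, fun w hw r hr hs => ?_⟩
  · have hc : Continuous fun w : ℂ => w * expT x := continuous_id.mul continuous_const
    have h2 : Tendsto (fun w : ℂ => w * expT x) (𝓝[annulusD h] w) (𝓝[annulusD h] (w * expT x)) :=
      hc.continuousWithinAt.tendsto_nhdsWithin fun z hz => (mul_mem_annulusD hx).2 hz
    exact h2.eventually (hv.1 _ ((mul_mem_annulusD hx).2 hw) y hy)
  · have h1 : v (w * expT x) ≤ Real.circleAverage v (w * expT x) r := by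
      refine hv.le_circleAverage ((mul_mem_annulusD hx).2 hw) hr fun z hz => ?_
      have : z * (expT x)⁻¹ ∈ annulusD h := hs (by
        have h0 : expT x ≠ 0 := by rw [← norm_ne_zero_iff, hx]; exact one_ne_zero
        rw [mem_closedBall_iff_norm] at hz ⊢
        have : z * (expT x)⁻¹ - w = (z - w * expT x) * (expT x)⁻¹ := by field_simp
        rw [this, norm_mul, norm_inv, hx]; simpa using hz)
      exact (mul_mem_annulusD (by rw [norm_inv, hx, inv_one])).1 this
    refine h1.trans_eq ?_
    obtain ⟨t, ht⟩ : ∃ t : ℝ, expT x = Complex.exp (t * I) :=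
      ⟨Complex.arg (expT x), by simpa [hx] using (Complex.norm_mul_exp_arg_mul_I (expT x)).symm⟩
    rw [Real.circleAverage_eq_integral_add t, smul_eq_mul]
    congr 1
    refine intervalIntegral.integral_congr fun θ _ => ?_
    simp only [circleMap, ht, ofReal_add, add_mul, Complex.exp_add]
    ring_nf

lemma circleIntegrable_of_bounded {v : ℂ → ℝ} (hv : Measurable v) {M : ℝ} (hb : ∀ z, |v z| ≤ M)
    (c : ℂ) (r : ℝ) : CircleIntegrable v c r := by
  rw [CircleIntegrable, intervalIntegrable_iff]
  refine Measure.integrableOn_of_bounded (M := M) measure_Ioc_lt_top.ne ?_ ?_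
  · exact (hv.comp (continuous_circleMap c r).measurable).aestronglyMeasurable
  · exact Eventually.of_forall fun θ => by simpa using hb _

lemma integrable_of_abs_le {α : Type*} [MeasurableSpace α] {ν : Measure α} [IsFiniteMeasure ν]
    {f : α → ℝ} (hf : Measurable f) {M : ℝ} (hb : ∀ a, |f a| ≤ M) : Integrable f ν :=
  Integrable.of_bound hf.aestronglyMeasurable M (Eventually.of_forall fun a => by simpa using hb a)

lemma abs_integral_le_of_abs_le {α : Type*} [MeasurableSpace α] {ν : Measure α}
    [IsProbabilityMeasure ν] {f : α → ℝ} {M : ℝ} (hb : ∀ a, |f a| ≤ M) : |∫ a, f a ∂ν| ≤ M := by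
  simpa using norm_integral_le_of_norm_le_const (μ := ν) (f := f) (C := M)
    (Eventually.of_forall fun a => by simpa using hb a)

lemma upperSemicontinuousOn_integral {α : Type*} [MeasurableSpace α] {ν : Measure α}
    [IsFiniteMeasure ν] {f : ℂ → α → ℝ} {D : Set ℂ} (hb : ∀ z a, |f z a| ≤ 1)
    (hm : ∀ z, Measurable (f z)) (hu : ∀ a, UpperSemicontinuousOn (fun z => f z a) D) :
    UpperSemicontinuousOn (fun z => ∫ a, f z a ∂ν) D := by
  intro z₀ hz₀ y hy
  have hint : ∀ z, Integrable (f z) ν := fun z => integrable_of_abs_le (hm z) (hb z)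
  have hint' : ∀ z, ∫⁻ a, ENNReal.ofReal (1 - f z a) ∂ν
      = ENNReal.ofReal (ν.real Set.univ - ∫ a, f z a ∂ν) := fun z => by
    have h1 : Integrable (fun a => 1 - f z a) ν := (integrable_const _).sub (hint z)
    rw [← ofReal_integral_eq_lintegral_ofReal h1
      (Eventually.of_forall fun a => by have := abs_le.1 (hb z a); simp; linarith),
      integral_sub (integrable_const _) (hint z)]
    simp
  have hle : ∀ z, ∫ a, f z a ∂ν ≤ ν.real Set.univ := fun z => by
    calc ∫ a, f z a ∂ν ≤ ∫ a, (1 : ℝ) ∂ν :=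
          integral_mono (hint z) (integrable_const _) fun a => (abs_le.1 (hb z a)).2
      _ = _ := by simp
  rcases lt_or_ge (ν.real Set.univ) y with hym | hym
  · exact Eventually.of_forall fun z => (hle z).trans_lt hym
  have h1 : ∫⁻ a, ENNReal.ofReal (1 - f z₀ a) ∂ν
      ≤ liminf (fun z => ∫⁻ a, ENNReal.ofReal (1 - f z a) ∂ν) (𝓝[D] z₀) := by
    refine le_trans (lintegral_mono fun a => ?_)
      (lintegral_liminf_le fun z => (measurable_const.sub (hm z)).ennreal_ofReal)
    refine le_of_forall_lt fun c hc => ?_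
    have hct : c ≠ ⊤ := hc.ne_top
    obtain ⟨d, hcd, hd⟩ := exists_between hc
    have hdt : d ≠ ⊤ := hd.ne_top
    rw [← ENNReal.ofReal_toReal hdt] at hd
    have hd2 := (ENNReal.ofReal_lt_ofReal_iff'.1 hd).1
    have hev := hu a z₀ hz₀ (1 - d.toReal) (by linarith)
    refine hcd.trans_le (le_liminf_of_le (by isBoundedDefault) ?_)
    filter_upwards [hev] with z hz
    rw [← ENNReal.ofReal_toReal hdt]
    exact ENNReal.ofReal_le_ofReal (by linarith)
  simp only [hint'] at h1
  have h2 : ENNReal.ofReal (ν.real Set.univ - y) <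
      ENNReal.ofReal (ν.real Set.univ - ∫ a, f z₀ a ∂ν) :=
    ENNReal.ofReal_lt_ofReal_iff'.2 ⟨by linarith, by linarith⟩
  filter_upwards [eventually_lt_of_lt_liminf (h2.trans_le h1)] with z hz
  have := (ENNReal.ofReal_lt_ofReal_iff'.1 hz).1
  linarith

lemma circleAverage_integral_swap {α : Type*} [MeasurableSpace α] {ν : Measure α}
    [IsFiniteMeasure ν] {f : ℂ → α → ℝ} (hm : Measurable (Function.uncurry f)) {M : ℝ} {c : ℂ}
    {r : ℝ} (hb : ∀ z ∈ Metric.sphere c |r|, ∀ a, |f z a| ≤ M) :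
    Real.circleAverage (fun z => ∫ a, f z a ∂ν) c r = ∫ a, Real.circleAverage (f · a) c r ∂ν := by
  simp only [Real.circleAverage_def, smul_eq_mul]
  rw [integral_const_mul, intervalIntegral.integral_of_le (by positivity)]
  congr 1
  rw [integral_integral_swap]
  · refine integral_congr_ae (Eventually.of_forall fun a => ?_)
    simp only
    rw [intervalIntegral.integral_of_le (by positivity)]
  · refine Integrable.of_bound (C := M) ?_ (Eventually.of_forall fun p => ?_)
    · exact (hm.comp (((continuous_circleMap c r).measurable.comp measurable_fst).prodMk
        measurable_snd)).aestronglyMeasurable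
    · exact hb _ (circleMap_mem_sphere' c r p.1) p.2

lemma SubharmonicOn.integral {α : Type*} [MeasurableSpace α] {ν : Measure α}
    [IsFiniteMeasure ν] {f : ℂ → α → ℝ} {D : Set ℂ} (hm : Measurable (Function.uncurry f))
    (hb : ∀ z a, |f z a| ≤ 1) (hs : ∀ a, SubharmonicOn (fun z => f z a) D) :
    SubharmonicOn (fun z => ∫ a, f z a ∂ν) D := by
  have hmz : ∀ z, Measurable (f z) := fun z => hm.comp (measurable_const.prodMk measurable_id)
  have hma : ∀ a, Measurable (f · a) := fun a => hm.comp (measurable_id.prodMk measurable_const)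
  refine ⟨upperSemicontinuousOn_integral hb hmz fun a => (hs a).1, fun w hw r hr hD => ?_⟩
  have h1 : ∫ a, f w a ∂ν ≤ ∫ a, Real.circleAverage (f · a) w r ∂ν := by
    refine integral_mono (integrable_of_abs_le (hmz w) (hb w)) ?_
      fun a => (hs a).le_circleAverage hw hr hD
    refine integrable_of_abs_le (M := 1) ?_ fun a => ?_
    · simp only [Real.circleAverage_def, smul_eq_mul]
      refine Measurable.const_mul ?_ _
      simp only [intervalIntegral.integral_of_le (show (0:ℝ) ≤ 2 * Real.pi by positivity)]
      refine (StronglyMeasurable.integral_prod_right (f := fun a θ => f (circleMap w r θ) a)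
        ?_).measurable
      exact (hm.comp (((continuous_circleMap w r).measurable.comp measurable_snd).prodMk
        measurable_fst)).stronglyMeasurable
    · refine abs_le.2 ⟨?_, ?_⟩
      · calc (-1 : ℝ) = Real.circleAverage (fun _ => (-1 : ℝ)) w r :=
              (Real.circleAverage_const _ _ _).symm
          _ ≤ _ := Real.circleAverage_mono (circleIntegrable_const _ _ _)
              (circleIntegrable_of_bounded (hma a) (hb · a) _ _) fun z _ => (abs_le.1 (hb z a)).1
      · exact Real.circleAverage_mono_on_of_le_circle
          (circleIntegrable_of_bounded (hma a) (hb · a) _ _) fun z _ => (abs_le.1 (hb z a)).2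
  rw [← circleAverage_integral_swap hm fun z _ a => hb z a] at h1
  simpa [Real.circleAverage_def, circleMap] using h1

/-- Maximum principle for functions that satisfy the sub-mean value inequality on some circle
around each point where they are positive. -/
lemma nonpos_of_le_circleAverage {Q : Set ℂ} (hQ : IsCompact Q) {F : ℂ → ℝ}
    (hF : UpperSemicontinuousOn F Q)
    (hmean : ∀ z ∈ Q, 0 < F z → ∃ r > 0, Metric.closedBall z r ⊆ Q ∧ CircleIntegrable F z r ∧
      F z ≤ Real.circleAverage F z r) : ∀ z ∈ Q, F z ≤ 0 := by
  by_contra! hcon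
  obtain ⟨z₁, hz₁, hpos⟩ := hcon
  obtain ⟨z₂, hz₂, hmax⟩ := hF.exists_isMaxOn ⟨z₁, hz₁⟩ hQ
  have hM : 0 < F z₂ := hpos.trans_le (hmax hz₁)
  have hS : IsCompact {z ∈ Q | F z₂ ≤ F z} := by
    obtain ⟨t, ht, hteq⟩ := upperSemicontinuousOn_iff_preimage_Ici.1 hF (F z₂)
    have : {z ∈ Q | F z₂ ≤ F z} = Q ∩ t := by
      rw [← hteq]; rfl
    rw [this]
    exact hQ.inter_right ht
  obtain ⟨z, ⟨hzQ, hzM⟩, hre⟩ := hS.exists_isMaxOn ⟨z₂, hz₂, le_rfl⟩ continuous_re.continuousOn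
  obtain ⟨r, hr, hball, hint, hle⟩ := hmean z hzQ (hM.trans_le hzM)
  have hmem : ∀ θ, circleMap z r θ ∈ Q := fun θ =>
    hball (Metric.sphere_subset_closedBall (circleMap_mem_sphere z hr.le θ))
  have hnn : ∀ θ, 0 ≤ F z - F (circleMap z r θ) := fun θ => by
    have : F (circleMap z r θ) ≤ F z₂ := hmax (hmem θ)
    linarith
  have hlt : ∀ θ ∈ Set.Ioo (0 : ℝ) (Real.pi / 2), 0 < F z - F (circleMap z r θ) := fun θ hθ => by
    rcases (hnn θ).lt_or_eq with h | h
    · exact h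
    · have h3 : (circleMap z r θ).re ≤ z.re := hre ⟨hmem θ, by linarith⟩
      have h4 : 0 < Real.cos θ :=
        Real.cos_pos_of_mem_Ioo ⟨by linarith [hθ.1, Real.pi_pos], hθ.2⟩
      have h5 : (circleMap z r θ).re = z.re + r * Real.cos θ := by
        simp [circleMap, Complex.exp_re]
      nlinarith [mul_pos hr h4]
  have hi : IntervalIntegrable (fun θ => F z - F (circleMap z r θ)) volume 0 (2 * Real.pi) :=
    (intervalIntegrable_const).sub hint
  have h6 : ∫ θ in (0:ℝ)..(2 * Real.pi), (F z - F (circleMap z r θ)) ≤ 0 := by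
    rw [intervalIntegral.integral_sub intervalIntegrable_const hint]
    rw [Real.circleAverage_def, smul_eq_mul, inv_mul_eq_div, le_div_iff₀ (by positivity)] at hle
    simp only [intervalIntegral.integral_const, smul_eq_mul]
    linarith
  have h7 : 0 < ∫ θ in (0:ℝ)..(Real.pi / 2), (F z - F (circleMap z r θ)) := by
    refine intervalIntegral.intervalIntegral_pos_of_pos_on (hi.mono_set ?_) hlt (by positivity)
    rw [Set.uIcc_of_le (by positivity), Set.uIcc_of_le (by positivity)]
    exact Set.Icc_subset_Icc le_rfl (by linarith [Real.pi_pos])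
  have h8 : ∫ θ in (0:ℝ)..(Real.pi / 2), (F z - F (circleMap z r θ)) ≤
      ∫ θ in (0:ℝ)..(2 * Real.pi), (F z - F (circleMap z r θ)) :=
    intervalIntegral.integral_mono_interval le_rfl (by positivity) (by linarith [Real.pi_pos])
      (Eventually.of_forall hnn) hi
  linarith

/-- The uniform probability measure on the disc of radius `r` about the origin. -/
def discMeas (r : ℝ) : Measure ℂ := ProbabilityTheory.cond volume (Metric.ball 0 r)

/-- The average of `f` over the disc of radius `r` about `w`. -/
def discAvg (r : ℝ) (f : ℂ → ℝ) (w : ℂ) : ℝ := ∫ ξ, f (w + ξ) ∂discMeas r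

lemma isProbabilityMeasure_discMeas {r : ℝ} (hr : 0 < r) : IsProbabilityMeasure (discMeas r) :=
  ProbabilityTheory.cond_isProbabilityMeasure_of_finite (Metric.measure_ball_pos _ _ hr).ne'
    (by simp [Complex.volume_ball, ENNReal.mul_eq_top])

lemma ae_discMeas (r : ℝ) : ∀ᵐ ξ ∂discMeas r, ‖ξ‖ < r := by
  filter_upwards [ProbabilityTheory.ae_cond_mem (μ := (volume : Measure ℂ))
    (Metric.isOpen_ball (x := (0:ℂ)) (ε := r)).measurableSet] with ξ hξ
  simpa using hξ

lemma discAvg_eq_setIntegral_zero {r : ℝ} (hr : 0 < r) (f : ℂ → ℝ) (w : ℂ) :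
    discAvg r f w = (Real.pi * r ^ 2)⁻¹ * ∫ ξ in Metric.ball 0 r, f (w + ξ) := by
  rw [discAvg, discMeas, ProbabilityTheory.cond, integral_smul_measure, smul_eq_mul]
  congr 1
  rw [ENNReal.toReal_inv, Complex.volume_ball]
  simp [hr.le, mul_comm]

lemma discAvg_eq_setIntegral {r : ℝ} (hr : 0 < r) (f : ℂ → ℝ) (w : ℂ) :
    discAvg r f w = (Real.pi * r ^ 2)⁻¹ * ∫ ξ in Metric.ball w r, f ξ := by
  rw [discAvg_eq_setIntegral_zero hr]
  congr 1
  have h := (measurePreserving_add_left (volume : Measure ℂ) w).setIntegral_preimage_emb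
    (MeasurableEquiv.addLeft w).measurableEmbedding f (Metric.ball w r)
  rw [← h]
  congr 2
  ext ξ; simp

lemma discAvg_sub_abs_le {r : ℝ} (hr : 0 < r) {f : ℂ → ℝ} (hf : Measurable f) {M : ℝ}
    (hM : ∀ z, |f z| ≤ M) (w w' : ℂ) :
    |discAvg r f w - discAvg r f w'| ≤ 4 * M / r * ‖w - w'‖ := by
  have hM0 : 0 ≤ M := (abs_nonneg _).trans (hM 0)
  have := isProbabilityMeasure_discMeas hr
  have hbd : ∀ w, |discAvg r f w| ≤ M := fun w => abs_integral_le_of_abs_le fun ξ => hM _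
  rcases le_or_gt r ‖w - w'‖ with h | h
  · calc |discAvg r f w - discAvg r f w'| ≤ M + M :=
          (abs_sub _ _).trans (add_le_add (hbd w) (hbd w'))
      _ ≤ 4 * M / r * r := by field_simp; linarith
      _ ≤ _ := by gcongr
  set d := ‖w - w'‖ with hd
  have hd0 : 0 ≤ d := norm_nonneg _
  have hfin : ∀ a : ℂ, ∀ ρ : ℝ, volume (Metric.ball a ρ) ≠ ⊤ := fun a ρ => by
    simp [Complex.volume_ball, ENNReal.mul_eq_top]
  have hvol : ∀ a : ℂ, ∀ ρ : ℝ, 0 ≤ ρ → volume.real (Metric.ball a ρ) = Real.pi * ρ ^ 2 := fun a ρ hρ => by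
    simp [measureReal_def, Complex.volume_ball, hρ, mul_comm]
  have hint : ∀ s : Set ℂ, volume s ≠ ⊤ → IntegrableOn f s := fun s hs =>
    Measure.integrableOn_of_bounded (M := M) hs hf.aestronglyMeasurable
      (Eventually.of_forall fun z => by simpa using hM z)
  have key : ∀ a a' : ℂ, ‖a - a'‖ = d → |∫ ξ in Metric.ball a r \ Metric.ball a' r, f ξ|
      ≤ M * (2 * Real.pi * r * d) := fun a a' haa => by
    have hsub : Metric.ball a r \ Metric.ball a' r ⊆ Metric.ball a r \ Metric.ball a (r - d) := by
      refine Set.sdiff_subset_sdiff_right fun z hz => ?_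
      rw [mem_ball_iff_norm] at hz ⊢
      calc ‖z - a'‖ = ‖(z - a) + (a - a')‖ := by ring_nf
        _ ≤ ‖z - a‖ + ‖a - a'‖ := norm_add_le _ _
        _ < r := by rw [haa]; linarith
    have hfin2 : volume (Metric.ball a r \ Metric.ball a (r - d)) ≠ ⊤ :=
      measure_ne_top_of_subset Set.sdiff_subset (hfin a r)
    have h1 : volume.real (Metric.ball a r \ Metric.ball a' r) ≤ 2 * Real.pi * r * d := by
      refine (measureReal_mono hsub hfin2).trans ?_
      rw [measureReal_sdiff (Metric.ball_subset_ball (by linarith)) Metric.isOpen_ball.measurableSet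
        , hvol _ _ hr.le, hvol _ _ (by linarith)]
      nlinarith [Real.pi_pos, mul_nonneg Real.pi_pos.le (sq_nonneg d)]
    have h2 := norm_setIntegral_le_of_norm_le_const (μ := volume) (f := f) (C := M)
      (measure_ne_top_of_subset Set.sdiff_subset (hfin a r) : volume (Metric.ball a r \ Metric.ball a' r) ≠ ⊤).lt_top
      (fun z _ => by simpa using hM z)
    rw [Real.norm_eq_abs] at h2
    exact h2.trans (by gcongr)
  have hsplit : ∀ a a' : ℂ, ∫ ξ in Metric.ball a r, f ξ =
      (∫ ξ in Metric.ball a r ∩ Metric.ball a' r, f ξ) +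
        ∫ ξ in Metric.ball a r \ Metric.ball a' r, f ξ := fun a a' =>
    (integral_inter_add_sdiff Metric.isOpen_ball.measurableSet (hint _ (hfin a r))).symm
  rw [discAvg_eq_setIntegral hr, discAvg_eq_setIntegral hr, ← mul_sub, hsplit w w', hsplit w' w,
    Set.inter_comm (Metric.ball w' r), abs_mul, abs_of_pos (by positivity)]
  have h1 := key w w' rfl
  have h2 := key w' w (by rw [hd, norm_sub_rev])
  calc (Real.pi * r ^ 2)⁻¹ * |_| ≤ (Real.pi * r ^ 2)⁻¹ * (M * (2 * Real.pi * r * d) + M * (2 * Real.pi * r * d)) := by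
        gcongr
        rw [add_sub_add_left_eq_sub]
        exact (abs_sub _ _).trans (add_le_add h1 h2)
    _ = 4 * M / r * d := by field_simp; ring

lemma discAvg_mul_right {r : ℝ} (hr : 0 < r) (f : ℂ → ℝ) {c : ℂ} (hc : ‖c‖ = 1) (w : ℂ) :
    discAvg r f (w * c) = discAvg r (fun z => f (z * c)) w := by
  rw [discAvg_eq_setIntegral_zero hr, discAvg_eq_setIntegral_zero hr]
  congr 1
  let R : ℂ ≃ₗᵢ[ℝ] ℂ := rotation ⟨c, by simp [Submonoid.unitSphere, hc]⟩
  have hR : ∀ ξ, R ξ = c * ξ := fun ξ => rotation_apply _ _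
  have h := R.measurePreserving.setIntegral_preimage_emb R.toMeasurableEquiv.measurableEmbedding
    (fun ξ => f (w * c + ξ)) (Metric.ball 0 r)
  rw [← h]
  have h2 : (R ⁻¹' Metric.ball 0 r) = Metric.ball 0 r := by ext ξ; simp
  rw [h2]
  simp only [hR, add_mul, mul_comm c]

lemma SubharmonicOn.le_discAvg {v : ℂ → ℝ} {D : Set ℂ} (h : SubharmonicOn v D)
    (hm : Measurable v) {M : ℝ} (hM : ∀ z, |v z| ≤ M) {w : ℂ}
    (hw : w ∈ D) {r : ℝ} (hr : 0 < r) (hs : Metric.closedBall w r ⊆ D) : v w ≤ discAvg r v w := by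
  have := isProbabilityMeasure_discMeas hr
  have hM0 : 0 ≤ M := (abs_nonneg _).trans (hM 0)
  have hmw : Measurable fun ξ => v (w + ξ) := hm.comp (measurable_const_add w)
  have h1 : discAvg r v w - v w = (Real.pi * r ^ 2)⁻¹ * ∫ ξ in Metric.ball 0 r, (v (w + ξ) - v w) := by
    rw [← discAvg_eq_setIntegral_zero hr (fun z => v z - v w), discAvg, discAvg, integral_sub
      (integrable_of_abs_le hmw fun ξ => hM _) (integrable_const _)]
    simp
  suffices 0 ≤ ∫ ξ in Metric.ball (0:ℂ) r, (v (w + ξ) - v w) by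
    have : 0 ≤ discAvg r v w - v w := by rw [h1]; positivity
    linarith
  rw [← integral_indicator Metric.isOpen_ball.measurableSet, ← Complex.integral_comp_polarCoord_symm,
    polarCoord_target]
  have hpm : Measurable fun p : ℝ × ℝ => Complex.polarCoord.symm p := by
    rw [show (fun p : ℝ × ℝ => Complex.polarCoord.symm p) = _ from
      funext fun p => Complex.polarCoord_symm_apply p]
    fun_prop
  set G : ℝ × ℝ → ℝ := fun p => p.1 • (Metric.ball (0:ℂ) r).indicator (fun ξ => v (w + ξ) - v w)
    (Complex.polarCoord.symm p) with hG
  have hGm : Measurable G := by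
    refine measurable_fst.smul ?_
    exact ((hmw.sub_const _).indicator Metric.isOpen_ball.measurableSet).comp
      hpm
  have hnorm : ∀ p : ℝ × ℝ, p.1 ∈ Set.Ioi (0:ℝ) → (Complex.polarCoord.symm p ∈ Metric.ball (0:ℂ) r ↔ p.1 < r) :=
    fun p hp => by
      rw [mem_ball_zero_iff, Complex.norm_polarCoord_symm, abs_of_pos hp]
  have hsupp : ∫ p in Set.Ioi (0:ℝ) ×ˢ Set.Ioo (-Real.pi) Real.pi, G p =
      ∫ p in Set.Ioo (0:ℝ) r ×ˢ Set.Ioo (-Real.pi) Real.pi, G p := by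
    refine setIntegral_eq_of_subset_of_forall_sdiff_eq_zero
      (measurableSet_Ioi.prod measurableSet_Ioo)
      (Set.prod_mono Set.Ioo_subset_Ioi_self subset_rfl) fun p hp => ?_
    have hp1 : p.1 ∈ Set.Ioi (0:ℝ) := hp.1.1
    have hp2 : ¬ p.1 < r := fun hlt => hp.2 ⟨⟨hp1, hlt⟩, hp.1.2⟩
    simp only [hG]
    rw [Set.indicator_of_notMem (by rwa [hnorm p hp1]), smul_zero]
  rw [hsupp, Measure.volume_eq_prod, setIntegral_prod]
  · refine setIntegral_nonneg measurableSet_Ioo fun ρ hρ => ?_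
    have h2 : ∫ θ in Set.Ioo (-Real.pi) Real.pi, G (ρ, θ)
        = ∫ θ in (-Real.pi)..Real.pi, ρ * (v (circleMap w ρ θ) - v w) := by
      rw [intervalIntegral.integral_of_le (by linarith [Real.pi_pos]), integral_Ioc_eq_integral_Ioo]
      refine setIntegral_congr_fun measurableSet_Ioo fun θ _ => ?_
      simp only [hG]
      rw [Set.indicator_of_mem ((hnorm (ρ, θ) hρ.1).2 hρ.2), smul_eq_mul,
        Complex.polarCoord_symm_apply, circleMap, Complex.exp_mul_I]
      simp
    have hci : CircleIntegrable v w ρ := circleIntegrable_of_bounded hm hM w ρ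
    have h3 : v w ≤ Real.circleAverage v w ρ :=
      h.le_circleAverage hw hρ.1 ((Metric.closedBall_subset_closedBall hρ.2.le).trans hs)
    have h4 : ∫ θ in (-Real.pi)..Real.pi, v (circleMap w ρ θ) = 2 * Real.pi * Real.circleAverage v w ρ := by
      rw [Real.circleAverage_eq_integral_add (-Real.pi)]
      rw [smul_eq_mul, mul_inv_cancel_left₀ (by positivity),
        intervalIntegral.integral_comp_add_right (fun θ => v (circleMap w ρ θ))]
      congr 1 <;> ring
    have hii : IntervalIntegrable (fun θ => v (circleMap w ρ θ)) volume (-Real.pi) Real.pi := by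
      rw [intervalIntegrable_iff]
      exact Measure.integrableOn_of_bounded (M := M) measure_Ioc_lt_top.ne
        (hm.comp (continuous_circleMap w ρ).measurable).aestronglyMeasurable
        (Eventually.of_forall fun θ => by simpa using hM _)
    rw [h2, intervalIntegral.integral_const_mul, intervalIntegral.integral_sub hii
      intervalIntegrable_const, h4, intervalIntegral.integral_const, smul_eq_mul]
    have := hρ.1
    have : 0 ≤ (Real.circleAverage v w ρ - v w) * Real.pi := mul_nonneg (by linarith) Real.pi_pos.le
    refine mul_nonneg hρ.1.le ?_
    nlinarith
  · refine Measure.integrableOn_of_bounded (M := r * (M + M)) ?_ hGm.aestronglyMeasurable ?_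
    · rw [Measure.prod_prod]
      exact ENNReal.mul_ne_top measure_Ioo_lt_top.ne measure_Ioo_lt_top.ne
    · rw [ae_restrict_iff' (measurableSet_Ioo.prod measurableSet_Ioo)]
      refine Eventually.of_forall fun p hp => ?_
      simp only [hG, norm_smul]
      have hp1 : 0 < p.1 := hp.1.1
      have hp2 : p.1 < r := hp.1.2
      rw [Real.norm_eq_abs, abs_of_pos hp1]
      gcongr
      refine (norm_indicator_le_norm_self _ _).trans ?_
      exact (norm_sub_le _ _).trans (add_le_add (hM _) (hM _))

/-- A function on `ℂ × ℂ` bounded by one, separately subharmonic on the product of two copies of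
the annulus of width `h` and vanishing off this product. -/
structure BddSepSubharmonic (h : ℝ) (U : ℂ → ℂ → ℝ) : Prop where
  left : ∀ w₂, SubharmonicOn (fun w₁ => U w₁ w₂) (annulusD h)
  right : ∀ w₁, SubharmonicOn (fun w₂ => U w₁ w₂) (annulusD h)
  bdd : ∀ w₁ w₂, |U w₁ w₂| ≤ 1
  zero_left : ∀ w₁ w₂, w₁ ∉ annulusD h → U w₁ w₂ = 0
  zero_right : ∀ w₁ w₂, w₂ ∉ annulusD h → U w₁ w₂ = 0

lemma measurable_of_upperSemicontinuousOn {v : ℂ → ℝ} {D : Set ℂ} (hD : IsOpen D)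
    (hv : UpperSemicontinuousOn v D) (h0 : ∀ w ∉ D, v w = 0) : Measurable v := by
  refine measurable_of_Iio fun x => ?_
  obtain ⟨u, hu, hueq⟩ := upperSemicontinuousOn_iff_preimage_Iio.1 hv x
  have : v ⁻¹' Set.Iio x = (D ∩ u) ∪ (Dᶜ ∩ {_w | 0 < x}) := by
    ext w
    by_cases hw : w ∈ D
    · have := Set.ext_iff.1 hueq w
      simp only [Set.mem_inter_iff, hw, true_and] at this
      simp [hw, ← this]
    · simp [hw, h0 w hw]
  rw [this]
  exact (hD.measurableSet.inter hu.measurableSet).union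
    (hD.measurableSet.compl.inter (MeasurableSet.const _))

lemma tendsto_discAvg {v : ℂ → ℝ} {D : Set ℂ} (hD : IsOpen D) (hv : SubharmonicOn v D)
    (hm : Measurable v) (hb : ∀ z, |v z| ≤ 1) {w : ℂ} (hw : w ∈ D) :
    Tendsto (fun n : ℕ => discAvg (1 / ((n : ℝ) + 1)) v w) atTop (𝓝 (v w)) := by
  have h0 : Tendsto (fun n : ℕ => 1 / ((n : ℝ) + 1)) atTop (𝓝 0) :=
    tendsto_one_div_add_atTop_nhds_zero_nat
  rw [tendsto_order]
  refine ⟨fun a ha => ?_, fun a ha => ?_⟩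
  · obtain ⟨ρ, hρ, hball⟩ := Metric.isOpen_iff.1 hD w hw
    filter_upwards [h0.eventually_lt_const hρ] with n hn
    exact ha.trans_le (hv.le_discAvg hm hb hw (by positivity)
      ((Metric.closedBall_subset_ball hn).trans hball))
  · obtain ⟨b, hb1, hb2⟩ := exists_between ha
    have h1 := hv.1 w hw b hb1
    change ∀ᶠ z in 𝓝[D] w, v z < b at h1
    rw [hD.nhdsWithin_eq hw] at h1
    obtain ⟨ρ, hρ, hball⟩ := Metric.eventually_nhds_iff.1 h1
    filter_upwards [h0.eventually_lt_const hρ] with n hn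
    have hr : 0 < 1 / ((n : ℝ) + 1) := by positivity
    have := isProbabilityMeasure_discMeas hr
    refine lt_of_le_of_lt ?_ hb2
    calc discAvg (1 / ((n : ℝ) + 1)) v w ≤ ∫ _, b ∂discMeas (1 / ((n : ℝ) + 1)) := by
          refine integral_mono_ae (integrable_of_abs_le (hm.comp (measurable_const_add w))
            fun ξ => hb _) (integrable_const _) ?_
          filter_upwards [ae_discMeas (1 / ((n : ℝ) + 1))] with ξ hξ
          exact (hball (by simpa using hξ.trans hn)).le
      _ = b := by rw [integral_const, probReal_univ, one_smul]

lemma continuous_discAvg {r : ℝ} (hr : 0 < r) {v : ℂ → ℝ} (hm : Measurable v) {M : ℝ}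
    (hb : ∀ z, |v z| ≤ M) : Continuous (discAvg r v) := by
  have hM0 : 0 ≤ M := (abs_nonneg _).trans (hb 0)
  refine LipschitzWith.continuous (K := Real.toNNReal (4 * M / r)) (LipschitzWith.of_dist_le_mul
    fun x y => ?_)
  rw [Real.dist_eq, dist_eq_norm, Real.coe_toNNReal _ (by positivity)]
  exact discAvg_sub_abs_le hr hm hb x y

namespace BddSepSubharmonic

variable {h : ℝ} {U : ℂ → ℂ → ℝ}

lemma measurable_left (hU : BddSepSubharmonic h U) (w₂ : ℂ) : Measurable (fun w₁ => U w₁ w₂) :=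
  measurable_of_upperSemicontinuousOn (isOpen_annulusD h) (hU.left w₂).1
    fun w hw => hU.zero_left w w₂ hw

lemma measurable_right (hU : BddSepSubharmonic h U) (w₁ : ℂ) : Measurable (fun w₂ => U w₁ w₂) :=
  measurable_of_upperSemicontinuousOn (isOpen_annulusD h) (hU.right w₁).1
    fun w hw => hU.zero_right w₁ w hw

lemma measurable (hU : BddSepSubharmonic h U) : Measurable (Function.uncurry U) := by
  set V : ℕ → ℂ → ℂ → ℝ := fun n w₂ w₁ => discAvg (1 / ((n : ℝ) + 1)) (U w₁) w₂ with hV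
  have hVm : ∀ n, Measurable (Function.uncurry (V n)) := fun n => by
    have hr : 0 < 1 / ((n : ℝ) + 1) := by positivity
    have := isProbabilityMeasure_discMeas hr
    refine measurable_uncurry_of_continuous_of_measurable
      (fun w₁ => continuous_discAvg hr (hU.measurable_right w₁) (hU.bdd w₁)) fun w₂ => ?_
    refine measurable_of_upperSemicontinuousOn (isOpen_annulusD h)
      (upperSemicontinuousOn_integral (fun z ξ => hU.bdd z _)
        (fun z => (hU.measurable_right z).comp (measurable_const_add w₂))
        fun ξ => (hU.left (w₂ + ξ)).1) fun w hw => ?_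
    change discAvg (1 / ((n : ℝ) + 1)) (U w) w₂ = 0
    simp [discAvg, hU.zero_left w _ hw]
  refine measurable_of_tendsto_metrizable
    (f := fun n => (Set.univ ×ˢ annulusD h).indicator fun p => V n p.2 p.1) (fun n => ?_) ?_
  · exact ((hVm n).comp measurable_swap).indicator
      (MeasurableSet.univ.prod (isOpen_annulusD h).measurableSet)
  · rw [tendsto_pi_nhds]
    rintro ⟨w₁, w₂⟩
    by_cases hw : w₂ ∈ annulusD h
    · simp only [Set.indicator, Set.mem_prod, Set.mem_univ, true_and, hw, if_true]
      exact tendsto_discAvg (isOpen_annulusD h) (hU.right w₁) (hU.measurable_right w₁)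
        (hU.bdd w₁) hw
    · simp [hw, Function.uncurry, hU.zero_right w₁ w₂ hw]

end BddSepSubharmonic

lemma SubharmonicOn.zero (D : Set ℂ) : SubharmonicOn (fun _ => 0) D :=
  ⟨upperSemicontinuousOn_const, fun w _ r _ _ => by simp⟩

lemma SepSubharmonicExt.exists_bddSepSubharmonic {u : Torus2 → ℝ} {h₁ h₂ h : ℝ} {U : ℂ × ℂ → ℝ}
    (hU : SepSubharmonicExt u h₁ h₂ U)
    (hb : ∀ w₁ ∈ annulusD h₁, ∀ w₂ ∈ annulusD h₂, |U (w₁, w₂)| ≤ 1)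
    (h0 : 0 < h) (hh₁ : h ≤ h₁) (hh₂ : h ≤ h₂) :
    ∃ V, BddSepSubharmonic h V ∧ ∀ p : Torus2, u p = V (expT p.1) (expT p.2) := by
  classical
  have hD : ∀ {h'}, h ≤ h' → annulusD h ⊆ annulusD h' := fun hh z hz =>
    ⟨by linarith [hz.1], by linarith [hz.2]⟩
  refine ⟨fun w₁ w₂ => if w₁ ∈ annulusD h ∧ w₂ ∈ annulusD h then U (w₁, w₂) else 0,
    ⟨fun w₂ => ?_, fun w₁ => ?_, fun w₁ w₂ => ?_, fun w₁ w₂ hw => by simp [hw],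
      fun w₁ w₂ hw => by simp [hw]⟩, fun p => ?_⟩
  · by_cases hw : w₂ ∈ annulusD h
    · exact ((hU.1 w₂ (hD hh₂ hw)).mono (hD hh₁)).congr fun w hw' => by simp [hw, hw']
    · simpa [hw] using SubharmonicOn.zero _
  · by_cases hw : w₁ ∈ annulusD h
    · exact ((hU.2.1 w₁ (hD hh₁ hw)).mono (hD hh₂)).congr fun w hw' => by simp [hw, hw']
    · simpa [hw] using SubharmonicOn.zero _
  · split_ifs with hw
    · exact hb _ (hD hh₁ hw.1) _ (hD hh₂ hw.2)
    · simp
  · simp [expT_mem_annulusD h0, ← hU.2.2 p]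

lemma circleAverage_log_norm_sub {a z : ℂ} {r : ℝ} (hr : 0 < r) (ha : r < ‖z - a‖) :
    Real.circleAverage (fun w => Real.log ‖w - a‖) z r = Real.log ‖z - a‖ := by
  refine AnalyticOnNhd.circleAverage_log_norm_of_ne_zero (g := fun w => w - a)
    (fun w _ => by fun_prop) fun w hw => ?_
  rw [abs_of_pos hr, mem_closedBall_iff_norm] at hw
  intro h0
  rw [sub_eq_zero.1 h0, norm_sub_rev] at hw
  linarith

lemma exists_expT_eq {c : ℂ} (hc : ‖c‖ = 1) : ∃ x : Torus, expT x = c := by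
  have hT : (1:ℝ) ≠ 0 := one_ne_zero
  obtain ⟨x, hx⟩ := (AddCircle.homeomorphCircle hT).surjective ⟨c, by simp [Submonoid.unitSphere, hc]⟩
  refine ⟨x, ?_⟩
  rw [expT, ← AddCircle.homeomorphCircle_apply hT, hx]

/-- The mean of `v` over the circle about the origin through `w`. -/
def radialMean (v : ℂ → ℝ) (w : ℂ) : ℝ := ∫ x : Torus, v (w * expT x)

lemma radialMean_mul_right (v : ℂ → ℝ) (w : ℂ) {c : ℂ} (hc : ‖c‖ = 1) :
    radialMean v (w * c) = radialMean v w := by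
  obtain ⟨y, rfl⟩ := exists_expT_eq hc
  simp only [radialMean, mul_assoc, ← expT_add]
  exact integral_add_left_eq_self (fun x => v (w * expT x)) y

lemma radialMean_eq_of_norm_eq (v : ℂ → ℝ) {w w' : ℂ} (h : ‖w‖ = ‖w'‖) :
    radialMean v w = radialMean v w' := by
  rcases eq_or_ne w 0 with rfl | hw
  · rw [norm_zero] at h
    rw [norm_eq_zero.1 h.symm]
  · have : w' = w * (w' / w) := by field_simp
    rw [this, radialMean_mul_right]
    rw [norm_div, h, div_self (by rw [← h]; exact norm_ne_zero_iff.2 hw)]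

lemma abs_radialMean_le {v : ℂ → ℝ} (hb : ∀ z, |v z| ≤ 1) (w : ℂ) : |radialMean v w| ≤ 1 :=
  abs_integral_le_of_abs_le fun _ => hb _

lemma measurable_uncurry_mul_expT {v : ℂ → ℝ} (hm : Measurable v) :
    Measurable (Function.uncurry fun (w : ℂ) (x : Torus) => v (w * expT x)) :=
  hm.comp (measurable_fst.mul (continuous_expT.measurable.comp measurable_snd))

lemma measurable_radialMean {v : ℂ → ℝ} (hm : Measurable v) : Measurable (radialMean v) :=
  (measurable_uncurry_mul_expT hm).stronglyMeasurable.integral_prod_right.measurable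

lemma SubharmonicOn.radialMean {v : ℂ → ℝ} {h : ℝ} (hv : SubharmonicOn v (annulusD h))
    (hm : Measurable v) (hb : ∀ z, |v z| ≤ 1) : SubharmonicOn (radialMean v) (annulusD h) :=
  SubharmonicOn.integral (f := fun w x => v (w * expT x)) (measurable_uncurry_mul_expT hm)
    (fun _ _ => hb _) fun x => hv.comp_mul_right x

lemma radialMean_le_of_mem_Icc {v : ℂ → ℝ} {h : ℝ} (hv : SubharmonicOn v (annulusD h))
    (hm : Measurable v) (hb : ∀ z, |v z| ≤ 1) {R : ℝ} (hR0 : 0 < R) (hR1 : R ≠ 1)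
    (hR : ∀ z : ℂ, min 1 R ≤ ‖z‖ → ‖z‖ ≤ max 1 R → z ∈ annulusD h) {w : ℂ}
    (hw : min 1 R ≤ ‖w‖) (hw' : ‖w‖ ≤ max 1 R) :
    radialMean v w ≤ radialMean v 1 + 2 * (Real.log ‖w‖ / Real.log R) := by
  set Q : Set ℂ := {z | min 1 R ≤ ‖z‖ ∧ ‖z‖ ≤ max 1 R} with hQdef
  have hQ : IsCompact Q := by
    refine Metric.isCompact_of_isClosed_isBounded ?_ ?_
    · exact (isClosed_le continuous_const continuous_norm).inter
        (isClosed_le continuous_norm continuous_const)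
    · exact (Metric.isBounded_closedBall (x := (0:ℂ)) (r := max 1 R)).subset fun z hz => by
        simpa using hz.2
  have hmin : 0 < min 1 R := lt_min one_pos hR0
  have hlogR : Real.log R ≠ 0 := Real.log_ne_zero_of_pos_of_ne_one hR0 hR1
  have hmS := hv.radialMean hm hb
  have hmb := abs_radialMean_le hb
  have hmm := measurable_radialMean hm
  set g : ℂ → ℝ := fun z => Real.log ‖z‖ * (2 / Real.log R) with hg
  have key := nonpos_of_le_circleAverage hQ
    (F := fun z => radialMean v z + (-radialMean v 1 - g z)) ?_ ?_ w ⟨hw, hw'⟩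
  · simp only [hg] at key
    have : 2 * (Real.log ‖w‖ / Real.log R) = Real.log ‖w‖ * (2 / Real.log R) := by ring
    linarith
  · refine (hmS.1.mono fun z hz => hR z hz.1 hz.2).add (ContinuousOn.upperSemicontinuousOn ?_)
    refine continuousOn_const.sub (ContinuousOn.mul_const ?_ _)
    exact ContinuousOn.log continuous_norm.continuousOn fun z hz => (hmin.trans_le hz.1).ne'
  · intro z hz hpos
    have hz1 : ‖z‖ ≠ 1 := fun h1 => by
      have : radialMean v z = radialMean v 1 := radialMean_eq_of_norm_eq v (by simpa using h1)
      simp [this, hg, h1] at hpos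
    have hzR : ‖z‖ ≠ R := fun h1 => by
      have h2 : g z = 2 := by simp only [hg, h1]; field_simp
      have h3 := (abs_le.1 (hmb z)).2
      have h4 := (abs_le.1 (hmb 1)).1
      linarith
    have hlt1 : min 1 R < ‖z‖ := lt_of_le_of_ne hz.1 (by
      rcases min_choice 1 R with h | h <;> rw [h]
      exacts [hz1.symm, hzR.symm])
    have hlt2 : ‖z‖ < max 1 R := lt_of_le_of_ne hz.2 (by
      rcases max_choice 1 R with h | h <;> rw [h]
      exacts [hz1, hzR])
    have hopen : IsOpen {z : ℂ | min 1 R < ‖z‖ ∧ ‖z‖ < max 1 R} :=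
      (isOpen_lt continuous_const continuous_norm).inter
        (isOpen_lt continuous_norm continuous_const)
    obtain ⟨r, hr, hball⟩ := Metric.nhds_basis_closedBall.mem_iff.1 (hopen.mem_nhds ⟨hlt1, hlt2⟩)
    have hballQ : Metric.closedBall z r ⊆ Q := hball.trans fun y hy => ⟨hy.1.le, hy.2.le⟩
    have hrz : r < ‖z‖ := by
      by_contra hcon
      have : (0:ℂ) ∈ Metric.closedBall z r := by simpa using hcon
      have := (hballQ this).1
      simp at this
      rcases this with h | h <;> linarith
    have hI1 : CircleIntegrable (radialMean v) z r := circleIntegrable_of_bounded hmm hmb z r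
    have hI2 : CircleIntegrable (fun w : ℂ => Real.log ‖w‖) z r := by
      simpa using circleIntegrable_log_norm_sub_const (a := 0) (c := z) r
    have hI3 : CircleIntegrable g z r := by
      have := hI2.const_smul (a := (2 / Real.log R))
      refine this.congr (fun w _ => ?_)
      simp [hg, mul_comm]
    have hI4 : CircleIntegrable (fun z => -radialMean v 1 - g z) z r :=
      (circleIntegrable_const _ _ _).sub hI3
    refine ⟨r, hr, hballQ, hI1.add hI4, ?_⟩
    rw [Real.circleAverage_fun_add hI1 hI4, Real.circleAverage_fun_sub (circleIntegrable_const _ _ _) hI3,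
      Real.circleAverage_const]
    have h5 : Real.circleAverage g z r = g z := by
      have h6 := circleAverage_log_norm_sub (a := 0) (z := z) hr (by simpa using hrz)
      simp only [sub_zero] at h6
      have h7 := Real.circleAverage_fun_smul (a := (2 / Real.log R)) (f := fun w : ℂ => Real.log ‖w‖)
        (c := z) (R := r)
      rw [h6] at h7
      simp only [smul_eq_mul] at h7
      simp only [hg, mul_comm _ (2 / Real.log R)]
      exact h7
    rw [h5]
    have := hmS.le_circleAverage (hR z hz.1 hz.2) hr (hballQ.trans fun y hy => hR y hy.1 hy.2)
    linarith

lemma radialMean_le {v : ℂ → ℝ} {h : ℝ} (hh : 0 < h) (hh' : h ≤ 1 / 2)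
    (hv : SubharmonicOn v (annulusD h)) (hm : Measurable v) (hb : ∀ z, |v z| ≤ 1) {w : ℂ}
    (hw : |‖w‖ - 1| ≤ h / 2) : radialMean v w ≤ radialMean v 1 + 8 / h * |‖w‖ - 1| := by
  obtain ⟨hw1, hw2⟩ := abs_le.1 hw
  rcases le_total 1 ‖w‖ with h1 | h1
  · have hR : (1:ℝ) ≤ 1 + h / 2 := by linarith
    have := radialMean_le_of_mem_Icc hv hm hb (R := 1 + h / 2) (by positivity) (by linarith)
      (fun z hz hz' => by
        rw [min_eq_left hR] at hz
        rw [max_eq_right hR] at hz'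
        exact ⟨by linarith, by linarith⟩) (w := w) (by rwa [min_eq_left hR])
        (by rw [max_eq_right hR]; linarith)
    refine this.trans ?_
    rw [abs_of_nonneg (by linarith)]
    have hl1 : Real.log ‖w‖ ≤ ‖w‖ - 1 := Real.log_le_sub_one_of_pos (by linarith)
    have hl2 : h / 4 ≤ Real.log (1 + h / 2) := by
      refine le_trans ?_ (Real.one_sub_inv_le_log_of_pos (by positivity))
      rw [le_sub_comm, inv_le_comm₀ (by positivity) (by linarith)]
      rw [inv_le_iff_one_le_mul₀ (by linarith)]
      nlinarith
    have : Real.log ‖w‖ / Real.log (1 + h / 2) ≤ (‖w‖ - 1) / (h / 4) :=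
      div_le_div₀ (by linarith) hl1 (by positivity) hl2
    have h2 : (‖w‖ - 1) / (h / 4) = 4 / h * (‖w‖ - 1) := by field_simp
    have h3 : 8 / h * (‖w‖ - 1) = 2 * (4 / h * (‖w‖ - 1)) := by ring
    linarith
  · have hR : 1 - h / 2 ≤ (1:ℝ) := by linarith
    have := radialMean_le_of_mem_Icc hv hm hb (R := 1 - h / 2) (by linarith) (by linarith)
      (fun z hz hz' => by
        rw [min_eq_right hR] at hz
        rw [max_eq_left hR] at hz'
        exact ⟨by linarith, by linarith⟩) (w := w) (by rw [min_eq_right hR]; linarith)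
        (by rwa [max_eq_left hR])
    refine this.trans ?_
    rw [abs_of_nonpos (by linarith), ← neg_div_neg_eq (Real.log ‖w‖)]
    have hw0 : 0 < ‖w‖ := by linarith
    have hl1 : -Real.log ‖w‖ ≤ 2 * (1 - ‖w‖) := by
      have := Real.one_sub_inv_le_log_of_pos hw0
      have h4 : ‖w‖⁻¹ - 1 = ‖w‖⁻¹ * (1 - ‖w‖) := by field_simp
      have h5 : ‖w‖⁻¹ ≤ 2 := by rw [inv_le_comm₀ hw0 (by norm_num)]; linarith
      nlinarith
    have hl2 : h / 2 ≤ -Real.log (1 - h / 2) := by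
      have := Real.log_le_sub_one_of_pos (show 0 < 1 - h / 2 by linarith)
      linarith
    have : -Real.log ‖w‖ / -Real.log (1 - h / 2) ≤ (2 * (1 - ‖w‖)) / (h / 2) :=
      div_le_div₀ (by linarith) hl1 (by positivity) hl2
    have h2 : (2 * (1 - ‖w‖)) / (h / 2) = 4 / h * (1 - ‖w‖) := by field_simp; ring
    have h3 : 8 / h * -(‖w‖ - 1) = 2 * (4 / h * (1 - ‖w‖)) := by ring
    linarith

lemma norm_expT_sub_one (x : Torus) : ‖expT x - 1‖ = 2 * Real.sin (Real.pi * ‖x‖) := by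
  obtain ⟨y, hy, rfl⟩ : ∃ y : ℝ, |y| ≤ 1 / 2 ∧ (y : Torus) = x := by
    obtain ⟨y, rfl⟩ := QuotientAddGroup.mk_surjective x
    refine ⟨y - round y, abs_sub_round y, ?_⟩
    have : ((round y : ℝ) : Torus) = 0 := by
      have := AddCircle.coe_period (1:ℝ)
      rw [← mul_one ((round y : ℤ) : ℝ), ← zsmul_eq_mul, AddCircle.coe_zsmul, this, smul_zero]
    rw [AddCircle.coe_sub, this, sub_zero]
  have h1 : ‖(y : Torus)‖ = |y| := (AddCircle.norm_coe_eq_abs_iff 1 one_ne_zero).2 (by simpa using hy)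
  have hpi := Real.pi_pos
  rw [h1, expT, AddCircle.toCircle_apply_mk, Circle.coe_exp]
  have h2 := Complex.norm_exp_I_mul_ofReal_sub_one (2 * Real.pi / 1 * y)
  rw [mul_comm I] at h2
  rw [h2, norm_mul, Real.norm_eq_abs, abs_of_pos (by norm_num : (0:ℝ) < 2)]
  congr 1
  rw [show 2 * Real.pi / 1 * y / 2 = Real.pi * y by ring, Real.norm_eq_abs]
  have hs : |Real.sin (Real.pi * y)| = |Real.sin (Real.pi * |y|)| := by
    rcases abs_choice y with h | h <;> rw [h]
    rw [mul_neg, Real.sin_neg, abs_neg]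
  rw [hs, abs_of_nonneg]
  exact Real.sin_nonneg_of_nonneg_of_le_pi (by positivity) (by nlinarith [abs_nonneg y])

lemma norm_torus_le (x : Torus) : ‖x‖ ≤ 1 / 2 := by
  simpa using AddCircle.norm_le_half_period (1:ℝ) (x := x) one_ne_zero

lemma four_mul_norm_le (x : Torus) : 4 * ‖x‖ ≤ ‖expT x - 1‖ := by
  rw [norm_expT_sub_one]
  have hpi := Real.pi_pos
  have h := Real.mul_le_sin (x := Real.pi * ‖x‖) (by positivity) (by nlinarith [norm_torus_le x])
  have : 2 / Real.pi * (Real.pi * ‖x‖) = 2 * ‖x‖ := by field_simp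
  linarith

lemma norm_expT_sub_one_le (x : Torus) : ‖expT x - 1‖ ≤ 7 * ‖x‖ := by
  rw [norm_expT_sub_one]
  have h := Real.sin_le (x := Real.pi * ‖x‖) (by positivity)
  nlinarith [Real.pi_lt_d2, norm_nonneg x]

lemma norm_expT_sub (x y : Torus) : ‖expT x - expT y‖ = ‖expT (x - y) - 1‖ := by
  have h : expT x = expT (x - y) * expT y := by rw [← expT_add, sub_add_cancel]
  rw [show expT x - expT y = (expT (x - y) - 1) * expT y by rw [h]; ring, norm_mul, norm_expT,
    mul_one]

instance nullSingletonClass_torus : NullSingletonClass (volume : Measure Torus) :=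
  ⟨fun x => by
    rw [← Metric.closedBall_zero, AddCircle.volume_closedBall]; simp⟩

lemma integrable_norm_torus_rpow : Integrable fun x : Torus => ‖x‖ ^ (-1 / 2 : ℝ) := by
  have hmp := AddCircle.measurePreserving_mk 1 0
  have hm : Measurable fun x : Torus => ‖x‖ ^ (-1 / 2 : ℝ) := measurable_norm.pow_const _
  rw [← hmp.integrable_comp hm.aestronglyMeasurable]
  have h0 : IntegrableOn (fun x : ℝ => x ^ (-1 / 2 : ℝ)) (Set.Ioc 0 1) :=
    (intervalIntegral.intervalIntegrable_rpow' (a := 0) (b := 1) (by norm_num)).1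
  have h1 : IntegrableOn (fun x : ℝ => (1 - x) ^ (-1 / 2 : ℝ)) (Set.Ioc 0 1) := by
    have := (intervalIntegral.intervalIntegrable_rpow' (a := 0) (b := 1) (r := -1/2)
      (by norm_num)).comp_sub_left 1
    simpa using this.2
  rw [zero_add]
  refine (h0.add h1).mono' (hm.comp hmp.measurable).aestronglyMeasurable ?_
  rw [ae_restrict_iff' measurableSet_Ioc]
  refine Eventually.of_forall fun x hx => ?_
  have hn1 : (0:ℝ) ≤ x ^ (-1 / 2 : ℝ) := Real.rpow_nonneg hx.1.le _
  have hn2 : (0:ℝ) ≤ (1 - x) ^ (-1 / 2 : ℝ) := Real.rpow_nonneg (by linarith [hx.2]) _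
  simp only [Function.comp_apply, Pi.add_apply]
  rw [Real.norm_of_nonneg (by positivity)]
  rcases le_total x (1 / 2) with h | h
  · have : ‖(x : Torus)‖ = x := by
      rw [(AddCircle.norm_coe_eq_abs_iff 1 one_ne_zero).2] <;> rw [abs_of_pos hx.1]; simpa using h
    rw [this]; linarith
  · have : ‖(x : Torus)‖ = 1 - x := by
      have h2 : (x : Torus) = -((1 - x : ℝ) : Torus) := by
        rw [AddCircle.coe_sub, AddCircle.coe_period, zero_sub, neg_neg]
      have h3 : |1 - x| = 1 - x := abs_of_nonneg (by linarith [hx.2])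
      rw [h2, norm_neg, (AddCircle.norm_coe_eq_abs_iff 1 one_ne_zero).2] <;> rw [h3]
      simp; linarith
    rw [this]; linarith

/-- The logarithmic kernel `log ‖w - e(x)‖`, truncated below at `log τ` and above at `log 3`. -/
def logKernel (τ : ℝ) (w : ℂ) (x : Torus) : ℝ := Real.log (min (max ‖w - expT x‖ τ) 3)

lemma continuous_logKernel {τ : ℝ} (hτ : 0 < τ) : Continuous (Function.uncurry (logKernel τ)) := by
  have := continuous_expT
  refine Continuous.log (by unfold expT at *; fun_prop) fun p => ?_
  exact (lt_min (hτ.trans_le (le_max_right _ _)) (by norm_num)).ne'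

lemma abs_logKernel_le {τ : ℝ} (hτ : 0 < τ) (w : ℂ) (x : Torus) :
    |logKernel τ w x| ≤ |Real.log τ| + Real.log 3 := by
  have h3 : (0:ℝ) ≤ Real.log 3 := Real.log_nonneg (by norm_num)
  have hpos : 0 < min (max ‖w - expT x‖ τ) 3 :=
    lt_min (hτ.trans_le (le_max_right _ _)) (by norm_num)
  refine abs_le.2 ⟨?_, ?_⟩
  · rcases le_total (max ‖w - expT x‖ τ) 3 with h | h
    · have : Real.log τ ≤ logKernel τ w x := by
        rw [logKernel, min_eq_left h]
        exact Real.log_le_log hτ (le_max_right _ _)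
      linarith [neg_abs_le (Real.log τ)]
    · rw [logKernel, min_eq_right h]
      linarith [abs_nonneg (Real.log τ)]
  · have : logKernel τ w x ≤ Real.log 3 := Real.log_le_log hpos (min_le_right _ _)
    linarith [abs_nonneg (Real.log τ)]

lemma logKernel_eq {τ : ℝ} {w : ℂ} {x : Torus} (h1 : τ ≤ ‖w - expT x‖) (h2 : ‖w - expT x‖ ≤ 3) :
    logKernel τ w x = Real.log ‖w - expT x‖ := by
  rw [logKernel, max_eq_left h1, min_eq_left h2]

lemma circleAverage_logKernel {τ r : ℝ} {z : ℂ} {x : Torus} (hτ : 0 < τ) (hr : 0 < r)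
    (h : ∀ w ∈ Metric.closedBall z r, τ ≤ ‖w - expT x‖ ∧ ‖w - expT x‖ ≤ 3) :
    Real.circleAverage (fun w => logKernel τ w x) z r = logKernel τ z x := by
  have hz := h z (Metric.mem_closedBall_self hr.le)
  rw [logKernel_eq hz.1 hz.2, ← circleAverage_log_norm_sub hr]
  · refine Real.circleAverage_congr_sphere fun w hw => ?_
    rw [abs_of_pos hr] at hw
    have := h w (Metric.sphere_subset_closedBall hw)
    exact logKernel_eq this.1 this.2
  · by_contra hcon
    have := h (expT x) (by rw [mem_closedBall_iff_norm, norm_sub_rev]; linarith)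
    simp at this
    linarith

/-- A universal constant in the lower bound for logarithmic potentials of arcs. -/
def potentialConst : ℝ := 2 * (∫ x : Torus, ‖x‖ ^ (-1 / 2 : ℝ)) + 1

lemma one_le_potentialConst : 1 ≤ potentialConst := by
  have : 0 ≤ ∫ x : Torus, ‖x‖ ^ (-1 / 2 : ℝ) := integral_nonneg fun x => by positivity
  rw [potentialConst]; linarith

lemma neg_le_log {a y : ℝ} (ha : 0 < a) (hy : 0 < y) :
    -(2 * Real.log (1 / a) + 2 * a * y ^ (-1 / 2 : ℝ)) ≤ Real.log y := by
  have hz : 0 < a * y ^ (-1 / 2 : ℝ) := by positivity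
  have h := Real.log_le_sub_one_of_pos hz
  rw [Real.log_mul ha.ne' (by positivity), Real.log_rpow hy] at h
  rw [one_div, Real.log_inv]
  linarith

lemma le_integral_logKernel {τ : ℝ} (hτ : 0 < τ) {E : Set Torus}
    (hE0 : 0 < volume.real E) {w : ℂ} :
    -(2 * Real.log (1 / volume.real E) + potentialConst) ≤
      ∫ x, logKernel τ w x ∂(ProbabilityTheory.cond volume E) := by
  set a := volume.real E with ha
  have hE' : volume E ≠ 0 := fun h => by simp [ha, measureReal_def, h] at hE0
  have : IsProbabilityMeasure (ProbabilityTheory.cond volume E) :=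
    ProbabilityTheory.cond_isProbabilityMeasure_of_finite hE' (measure_ne_top _ _)
  obtain ⟨x', hx'⟩ : ∃ x' : Torus, ∀ x, ‖expT x' - w‖ ≤ ‖w - expT x‖ := by
    rcases eq_or_ne w 0 with rfl | hw
    · exact ⟨0, fun x => by simp [norm_expT]⟩
    · have hw0 : ‖w‖ ≠ 0 := norm_ne_zero_iff.2 hw
      obtain ⟨x', hx'⟩ := exists_expT_eq (c := w / ‖w‖) (by simp [hw0])
      refine ⟨x', fun x => ?_⟩
      have h1 : expT x' - w = w / ‖w‖ * (1 - ‖w‖ : ℝ) := by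
        have : (‖w‖ : ℂ) ≠ 0 := by exact_mod_cast hw0
        rw [hx']; push_cast; field_simp
      rw [h1, norm_mul, Complex.norm_real, norm_div, Complex.norm_real, norm_norm, div_self hw0,
        one_mul, Real.norm_eq_abs, abs_sub_comm, ← norm_expT x]
      exact abs_norm_sub_norm_le _ _
  have hlow : ∀ x ≠ x', -(2 * Real.log (1 / a) + 2 * a * ‖x' - x‖ ^ (-1 / 2 : ℝ)) ≤
      logKernel τ w x := fun x hx => by
    have hpos : 0 < ‖x' - x‖ := norm_pos_iff.2 (sub_ne_zero.2 hx.symm)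
    refine (neg_le_log hE0 hpos).trans (Real.log_le_log hpos (le_min ?_ ?_))
    · refine le_trans ?_ (le_max_left _ _)
      have h1 := four_mul_norm_le (x' - x)
      rw [← norm_expT_sub] at h1
      have h2 : ‖expT x' - expT x‖ ≤ ‖expT x' - w‖ + ‖w - expT x‖ := norm_sub_le_norm_sub_add_norm_sub _ _ _
      linarith [hx' x]
    · linarith [norm_torus_le (x' - x)]
  have hJ : Integrable fun x : Torus => ‖x' - x‖ ^ (-1 / 2 : ℝ) :=
    integrable_norm_torus_rpow.comp_sub_left x'
  have hJ' : Integrable (fun x : Torus => ‖x' - x‖ ^ (-1 / 2 : ℝ)) (ProbabilityTheory.cond volume E) := by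
    rw [ProbabilityTheory.cond]
    exact hJ.integrableOn.smul_measure (ENNReal.inv_ne_top.2 hE')
  have hJb : ∫ x, ‖x' - x‖ ^ (-1 / 2 : ℝ) ∂(ProbabilityTheory.cond volume E) ≤
      a⁻¹ * ∫ x : Torus, ‖x‖ ^ (-1 / 2 : ℝ) := by
    rw [ProbabilityTheory.cond, integral_smul_measure, ENNReal.toReal_inv, smul_eq_mul]
    change a⁻¹ * _ ≤ _
    gcongr
    rw [← integral_sub_left_eq_self (fun x : Torus => ‖x‖ ^ (-1 / 2 : ℝ)) volume x']
    exact setIntegral_le_integral hJ (Eventually.of_forall fun x => by positivity)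
  calc -(2 * Real.log (1 / a) + potentialConst)
      ≤ -(2 * Real.log (1 / a) + 2 * a * (a⁻¹ * ∫ x : Torus, ‖x‖ ^ (-1 / 2 : ℝ))) := by
        rw [potentialConst]; field_simp; linarith
    _ ≤ -(2 * Real.log (1 / a) +
          2 * a * ∫ x, ‖x' - x‖ ^ (-1 / 2 : ℝ) ∂(ProbabilityTheory.cond volume E)) := by gcongr
    _ = ∫ x, -(2 * Real.log (1 / a) + 2 * a * ‖x' - x‖ ^ (-1 / 2 : ℝ))
          ∂(ProbabilityTheory.cond volume E) := by
        rw [integral_neg, integral_add (integrable_const _) (hJ'.const_mul _), integral_const,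
          probReal_univ, one_smul, integral_const_mul]
    _ ≤ _ := by
        refine integral_mono_ae ((integrable_const _).add (hJ'.const_mul _)).neg
          (integrable_of_abs_le ((continuous_logKernel hτ).comp
            (Continuous.prodMk_right w)).measurable (abs_logKernel_le hτ w)) ?_
        have h0 : ∀ᵐ x ∂(volume : Measure Torus), x ≠ x' := by
          rw [ae_iff]; simp
        filter_upwards [ProbabilityTheory.cond_absolutelyContinuous.ae_le h0] with x hx
        exact hlow x hx

lemma volume_real_le_of_isCompact {V : ℂ → ℝ} {h t b s m lam : ℝ} (hh : h ≤ 1 / 2)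
    (hV : SubharmonicOn V (annulusD h)) (hm : Measurable V) {M : ℝ} (hb : ∀ z, |V z| ≤ M)
    (ht0 : 0 < t) (hth : 40 * t < h) (hs : 0 ≤ s) (hm0 : 0 < m) (hlam : 0 ≤ lam)
    (hup : ∀ z, |‖z‖ - 1| ≤ 40 * t → V z ≤ b + s) {c x₀ : Torus} (hx₀ : ‖x₀ - c‖ ≤ t)
    (hVx₀ : b - m ≤ V (expT x₀)) {E : Set Torus} (hE : IsCompact E)
    (hEc : ∀ x ∈ E, ‖x - c‖ ≤ t) (hEV : ∀ x ∈ E, V (expT x) < b - lam) :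
    volume.real E ≤ Real.exp (potentialConst / 2) * Real.exp (-lam / (4 * (s + m))) := by
  have hA := one_le_potentialConst
  rcases lt_or_ge lam m with hlm | hlm
  · have h1 : volume.real E ≤ 1 := measureReal_le_one
    refine h1.trans ?_
    rw [← Real.exp_add]
    refine Real.one_le_exp ?_
    have : lam / (4 * (s + m)) ≤ 1 / 2 := by
      rw [div_le_iff₀ (by positivity)]; linarith
    rw [neg_div]; linarith
  rcases (measureReal_nonneg (μ := (volume : Measure Torus)) (s := E)).eq_or_lt with hE0 | hE0
  · rw [← hE0]; positivity
  set D := annulusD h with hD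
  have hcirc : ∀ z, ‖z - expT c‖ ≤ 40 * t → |‖z‖ - 1| ≤ 40 * t := fun z hz => by
    rw [← norm_expT c]; exact (abs_norm_sub_norm_le _ _).trans hz
  have hmemD : ∀ z, ‖z - expT c‖ ≤ 40 * t → z ∈ D := fun z hz => by
    have := abs_le.1 (hcirc z hz)
    exact ⟨by linarith, by linarith⟩
  have hO : IsOpen {z ∈ D | V z < b - lam} := by
    obtain ⟨u, hu, hueq⟩ := upperSemicontinuousOn_iff_preimage_Iio.1 hV.1 (b - lam)
    have : {z ∈ D | V z < b - lam} = D ∩ u := by rw [← hueq]; rfl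
    rw [this]; exact (isOpen_annulusD h).inter hu
  have hE' : IsCompact (expT '' E) := hE.image continuous_expT
  obtain ⟨τ', hτ', hτO⟩ := hE'.exists_cthickening_subset_open hO (by
    rintro _ ⟨x, hx, rfl⟩
    exact ⟨expT_mem_annulusD (by linarith) x, hEV x hx⟩)
  set τ := min τ' t with hτdef
  have hτ : 0 < τ := lt_min hτ' ht0
  have hτt : τ ≤ t := min_le_right _ _
  have hτO : Metric.cthickening τ (expT '' E) ⊆ {z ∈ D | V z < b - lam} :=
    (Metric.cthickening_mono (min_le_left _ _) _).trans hτO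
  set Q := Metric.closedBall (expT c) (40 * t) \ Metric.thickening τ (expT '' E) with hQ
  have hQc : IsCompact Q := (isCompact_closedBall _ _).diff Metric.isOpen_thickening
  have hEvol : volume E ≠ 0 := fun h => by simp [measureReal_def, h] at hE0
  set ν := ProbabilityTheory.cond (volume : Measure Torus) E with hν
  have hνp : IsProbabilityMeasure ν :=
    ProbabilityTheory.cond_isProbabilityMeasure_of_finite hEvol (measure_ne_top _ _)
  have hνE : ∀ᵐ x ∂ν, x ∈ E := ProbabilityTheory.ae_cond_mem hE.measurableSet
  set p : ℂ → ℝ := fun w => ∫ x, logKernel τ w x ∂ν with hp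
  have hkc := continuous_logKernel hτ
  have hki : ∀ w, Integrable (logKernel τ w) ν := fun w =>
    integrable_of_abs_le (hkc.comp (Continuous.prodMk_right w)).measurable (abs_logKernel_le hτ w)
  have hpc : Continuous p := by
    refine continuous_of_dominated (bound := fun _ => |Real.log τ| + Real.log 3)
      (fun w => (hki w).aestronglyMeasurable)
      (fun w => Eventually.of_forall fun x => by simpa using abs_logKernel_le hτ w x)
      (integrable_const _) (Eventually.of_forall fun x => hkc.comp (Continuous.prodMk_left x))
  set L := 2 * Real.log (1 / volume.real E) + potentialConst with hL
  have hpL : ∀ w, -L ≤ p w := fun w => le_integral_logKernel hτ hE0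
  have hL0 : 0 < L := by
    have : 0 ≤ Real.log (1 / volume.real E) :=
      Real.log_nonneg (by rw [le_div_iff₀ hE0, one_mul]; exact measureReal_le_one)
    linarith
  have hdist : ∀ z, ‖z - expT c‖ ≤ 40 * t → ∀ x ∈ E, ‖z - expT x‖ ≤ 3 ∧
      ‖z - expT c‖ - 7 * t ≤ ‖z - expT x‖ := fun z hz x hx => by
    have h1 : ‖expT x - expT c‖ ≤ 7 * t := by
      rw [norm_expT_sub]
      exact (norm_expT_sub_one_le _).trans (by linarith [hEc x hx])
    have h2 := norm_sub_le_norm_sub_add_norm_sub z (expT x) (expT c)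
    have h3 := norm_sub_le_norm_sub_add_norm_sub z (expT c) (expT x)
    rw [norm_sub_rev (expT c)] at h3
    exact ⟨by linarith, by linarith⟩
  have hτdist : ∀ z ∈ Q, ∀ x ∈ E, τ ≤ ‖z - expT x‖ := fun z hz x hx => by
    by_contra! hcon
    exact hz.2 (Metric.mem_thickening_iff.2 ⟨_, ⟨x, hx, rfl⟩, by rwa [dist_eq_norm]⟩)
  have hlogt : Real.log (33 * t) ≤ 0 := Real.log_nonpos (by positivity) (by linarith)
  set α := lam / L with hα
  have hα0 : 0 ≤ α := div_nonneg hlam hL0.le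
  have hF := nonpos_of_le_circleAverage hQc
    (F := fun z => V z + (-(b + s) - α * (p z - Real.log (33 * t)))) ?_ ?_ (expT x₀) ?_
  · have hx₀E : ∀ x ∈ E, logKernel τ (expT x₀) x ≤ Real.log (14 * t) := fun x hx => by
      have h1 : ‖expT x₀ - expT x‖ ≤ 14 * t := by
        rw [norm_expT_sub]
        refine (norm_expT_sub_one_le _).trans ?_
        have h2 := norm_sub_le_norm_sub_add_norm_sub x₀ c x
        rw [norm_sub_rev c] at h2
        linarith [hEc x hx]
      refine Real.log_le_log (lt_min (hτ.trans_le (le_max_right _ _)) (by norm_num)) ?_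
      exact (min_le_left _ _).trans (max_le h1 (by linarith))
    have hpx₀ : p (expT x₀) ≤ Real.log (14 * t) := by
      calc p (expT x₀) ≤ ∫ _, Real.log (14 * t) ∂ν :=
            integral_mono_ae (hki _) (integrable_const _) (hνE.mono fun x hx => hx₀E x hx)
        _ = _ := by rw [integral_const, probReal_univ, one_smul]
    have hlog : Real.log (14 * t) - Real.log (33 * t) ≤ -(1 / 2) := by
      rw [← Real.log_div (by positivity) (by positivity),
        show 14 * t / (33 * t) = 14 / 33 by field_simp]
      refine (Real.log_le_sub_one_of_pos (by norm_num)).trans (by norm_num)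
    have h1 : α * (p (expT x₀) - Real.log (33 * t)) ≤ α * (-(1 / 2)) :=
      mul_le_mul_of_nonneg_left (by linarith) hα0
    have h2 : lam / L ≤ 2 * (s + m) := by simp only [hα] at h1 hF; linarith
    rw [div_le_iff₀ hL0] at h2
    have h3 : lam / (4 * (s + m)) ≤ L / 2 := by
      rw [div_le_iff₀ (by positivity)]; linarith
    have h4 : Real.log (volume.real E) ≤ potentialConst / 2 - lam / (4 * (s + m)) := by
      have : Real.log (1 / volume.real E) = -Real.log (volume.real E) := by
        rw [one_div, Real.log_inv]
      rw [hL, this] at h3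
      linarith
    rw [← Real.exp_add, neg_div, ← sub_eq_add_neg]
    exact (Real.log_le_iff_le_exp hE0).1 h4
  · refine (hV.1.mono fun z hz => hmemD z (mem_closedBall_iff_norm.1 hz.1)).add
      (Continuous.continuousOn ?_).upperSemicontinuousOn
    fun_prop
  · intro z hz hpos
    have hzc : ‖z - expT c‖ ≤ 40 * t := mem_closedBall_iff_norm.1 hz.1
    have hVs : V z ≤ b + s := hup z (hcirc z hzc)
    have hzlt : ‖z - expT c‖ < 40 * t := by
      refine lt_of_le_of_ne hzc fun heq => ?_
      have hp1 : Real.log (33 * t) ≤ p z := by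
        calc Real.log (33 * t) = ∫ _, Real.log (33 * t) ∂ν := by
              rw [integral_const, probReal_univ, one_smul]
          _ ≤ p z := integral_mono_ae (integrable_const _) (hki _) (hνE.mono fun x hx => by
              have h1 := hdist z hzc x hx
              refine Real.log_le_log (by positivity) (le_min ((by linarith : 33 * t ≤ ‖z - expT x‖).trans
                (le_max_left _ _)) (by linarith)))
      nlinarith [mul_nonneg hα0 (sub_nonneg.2 hp1)]
    have hzO : b - lam ≤ V z := by
      by_contra! hcon
      have h1 : -lam ≤ α * (p z - Real.log (33 * t)) := by
        calc -lam = α * (-L) := by rw [hα]; field_simp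
          _ ≤ _ := mul_le_mul_of_nonneg_left (by linarith [hpL z]) hα0
      linarith
    have hopen : IsOpen (Metric.ball (expT c) (40 * t) \ Metric.cthickening τ (expT '' E)) :=
      Metric.isOpen_ball.sdiff Metric.isClosed_cthickening
    have hzmem : z ∈ Metric.ball (expT c) (40 * t) \ Metric.cthickening τ (expT '' E) :=
      ⟨mem_ball_iff_norm.2 hzlt, fun hcon => by linarith [(hτO hcon).2]⟩
    obtain ⟨r, hr, hball⟩ := Metric.nhds_basis_closedBall.mem_iff.1 (hopen.mem_nhds hzmem)
    have hballQ : Metric.closedBall z r ⊆ Q := hball.trans fun y hy =>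
      ⟨Metric.ball_subset_closedBall hy.1,
        fun hcon => hy.2 (Metric.thickening_subset_cthickening _ _ hcon)⟩
    have hI1 : CircleIntegrable V z r := circleIntegrable_of_bounded hm hb z r
    have hI2 : CircleIntegrable p z r := hpc.continuousOn.circleIntegrable hr.le
    have hI3 : CircleIntegrable (fun z => -(b + s) - α * (p z - Real.log (33 * t))) z r :=
      Continuous.continuousOn (by fun_prop) |>.circleIntegrable hr.le
    refine ⟨r, hr, hballQ, hI1.add hI3, ?_⟩
    have hpm : Real.circleAverage p z r = p z := by
      rw [hp, circleAverage_integral_swap hkc.measurable fun w _ x => abs_logKernel_le hτ w x]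
      refine integral_congr_ae (hνE.mono fun x hx => ?_)
      refine circleAverage_logKernel hτ hr fun w hw => ⟨hτdist w (hballQ hw) x hx, ?_⟩
      exact (hdist w (mem_closedBall_iff_norm.1 (hballQ hw).1) x hx).1
    have h5 : Real.circleAverage (fun z => -(b + s) - α * (p z - Real.log (33 * t))) z r
        = -(b + s) - α * (p z - Real.log (33 * t)) := by
      have h6 : (fun z => -(b + s) - α * (p z - Real.log (33 * t))) =
          fun z => (-(b + s) + α * Real.log (33 * t)) - α • p z := by
        funext z; simp only [smul_eq_mul]; ring
      have hI2' : CircleIntegrable (fun z => α • p z) z r := hI2.const_smul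
      rw [h6, Real.circleAverage_fun_sub (circleIntegrable_const _ _ _) hI2', Real.circleAverage_const, Real.circleAverage_fun_smul, hpm,
        smul_eq_mul]
      ring
    rw [Real.circleAverage_fun_add hI1 hI3, h5]
    have := hV.le_circleAverage (hmemD z hzc) hr
      (hballQ.trans fun y hy => hmemD y (mem_closedBall_iff_norm.1 hy.1))
    linarith
  · refine ⟨mem_closedBall_iff_norm.2 ?_, fun hcon => ?_⟩
    · rw [norm_expT_sub]
      exact (norm_expT_sub_one_le _).trans (by linarith)
    · have := (hτO (Metric.thickening_subset_cthickening _ _ hcon)).2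
      linarith

lemma exists_norm_sub_natCast_div_le {N : ℕ} (hN : 0 < N) (x : Torus) :
    ∃ j < N, ‖x - ((j / N : ℝ) : Torus)‖ ≤ 1 / N := by
  have hN' : (0:ℝ) < N := by exact_mod_cast hN
  obtain ⟨y, rfl⟩ := QuotientAddGroup.mk_surjective x
  have h0 := Int.fract_nonneg y
  have h1 := Int.fract_lt_one y
  have hfr : ((Int.fract y : ℝ) : Torus) = (y : Torus) := by
    have : ((⌊y⌋ : ℝ) : Torus) = 0 := by
      rw [← mul_one ((⌊y⌋ : ℤ) : ℝ), ← zsmul_eq_mul, AddCircle.coe_zsmul, AddCircle.coe_period,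
        smul_zero]
    rw [Int.fract, AddCircle.coe_sub, this, sub_zero]
  have hfl := Nat.floor_le (a := Int.fract y * N) (by positivity)
  refine ⟨⌊Int.fract y * N⌋₊, ?_, ?_⟩
  · have : (⌊Int.fract y * N⌋₊ : ℝ) < N := by nlinarith
    exact_mod_cast this
  · have h2 := Nat.lt_floor_add_one (Int.fract y * N)
    change ‖(y : Torus) - _‖ ≤ _
    rw [← hfr, ← AddCircle.coe_sub]
    refine (QuotientAddGroup.norm_mk_le_norm (m := _)).trans ?_
    rw [Real.norm_eq_abs, abs_of_nonneg]
    · rw [sub_le_iff_le_add, ← add_div, le_div_iff₀ hN']; linarith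
    · rw [sub_nonneg, div_le_iff₀ hN']; exact hfl

/-- A bounded subharmonic function on an annulus, whose values near the unit circle barely exceed
its mean over the unit circle, is close to this mean off a small subset of the circle. -/
lemma volume_expT_lt_le {V : ℂ → ℝ} {h b s s₀ κ lam : ℝ} {N : ℕ} (hh : h ≤ 1 / 2)
    (hV : SubharmonicOn V (annulusD h)) (hm : Measurable V) {M : ℝ} (hb : ∀ z, |V z| ≤ M)
    (hN : 40 / N < h) (hN0 : 0 < N) (hs : 0 ≤ s) (hs₀ : 0 ≤ s₀) (hκ : 0 < κ + s₀) (hlam : 0 ≤ lam)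
    (hup : ∀ z, |‖z‖ - 1| ≤ 40 / N → V z ≤ b + s)
    (hup₀ : ∀ x : Torus, V (expT x) ≤ b + s₀) (hmean : b - κ ≤ ∫ x : Torus, V (expT x)) :
    volume.real {x : Torus | V (expT x) < b - lam} ≤
      N * (Real.exp (potentialConst / 2) * Real.exp (-lam / (4 * (s + N * (κ + s₀))))) := by
  have hN' : (0:ℝ) < N := by exact_mod_cast hN0
  have hN80 : (80:ℝ) < N := by
    rw [div_lt_iff₀ hN'] at hN; nlinarith
  have hVm : Measurable fun x : Torus => V (expT x) := hm.comp continuous_expT.measurable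
  set B := {x : Torus | V (expT x) < b - lam} with hB
  have hBm : MeasurableSet B := hVm measurableSet_Iio
  set I : ℕ → Set Torus := fun j => Metric.closedBall ((j / N : ℝ) : Torus) (1 / N) with hI
  have hIvol : ∀ j, volume.real (I j) = 2 / N := fun j => by
    rw [hI, measureReal_def, AddCircle.volume_closedBall, ENNReal.toReal_ofReal (by positivity),
      min_eq_right]
    · ring
    · rw [mul_one_div, div_le_one hN']; linarith
  have hcover : B ⊆ ⋃ j ∈ Finset.range N, B ∩ I j := fun x hx => by
    obtain ⟨j, hj, hxj⟩ := exists_norm_sub_natCast_div_le hN0 x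
    exact Set.mem_biUnion (Finset.mem_coe.2 (Finset.mem_range.2 hj)) ⟨hx, mem_closedBall_iff_norm.2 hxj⟩
  have hVi : Integrable fun x : Torus => V (expT x) := integrable_of_abs_le hVm fun x => hb _
  have hx₀ : ∀ j, ∃ x₀ ∈ I j, b - N * (κ + s₀) ≤ V (expT x₀) := fun j => by
    by_contra! hcon
    have hIm : MeasurableSet (I j) := Metric.isClosed_closedBall.measurableSet
    have h1 : ∫ x : Torus, V (expT x) ≤
        ∫ x : Torus, ((b + s₀) - (I j).indicator (fun _ => N * (κ + s₀) + s₀) x) := by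
      refine integral_mono hVi ((integrable_const _).sub
        ((integrable_const _).indicator hIm)) fun x => ?_
      by_cases hx : x ∈ I j
      · simp only [Set.indicator_of_mem hx]
        linarith [hcon x hx]
      · simp only [Set.indicator_of_notMem hx]
        linarith [hup₀ x]
    rw [integral_sub (integrable_const _) ((integrable_const _).indicator hIm),
      integral_indicator_const _ hIm, hIvol, integral_const, probReal_univ, one_smul,
      smul_eq_mul] at h1
    have h2 : 2 / (N:ℝ) * (N * (κ + s₀) + s₀) = 2 * (κ + s₀) + 2 / N * s₀ := by field_simp
    rw [h2] at h1
    have h3 : 2 / (N:ℝ) ≤ 1 := by rw [div_le_one hN']; linarith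
    have h4 : (0:ℝ) < 2 / N := by positivity
    nlinarith [mul_nonneg h4.le hs₀]
  have hloc : ∀ j, volume.real (B ∩ I j) ≤
      Real.exp (potentialConst / 2) * Real.exp (-lam / (4 * (s + N * (κ + s₀)))) := fun j => by
    obtain ⟨x₀, hx₀, hVx₀⟩ := hx₀ j
    have hBI : MeasurableSet (B ∩ I j) := hBm.inter Metric.isClosed_closedBall.measurableSet
    refine le_of_forall_pos_le_add fun ε hε => ?_
    obtain ⟨E, hEB, hE, hlt⟩ := hBI.exists_isCompact_lt_add (measure_ne_top volume _)
      (ENNReal.ofReal_pos.2 hε).ne'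
    have h1 := volume_real_le_of_isCompact (t := 1 / N) (m := N * (κ + s₀)) hh hV hm hb
      (by positivity) (by rwa [mul_one_div]) hs (by positivity) hlam
      (fun z hz => hup z (by rwa [mul_one_div] at hz))
      (mem_closedBall_iff_norm.1 hx₀) hVx₀ hE (fun x hx => mem_closedBall_iff_norm.1 (hEB hx).2)
      fun x hx => (hEB hx).1
    refine le_trans ?_ (add_le_add_left h1 ε)
    rw [measureReal_def, measureReal_def]
    refine ENNReal.toReal_le_of_le_ofReal (by positivity) ?_
    rw [ENNReal.ofReal_add ENNReal.toReal_nonneg hε.le, ENNReal.ofReal_toReal (measure_ne_top _ _)]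
    exact hlt.le
  calc volume.real B ≤ volume.real (⋃ j ∈ Finset.range N, B ∩ I j) :=
        measureReal_mono hcover (measure_ne_top _ _)
    _ ≤ ∑ j ∈ Finset.range N, volume.real (B ∩ I j) := measureReal_biUnion_finset_le _ _
    _ ≤ ∑ j ∈ Finset.range N,
        (Real.exp (potentialConst / 2) * Real.exp (-lam / (4 * (s + N * (κ + s₀))))) :=
        Finset.sum_le_sum fun j _ => hloc j
    _ = _ := by rw [Finset.sum_const, Finset.card_range, nsmul_eq_mul]

namespace UnitAddTorus

variable {d : Type*} [Fintype d]

lemma haarAddCircle_eq_volume : (AddCircle.haarAddCircle : Measure Torus) = volume := by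
  rw [AddCircle.volume_eq_smul_haarAddCircle, ENNReal.ofReal_one, one_smul]

lemma mFourierCoeff_eq (f : UnitAddTorus d → ℂ) (n : d → ℤ) :
    mFourierCoeff f n =
      ∫ t : d → Torus, mFourier (-n) t • f t ∂Measure.pi fun _ => (volume : Measure Torus) := by
  rw [← haarAddCircle_eq_volume]
  rfl

lemma mFourierCoeff_zero_eq (f : UnitAddTorus d → ℂ) :
    mFourierCoeff f 0 = ∫ t : d → Torus, f t ∂Measure.pi fun _ => (volume : Measure Torus) := by
  rw [mFourierCoeff_eq]
  simp [mFourier_zero]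

lemma mFourier_apply_add (n : d → ℤ) (x t : UnitAddTorus d) :
    mFourier n (x + t) = mFourier n x * mFourier n t := by
  simp [mFourier, fourier_apply, AddCircle.toCircle_add, Finset.prod_mul_distrib]

lemma mFourierCoeff_comp_add_right (f : UnitAddTorus d → ℂ) (t : UnitAddTorus d) (n : d → ℤ) :
    mFourierCoeff (fun x => f (x + t)) n = mFourier n t * mFourierCoeff f n := by
  rw [mFourierCoeff_eq, mFourierCoeff_eq, ← integral_const_mul]
  rw [← integral_add_right_eq_self (fun x => mFourier n t * (mFourier (-n) x • f x)) t]
  refine integral_congr_ae (Eventually.of_forall fun x => ?_)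
  have h : mFourier n t * mFourier (-n) t = 1 := by
    rw [← mFourier_add, add_neg_cancel, mFourier_zero]; rfl
  simp only [mFourier_apply_add, smul_eq_mul]
  linear_combination (-(mFourier (-n) x * f (x + t))) * h

lemma mFourierCoeff_sub {f g : UnitAddTorus d → ℂ} (hf : Continuous f) (hg : Continuous g)
    (n : d → ℤ) :
    mFourierCoeff (fun x => f x - g x) n = mFourierCoeff f n - mFourierCoeff g n := by
  have hi : ∀ {f : UnitAddTorus d → ℂ}, Continuous f → Integrable (fun t => mFourier (-n) t • f t)
      (Measure.pi fun _ => (volume : Measure Torus)) := fun {f} hf =>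
    ((mFourier (-n)).continuous.smul hf).integrable_of_hasCompactSupport
      (HasCompactSupport.of_compactSpace _)
  rw [mFourierCoeff_eq, mFourierCoeff_eq, mFourierCoeff_eq, ← integral_sub (hi hf) (hi hg)]
  simp only [smul_sub]

lemma sum_norm_sq_mFourierCoeff_le {f : UnitAddTorus d → ℂ} (hf : Continuous f) {M : ℝ}
    (hM : ∀ x, ‖f x‖ ≤ M) (F : Finset (d → ℤ)) : ∑ n ∈ F, ‖mFourierCoeff f n‖ ^ 2 ≤ M ^ 2 := by
  have hM0 : 0 ≤ M := (norm_nonneg _).trans (hM 0)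
  have h : HasSum (fun n => ‖mFourierCoeff f n‖ ^ 2)
      (∫ t : d → Torus, ‖f t‖ ^ 2 ∂Measure.pi fun _ => (volume : Measure Torus)) := by
    have h1 := hasSum_sq_mFourierCoeff (ContinuousMap.toLp 2
      (Measure.pi fun _ : d => AddCircle.haarAddCircle) ℂ (⟨f, hf⟩ : C(UnitAddTorus d, ℂ)))
    have h2 := mFourierCoeff_toLp (⟨f, hf⟩ : C(UnitAddTorus d, ℂ))
    simp only [volume] at h2
    simp only [h2, ContinuousMap.coe_mk] at h1
    rw [← haarAddCircle_eq_volume]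
    convert h1 using 1
    refine integral_congr_ae ?_
    filter_upwards [ContinuousMap.coeFn_toLp (𝕜 := ℂ) (p := 2)
      (Measure.pi fun _ : d => AddCircle.haarAddCircle) (⟨f, hf⟩ : C(UnitAddTorus d, ℂ))] with x hx
    exact congrArg (‖·‖ ^ 2) hx.symm
  refine (sum_le_hasSum F (fun _ _ => by positivity) h).trans ?_
  refine (integral_mono_of_nonneg (g := fun _ => M ^ 2) (Eventually.of_forall fun _ => by positivity)
    (integrable_const _) (Eventually.of_forall fun x => ?_)).trans ?_
  · exact pow_le_pow_left₀ (norm_nonneg _) (hM x) 2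
  · simp

/-- The difference operator in the direction `i` with step `s`. -/
def diff [DecidableEq d] (i : d) (s : ℝ) (f : UnitAddTorus d → ℂ) (x : UnitAddTorus d) : ℂ :=
  f (x + Pi.single i (s : Torus)) - f x

section Difference

variable [DecidableEq d] {f : UnitAddTorus d → ℂ}

lemma continuous_diff (hf : Continuous f) (i : d) (s : ℝ) : Continuous (diff i s f) :=
  (hf.comp (continuous_id.add continuous_const)).sub hf

lemma mFourier_single_eq (n : d → ℤ) (i : d) (s : ℝ) :
    mFourier n (Pi.single i (s : Torus)) = expT (n i • (s : Torus)) := by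
  rw [mFourier, ContinuousMap.coe_mk, Finset.prod_eq_single i]
  · rw [Pi.single_eq_same, fourier_apply, expT]
  · intro j _ hj
    rw [Pi.single_eq_of_ne hj, fourier_eval_zero]
  · simp

lemma mFourierCoeff_diff (hf : Continuous f) (i : d) (s : ℝ) (n : d → ℤ) :
    mFourierCoeff (diff i s f) n = (expT (n i • (s : Torus)) - 1) * mFourierCoeff f n := by
  have h := mFourierCoeff_sub (hf.comp (continuous_id.add (continuous_const
    (y := (Pi.single i (s : Torus) : UnitAddTorus d))))) hf n
  have h2 := mFourierCoeff_comp_add_right f (Pi.single i (s : Torus)) n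
  rw [mFourier_single_eq] at h2
  rw [sub_one_mul, ← h2]
  exact h

lemma four_mul_le_norm_expT_zsmul_sub_one {m : ℤ} {s : ℝ} (hs : 0 ≤ s) (hm : |(m : ℝ)| * s ≤ 1 / 2) :
    4 * (|(m : ℝ)| * s) ≤ ‖expT (m • (s : Torus)) - 1‖ := by
  refine le_trans (le_of_eq ?_) (four_mul_norm_le _)
  rw [← AddCircle.coe_zsmul, zsmul_eq_mul]
  have h : |(m : ℝ) * s| = |(m : ℝ)| * s := by rw [abs_mul, abs_of_nonneg hs]
  rw [(AddCircle.norm_coe_eq_abs_iff 1 one_ne_zero).2 (by rw [h]; simpa using hm), h]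

lemma exists_pos_forall_abs_mul_le (F : Finset (d → ℤ)) :
    ∃ s : ℝ, 0 < s ∧ ∀ n ∈ F, ∀ i, |(n i : ℝ)| * s ≤ 1 / 2 := by
  set S := ∑ n ∈ F, ∑ i, |(n i : ℝ)| with hS
  have h0 : 0 ≤ S := by positivity
  refine ⟨1 / (2 * (S + 1)), by positivity, fun n hn i => ?_⟩
  have h1 : |(n i : ℝ)| ≤ S :=
    (Finset.single_le_sum (f := fun i => |(n i : ℝ)|) (fun _ _ => abs_nonneg _)
      (Finset.mem_univ i)).trans
    (Finset.single_le_sum (f := fun n : d → ℤ => ∑ i, |(n i : ℝ)|) (fun _ _ => by positivity) hn)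
  rw [mul_one_div, div_le_div_iff₀ (by positivity) (by norm_num)]
  linarith

lemma sum_sq_mul_norm_sq_mFourierCoeff_le (hf : Continuous f) (i : d) {L : ℝ}
    (hL : ∀ s : ℝ, 0 < s → ∀ x, ‖diff i s f x‖ ≤ L * s) (F : Finset (d → ℤ)) :
    ∑ n ∈ F, (n i : ℝ) ^ 2 * ‖mFourierCoeff f n‖ ^ 2 ≤ L ^ 2 := by
  obtain ⟨s, hs, hF⟩ := exists_pos_forall_abs_mul_le F
  have h := sum_norm_sq_mFourierCoeff_le (continuous_diff hf i s) (hL s hs) F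
  refine le_of_mul_le_mul_right ?_ (pow_pos hs 2)
  rw [← mul_pow, Finset.sum_mul]
  refine (Finset.sum_le_sum fun n hn => ?_).trans h
  rw [mFourierCoeff_diff hf, norm_mul, mul_pow, ← sq_abs (n i : ℝ)]
  have h1 := four_mul_le_norm_expT_zsmul_sub_one hs.le (hF n hn i)
  calc |(n i : ℝ)| ^ 2 * ‖mFourierCoeff f n‖ ^ 2 * s ^ 2
      = (|(n i : ℝ)| * s) ^ 2 * ‖mFourierCoeff f n‖ ^ 2 := by ring
    _ ≤ _ := by
      gcongr
      nlinarith [abs_nonneg (n i : ℝ), mul_nonneg (abs_nonneg (n i : ℝ)) hs.le]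

lemma sum_sq_mul_sq_mul_norm_sq_mFourierCoeff_le (hf : Continuous f) (i j : d) {L : ℝ}
    (hL : ∀ s : ℝ, 0 < s → ∀ x, ‖diff i s (diff j s f) x‖ ≤ (L * s) ^ 2) (F : Finset (d → ℤ)) :
    ∑ n ∈ F, (n i : ℝ) ^ 2 * (n j : ℝ) ^ 2 * ‖mFourierCoeff f n‖ ^ 2 ≤ L ^ 4 := by
  obtain ⟨s, hs, hF⟩ := exists_pos_forall_abs_mul_le F
  have h := sum_norm_sq_mFourierCoeff_le (continuous_diff (continuous_diff hf j s) i s) (hL s hs) F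
  refine le_of_mul_le_mul_right ?_ (pow_pos hs 4)
  rw [← mul_pow, Finset.sum_mul, show (L * s) ^ 4 = ((L * s) ^ 2) ^ 2 by ring]
  refine (Finset.sum_le_sum fun n hn => ?_).trans h
  rw [mFourierCoeff_diff (continuous_diff hf j s), mFourierCoeff_diff hf, norm_mul, norm_mul,
    mul_pow, mul_pow, ← sq_abs (n i : ℝ), ← sq_abs (n j : ℝ)]
  have h1 := four_mul_le_norm_expT_zsmul_sub_one hs.le (hF n hn i)
  have h2 := four_mul_le_norm_expT_zsmul_sub_one hs.le (hF n hn j)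
  calc |(n i : ℝ)| ^ 2 * |(n j : ℝ)| ^ 2 * ‖mFourierCoeff f n‖ ^ 2 * s ^ 4
      = (|(n i : ℝ)| * s) ^ 2 * ((|(n j : ℝ)| * s) ^ 2 * ‖mFourierCoeff f n‖ ^ 2) := by ring
    _ ≤ _ := by
      gcongr
      · nlinarith [abs_nonneg (n i : ℝ), mul_nonneg (abs_nonneg (n i : ℝ)) hs.le]
      · nlinarith [abs_nonneg (n j : ℝ), mul_nonneg (abs_nonneg (n j : ℝ)) hs.le]

end Difference

/-- If the exponential sums along a finite family of points are small relative to the decay of the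
Fourier coefficients of `f`, then the average of `f` along this family is close to its mean. -/
lemma norm_average_sub_mFourierCoeff_zero_le {ι : Type*} {f : UnitAddTorus d → ℂ}
    (hf : Continuous f) (T : Finset ι) (hT : T.Nonempty) (p : ι → UnitAddTorus d)
    {w G : (d → ℤ) → ℝ} {B D S : ℝ} (hB0 : 0 ≤ B) (hD0 : 0 ≤ D) (hS0 : 0 ≤ S)
    (hw : ∀ n, 0 < w n) (hB : ∀ F : Finset (d → ℤ), ∑ n ∈ F, w n * ‖mFourierCoeff f n‖ ^ 2 ≤ B ^ 2)
    (hG : ∀ n, 1 ≤ w n * G n) (hS : ∀ F : Finset (d → ℤ), ∑ n ∈ F, G n ≤ S ^ 2)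
    (hW : ∀ n ≠ 0, ‖(T.card : ℂ)⁻¹ * ∑ k ∈ T, mFourier n (p k)‖ ^ 2 ≤ D ^ 2 * (w n * G n)) :
    ‖(T.card : ℂ)⁻¹ * ∑ k ∈ T, f (p k) - mFourierCoeff f 0‖ ≤ B * D * S := by
  classical
  have hT' : (T.card : ℂ) ≠ 0 := by exact_mod_cast hT.card_pos.ne'
  have hG0 : ∀ n, 0 < G n := fun n => by
    by_contra! h
    linarith [hG n, mul_nonpos_of_nonneg_of_nonpos (hw n).le h]
  have hCS : ∀ (W : (d → ℤ) → ℝ) (E : ℝ), 0 ≤ E → (∀ n, 0 ≤ W n) →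
      (∀ n, W n ^ 2 ≤ E ^ 2 * (w n * G n)) →
      ∀ F : Finset (d → ℤ), ∑ n ∈ F, ‖mFourierCoeff f n‖ * W n ≤ B * E * S := by
    intro W E hE hW0 hWE F
    have h1 := Finset.sum_sq_le_sum_mul_sum_of_sq_le_mul F
      (r := fun n => ‖mFourierCoeff f n‖ * W n) (f := fun n => w n * ‖mFourierCoeff f n‖ ^ 2)
      (g := fun n => E ^ 2 * G n) (fun n _ => mul_nonneg (hw n).le (by positivity))
      (fun n _ => mul_nonneg (by positivity) (hG0 n).le) (fun n _ => by
        rw [mul_pow]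
        calc _ ≤ ‖mFourierCoeff f n‖ ^ 2 * (E ^ 2 * (w n * G n)) := by gcongr; exact hWE n
          _ = _ := by ring)
    rw [← Finset.mul_sum] at h1
    refine le_of_sq_le_sq ?_ (by positivity)
    calc _ ≤ _ := h1
      _ ≤ B ^ 2 * (E ^ 2 * S ^ 2) := by
        gcongr
        · exact mul_nonneg (sq_nonneg _) (Finset.sum_nonneg fun n _ => (hG0 n).le)
        · exact hB F
        · exact hS F
      _ = _ := by ring
  have hsum : Summable (mFourierCoeff f) := by
    refine Summable.of_norm (summable_of_sum_le (c := B * 1 * S) (fun _ => norm_nonneg _) fun F => ?_)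
    simpa using hCS (fun _ => 1) 1 zero_le_one (fun _ => zero_le_one) (fun n => by simpa using hG n) F
  have h1 : HasSum (fun n => mFourierCoeff f n * ((T.card : ℂ)⁻¹ * ∑ k ∈ T, mFourier n (p k)))
      ((T.card : ℂ)⁻¹ * ∑ k ∈ T, f (p k)) := by
    have h2 := (hasSum_sum fun k (_ : k ∈ T) =>
      hasSum_mFourier_series_apply_of_summable (f := ⟨f, hf⟩) hsum (p k)).mul_left (T.card : ℂ)⁻¹
    refine h2.congr_fun fun n => ?_
    simp only [smul_eq_mul, ContinuousMap.coe_mk, Finset.mul_sum]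
    refine Finset.sum_congr rfl fun k _ => ?_
    ring
  have h2 := h1.sub (hasSum_ite_eq (0 : d → ℤ) (mFourierCoeff f 0))
  refine le_of_tendsto h2.norm (Eventually.of_forall fun F => ?_)
  refine (norm_sum_le _ _).trans (le_trans (Finset.sum_le_sum fun n _ => le_of_eq ?_)
    (hCS (fun n => if n = 0 then 0 else ‖(T.card : ℂ)⁻¹ * ∑ k ∈ T, mFourier n (p k)‖) D hD0
      (fun n => by split_ifs <;> positivity) (fun n => ?_) F))
  · split_ifs with h
    · subst h
      simp [mFourier_zero, hT']
    · rw [sub_zero, norm_mul]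
  · split_ifs with h
    · have := (hw n).le; have := (hG0 n).le
      rw [zero_pow two_ne_zero]; positivity
    · exact hW n h

end UnitAddTorus

/-- The frequencies `ω` with `‖nω‖ ≥ c n ^ (-(1 + σ))` for all positive integers `n`. -/
def DiophExp (c σ : ℝ) : Set Torus :=
  {ω | ∀ n : ℕ, 0 < n → c * (n : ℝ) ^ (-(1 + σ)) ≤ ‖n • ω‖}

lemma diophSet_subset_diophExp {ε σ : ℝ} (hε : 0 < ε) (hσ : 0 < σ) :
    DiophSet ε ⊆ DiophExp (ε / (1 + 2 / σ) ^ 2) σ := fun ω hω n hn => by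
  have hn1 : (1:ℝ) ≤ n := by exact_mod_cast hn
  have hn0 : (0:ℝ) < n := by linarith
  have h := hω n hn
  rw [natCast_zsmul] at h
  refine le_trans ?_ h
  have hlog := Real.log_nonneg hn1
  have h1 : 1 + Real.log n ≤ (1 + 2 / σ) * (n:ℝ) ^ (σ / 2) := by
    have h2 := Real.log_le_rpow_div hn0.le (half_pos hσ)
    have h3 : 1 ≤ (n:ℝ) ^ (σ / 2) := Real.one_le_rpow hn1 (half_pos hσ).le
    calc _ ≤ (n:ℝ) ^ (σ / 2) + (n:ℝ) ^ (σ / 2) / (σ / 2) := add_le_add h3 h2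
      _ = _ := by field_simp
  have h4 : (1 + Real.log n) ^ 2 ≤ (1 + 2 / σ) ^ 2 * (n:ℝ) ^ σ := by
    calc _ ≤ ((1 + 2 / σ) * (n:ℝ) ^ (σ / 2)) ^ 2 := by gcongr
      _ = _ := by
        rw [mul_pow, ← Real.rpow_natCast ((n:ℝ) ^ (σ / 2)) 2, ← Real.rpow_mul hn0.le]
        congr 2
        push_cast
        ring
  rw [neg_add, Real.rpow_add hn0, Real.rpow_neg_one, Real.rpow_neg hn0.le]
  calc ε / (1 + 2 / σ) ^ 2 * ((n:ℝ)⁻¹ * ((n:ℝ) ^ σ)⁻¹)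
      = ε * (n:ℝ)⁻¹ * ((1 + 2 / σ) ^ 2 * (n:ℝ) ^ σ)⁻¹ := by rw [mul_inv]; ring
    _ ≤ _ := by gcongr

lemma exists_real_rep (x : Torus) : ∃ y : ℝ, (y : Torus) = x ∧ ‖x‖ = |y| := by
  obtain ⟨y, rfl⟩ := QuotientAddGroup.mk_surjective x
  have h : (((y - round y : ℝ)) : Torus) = (y : Torus) := by
    have : ((round y : ℝ) : Torus) = 0 := by
      rw [← mul_one ((round y : ℤ) : ℝ), ← zsmul_eq_mul, AddCircle.coe_zsmul,
        AddCircle.coe_period, smul_zero]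
    rw [AddCircle.coe_sub, this, sub_zero]
  refine ⟨y - round y, h, ?_⟩
  change ‖(y : Torus)‖ = _
  rw [← h, (AddCircle.norm_coe_eq_abs_iff 1 one_ne_zero).2]
  simpa using abs_sub_round y

lemma norm_torus_coe_le (y : ℝ) : ‖(y : Torus)‖ ≤ |y| :=
  QuotientAddGroup.norm_mk_le_norm (m := y)

lemma sum_inv_norm_nsmul_le {θ : Torus} {γ σ : ℝ} {N : ℕ} (hγ : 0 < γ) (hσ : 0 < σ)
    (h : ∀ j, 1 ≤ j → j < N → γ ≤ ‖j • θ‖) :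
    ∑ j ∈ Finset.Ico 1 N, ‖j • θ‖⁻¹ ≤ (2 / γ) ^ (1 + σ) * ∑' z : ℤ, |(z : ℝ)| ^ (-(1 + σ)) := by
  choose y hy hyn using fun j : ℕ => exists_real_rep (j • θ)
  set z : ℕ → ℤ := fun j => ⌊y j / γ⌋ with hz
  have hsum : Summable fun z : ℤ => |(z : ℝ)| ^ (-(1 + σ)) :=
    Real.summable_abs_int_rpow (by linarith)
  have hlt : ∀ i ∈ Finset.Ico 1 N, ∀ j ∈ Finset.Ico 1 N, i < j → z i ≠ z j := by
    intro i hi j hj hij he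
    rw [Finset.mem_Ico] at hi hj
    have h1 := Int.abs_sub_lt_one_of_floor_eq_floor he
    rw [← sub_div, abs_div, abs_of_pos hγ, div_lt_one hγ] at h1
    have h2 := h (j - i) (by omega) (by omega)
    have h3 : (j - i) • θ = j • θ - i • θ := by
      rw [eq_sub_iff_add_eq, ← add_nsmul, Nat.sub_add_cancel hij.le]
    rw [h3, ← hy i, ← hy j, ← AddCircle.coe_sub] at h2
    rw [abs_sub_comm] at h1
    linarith [norm_torus_coe_le (y j - y i)]
  have hinj : Set.InjOn z (Finset.Ico 1 N) := fun i hi j hj he => by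
    rcases lt_trichotomy i j with hij | hij | hij
    · exact absurd he (hlt i hi j hj hij)
    · exact hij
    · exact absurd he.symm (hlt j hj i hi hij)
  have hterm : ∀ j ∈ Finset.Ico 1 N,
      ‖j • θ‖⁻¹ ≤ (2 / γ) ^ (1 + σ) * |(z j : ℝ)| ^ (-(1 + σ)) := by
    intro j hj
    rw [Finset.mem_Ico] at hj
    have h1 := h j hj.1 hj.2
    have hpos : 0 < ‖j • θ‖ := hγ.trans_le h1
    have hf1 := Int.floor_le (y j / γ)
    have hf2 := Int.lt_floor_add_one (y j / γ)
    change (z j : ℝ) ≤ _ at hf1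
    change _ < (z j : ℝ) + 1 at hf2
    rw [le_div_iff₀ hγ] at hf1
    rw [div_lt_iff₀ hγ] at hf2
    rw [hyn] at h1
    have h2 : 0 < |(z j : ℝ)| ∧ γ * |(z j : ℝ)| / 2 ≤ |y j| := by
      rcases le_total 0 (y j) with h0 | h0
      · rw [abs_of_nonneg h0] at h1 ⊢
        have : (0:ℝ) < z j := by
          by_contra! hc
          have : z j ≤ 0 := by exact_mod_cast hc
          have : (1:ℤ) ≤ z j := Int.le_floor.2 (by rw [Int.cast_one, le_div_iff₀ hγ]; linarith)
          omega
        rw [abs_of_pos this]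
        exact ⟨this, by nlinarith⟩
      · rw [abs_of_nonpos h0] at h1 ⊢
        have : (z j : ℝ) ≤ -1 := by
          have : z j ≤ -1 := Int.floor_le_iff.2 (by rw [div_lt_iff₀ hγ]; push_cast; linarith)
          exact_mod_cast this
        rw [abs_of_neg (by linarith)]
        exact ⟨by linarith, by nlinarith⟩
    rw [← hyn] at h2
    have h3 : ‖j • θ‖⁻¹ ≤ ‖j • θ‖⁻¹ ^ (1 + σ) := by
      refine Real.self_le_rpow_of_one_le ?_ (by linarith)
      rw [one_le_inv₀ hpos]
      linarith [norm_torus_le (j • θ)]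
    refine h3.trans ?_
    rw [Real.rpow_neg (abs_nonneg _), ← Real.inv_rpow (abs_nonneg _),
      ← Real.mul_rpow (by positivity) (by positivity)]
    refine Real.rpow_le_rpow (by positivity) ?_ (by linarith)
    have h4 := h2.1
    calc ‖j • θ‖⁻¹ ≤ (γ * |(z j : ℝ)| / 2)⁻¹ := inv_anti₀ (by positivity) h2.2
      _ = _ := by field_simp
  calc _ ≤ ∑ j ∈ Finset.Ico 1 N, (2 / γ) ^ (1 + σ) * |(z j : ℝ)| ^ (-(1 + σ)) :=
        Finset.sum_le_sum hterm
    _ = (2 / γ) ^ (1 + σ) * ∑ j ∈ Finset.Ico 1 N, |(z j : ℝ)| ^ (-(1 + σ)) := by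
        rw [Finset.mul_sum]
    _ ≤ _ := by
        gcongr
        rw [← Finset.sum_image (f := fun z : ℤ => |(z : ℝ)| ^ (-(1 + σ))) hinj]
        exact hsum.sum_le_tsum _ fun _ _ => by positivity

lemma expT_nsmul (k : ℕ) (θ : Torus) : expT (k • θ) = expT θ ^ k := by
  rw [expT, expT, AddCircle.toCircle_nsmul, Circle.coe_pow]

lemma norm_sum_expT_le {θ : Torus} (hθ : 0 < ‖θ‖) (n : ℕ) :
    ‖∑ k ∈ Finset.range n, expT (k • θ)‖ ≤ ‖θ‖⁻¹ / 2 := by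
  have h1 := four_mul_norm_le θ
  have h2 : expT θ ≠ 1 := fun h => by rw [h, sub_self, norm_zero] at h1; linarith
  simp_rw [expT_nsmul]
  rw [geom_sum_eq h2, norm_div]
  have h3 : ‖expT θ ^ n - 1‖ ≤ 2 := by
    refine (norm_sub_le _ _).trans ?_
    rw [norm_pow, norm_expT, one_pow, norm_one]; norm_num
  calc _ ≤ 2 / (4 * ‖θ‖) := by gcongr
    _ = _ := by field_simp; norm_num

lemma norm_sum_sq_le (z : ℕ → ℂ) (hz : ∀ k, ‖z k‖ ≤ 1) (K : ℕ) :
    ‖∑ k ∈ Finset.range K, z k‖ ^ 2 ≤ K + 2 * ∑ h ∈ Finset.range (K - 1),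
      ‖∑ k ∈ Finset.range (K - (h + 1)), z (k + (h + 1)) * (starRingEnd ℂ) (z k)‖ := by
  set Q : ℕ → ℂ := fun K => ∑ h ∈ Finset.range K,
    ∑ k ∈ Finset.range (K - (h + 1)), z (k + (h + 1)) * (starRingEnd ℂ) (z k) with hQ
  have hQs : ∀ K, Q (K + 1) = Q K + z K * (starRingEnd ℂ) (∑ k ∈ Finset.range K, z k) := fun K => by
    have h1 : ∀ h ∈ Finset.range K,
        ∑ k ∈ Finset.range (K + 1 - (h + 1)), z (k + (h + 1)) * (starRingEnd ℂ) (z k) =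
        ∑ k ∈ Finset.range (K - (h + 1)), z (k + (h + 1)) * (starRingEnd ℂ) (z k) +
          z K * (starRingEnd ℂ) (z (K - 1 - h)) := fun h hh => by
      rw [Finset.mem_range] at hh
      rw [show K + 1 - (h + 1) = K - (h + 1) + 1 by omega, Finset.sum_range_succ,
        show K - (h + 1) + (h + 1) = K by omega, show K - (h + 1) = K - 1 - h by omega]
    simp only [hQ]
    rw [Finset.sum_range_succ, Nat.sub_self, Finset.sum_range_zero, add_zero,
      Finset.sum_congr rfl h1, Finset.sum_add_distrib, ← Finset.mul_sum, ← map_sum,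
      Finset.sum_range_reflect]
  have hS : ∀ K, ‖∑ k ∈ Finset.range K, z k‖ ^ 2 ≤ K + 2 * (Q K).re := fun K => by
    induction K with
    | zero => simp [hQ]
    | succ K ih =>
      rw [hQs, Finset.sum_range_succ, ← Complex.normSq_eq_norm_sq, Complex.normSq_add,
        Complex.normSq_eq_norm_sq, Complex.normSq_eq_norm_sq, Complex.add_re, mul_comm (z K)]
      have h2 : ((∑ k ∈ Finset.range K, z k) * (starRingEnd ℂ) (z K)).re =
          ((starRingEnd ℂ) (∑ k ∈ Finset.range K, z k) * z K).re := by
        rw [← Complex.conj_re, map_mul, Complex.conj_conj]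
      rw [h2]
      push_cast
      nlinarith [hz K, norm_nonneg (z K)]
  refine (hS K).trans ?_
  gcongr
  refine (Complex.re_le_norm _).trans ?_
  rcases K with _ | K
  · simp [hQ]
  · simp only [hQ]
    rw [Finset.sum_range_succ, Nat.sub_self, Finset.sum_range_zero, add_zero]
    exact norm_sum_le _ _

lemma skewShift_iterate (ω : Torus) (p : Torus2) (k : ℕ) :
    (skewShift ω)^[k] p = (p.1 + k • p.2 + k.choose 2 • ω, p.2 + k • ω) := by
  induction k with
  | zero => simp
  | succ k ih =>
    rw [Function.iterate_succ_apply', ih, skewShift, Nat.choose_succ_succ' k 1, Nat.choose_one_right]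
    ext <;> simp only [add_nsmul, one_nsmul] <;> abel

/-- The value at step `k` of the character of index `(l, m)` along a skew-shift orbit. -/
def skewPhase (ω : Torus) (p : Torus2) (l m : ℤ) (k : ℕ) : Torus :=
  l • ((skewShift ω)^[k] p).1 + m • ((skewShift ω)^[k] p).2

lemma choose_two_add (k h : ℕ) : (k + h).choose 2 = k.choose 2 + k * h + h.choose 2 := by
  induction h with
  | zero => simp
  | succ h ih =>
    rw [← add_assoc, Nat.choose_succ_succ' (k + h) 1, Nat.choose_succ_succ' h 1, ih,
      Nat.choose_one_right, Nat.choose_one_right]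
    ring

lemma skewPhase_add (ω : Torus) (p : Torus2) (l m : ℤ) (k h : ℕ) :
    skewPhase ω p l m (k + h) = k • (h • (l • ω)) + (l • (h • p.2 + h.choose 2 • ω) + m • (h • ω))
      + skewPhase ω p l m k := by
  simp only [skewPhase, skewShift_iterate, choose_two_add, add_nsmul, zsmul_add, mul_nsmul' ω k h]
  rw [smul_comm l k (h • ω), smul_comm l h ω]
  abel

lemma conj_expT (x : Torus) : (starRingEnd ℂ) (expT x) = expT (-x) := by
  rw [expT, expT, AddCircle.toCircle_neg, Circle.coe_inv_eq_conj]

lemma norm_zsmul_ge {ω : Torus} {c σ : ℝ} (hω : ω ∈ DiophExp c σ) {l : ℤ} (hl : l ≠ 0) :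
    c * |(l : ℝ)| ^ (-(1 + σ)) ≤ ‖l • ω‖ := by
  have h := hω l.natAbs (Int.natAbs_pos.2 hl)
  rw [Nat.cast_natAbs, Int.cast_abs] at h
  refine h.trans (le_of_eq ?_)
  rcases Int.natAbs_eq l with h1 | h1
  · conv_rhs => rw [h1, natCast_zsmul]
  · conv_rhs => rw [h1, neg_zsmul, natCast_zsmul, norm_neg]

lemma sum_Icc_one_eq_sum_range {M : Type*} [AddCommMonoid M] (f : ℕ → M) (K : ℕ) :
    ∑ k ∈ Finset.Icc 1 K, f k = ∑ k ∈ Finset.range K, f (k + 1) := by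
  rw [show Finset.Icc 1 K = Finset.Ico 1 (K + 1) by ext; simp, Finset.sum_Ico_eq_sum_range,
    Nat.add_sub_cancel]
  simp only [add_comm]

lemma norm_inv_mul_sum_expT_le_one (K : ℕ) (φ : ℕ → Torus) :
    ‖(K : ℂ)⁻¹ * ∑ k ∈ Finset.Icc 1 K, expT (φ k)‖ ≤ 1 := by
  rcases K.eq_zero_or_pos with rfl | hK
  · simp
  have hK' : (0:ℝ) < K := by exact_mod_cast hK
  rw [norm_mul, norm_inv, Complex.norm_natCast, inv_mul_le_iff₀ hK', mul_one]
  refine (norm_sum_le _ _).trans ?_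
  simp [norm_expT]

section

variable {ω : Torus} {c σ : ℝ}

lemma norm_average_expT_rotation_le (hω : ω ∈ DiophExp c σ) (hc : 0 < c) {K : ℕ} (hK : 0 < K)
    {m : ℤ} (hm : m ≠ 0) (y : Torus) :
    ‖(K : ℂ)⁻¹ * ∑ k ∈ Finset.Icc 1 K, expT (m • (y + k • ω))‖ ≤
      c⁻¹ * |(m : ℝ)| ^ (1 + σ) * (K : ℝ)⁻¹ := by
  have hm' : 0 < |(m : ℝ)| := abs_pos.2 (by exact_mod_cast hm)
  have h1 := norm_zsmul_ge hω hm
  have h2 : 0 < c * |(m : ℝ)| ^ (-(1 + σ)) := by positivity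
  have h3 : ∑ k ∈ Finset.Icc 1 K, expT (m • (y + k • ω)) =
      expT (m • (y + ω)) * ∑ k ∈ Finset.range K, expT (k • (m • ω)) := by
    rw [sum_Icc_one_eq_sum_range, Finset.mul_sum]
    refine Finset.sum_congr rfl fun k _ => ?_
    rw [← expT_add]
    congr 1
    rw [smul_comm k m ω, ← zsmul_add, add_nsmul, one_nsmul]
    congr 1
    abel
  rw [h3, norm_mul, norm_mul, norm_expT, one_mul, norm_inv, Complex.norm_natCast, mul_comm]
  have h4 := norm_sum_expT_le (h2.trans_le h1) K
  gcongr
  refine h4.trans ?_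
  calc ‖m • ω‖⁻¹ / 2 ≤ ‖m • ω‖⁻¹ := half_le_self (by positivity)
    _ ≤ (c * |(m : ℝ)| ^ (-(1 + σ)))⁻¹ := inv_anti₀ h2 h1
    _ = _ := by rw [mul_inv, Real.rpow_neg hm'.le, inv_inv]

/-- The sum over nonzero integers of `|z| ^ (-(1 + σ))`. -/
def zetaSum (σ : ℝ) : ℝ := ∑' z : ℤ, |(z : ℝ)| ^ (-(1 + σ))

lemma zetaSum_nonneg (σ : ℝ) : 0 ≤ zetaSum σ := tsum_nonneg fun _ => by positivity

lemma norm_sum_skewPhase_sq_le (hω : ω ∈ DiophExp c σ) (hc : 0 < c) (hσ : 0 < σ) (hσ' : σ ≤ 1)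
    {K : ℕ} (hK : 0 < K) {l : ℤ} (hl : l ≠ 0) (m : ℤ) (p : Torus2) :
    ‖∑ k ∈ Finset.Icc 1 K, expT (skewPhase ω p l m k)‖ ^ 2 ≤
      (1 + zetaSum σ * (2 / c) ^ 2) * (|(l : ℝ)| * K) ^ (1 + 3 * σ) := by
  have hl1 : 1 ≤ |(l : ℝ)| := by exact_mod_cast Int.one_le_abs hl
  have hK1 : (1:ℝ) ≤ K := by exact_mod_cast hK
  have hlK : 1 ≤ |(l : ℝ)| * K := by nlinarith
  have hc2 : 1 ≤ 2 / c := by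
    have := hω 1 one_pos
    rw [Nat.cast_one, Real.one_rpow, one_nsmul] at this
    rw [le_div_iff₀ hc]; linarith [norm_torus_le ω]
  set θ := l • ω with hθ
  set γ := c * (|(l : ℝ)| * K) ^ (-(1 + σ)) with hγ
  have hγ0 : 0 < γ := by positivity
  have hθγ : ∀ j, 1 ≤ j → j < K → γ ≤ ‖j • θ‖ := fun j hj1 hjK => by
    have h := norm_zsmul_ge hω (l := l * j) (mul_ne_zero hl (by omega))
    have he : (l * (j : ℤ)) • ω = j • θ := by rw [mul_comm, mul_smul, natCast_zsmul]
    rw [he] at h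
    refine le_trans ?_ h
    have hj : (1:ℝ) ≤ j := by exact_mod_cast hj1
    have hjK' : (j:ℝ) ≤ K := by exact_mod_cast hjK.le
    rw [hγ]
    push_cast
    rw [abs_mul, Nat.abs_cast]
    refine mul_le_mul_of_nonneg_left (Real.rpow_le_rpow_of_nonpos (by positivity) ?_ (by linarith))
      hc.le
    gcongr
  rw [sum_Icc_one_eq_sum_range]
  refine (norm_sum_sq_le _ (fun k => (norm_expT _).le) K).trans ?_
  have h1 : ∀ h ∈ Finset.range (K - 1), ‖∑ k ∈ Finset.range (K - (h + 1)),
      expT (skewPhase ω p l m (k + (h + 1) + 1)) *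
        (starRingEnd ℂ) (expT (skewPhase ω p l m (k + 1)))‖ ≤ ‖(h + 1) • θ‖⁻¹ / 2 := by
    intro h hh
    rw [Finset.mem_range] at hh
    have h2 : ∀ k, expT (skewPhase ω p l m (k + (h + 1) + 1)) *
        (starRingEnd ℂ) (expT (skewPhase ω p l m (k + 1))) =
        expT ((h + 1) • θ + (l • ((h + 1) • p.2 + (h + 1).choose 2 • ω) + m • ((h + 1) • ω))) *
          expT (k • ((h + 1) • θ)) := fun k => by
      rw [add_right_comm, skewPhase_add, conj_expT, ← expT_add, ← expT_add, add_nsmul, one_nsmul]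
      congr 1
      abel
    simp_rw [h2]
    rw [← Finset.mul_sum, norm_mul, norm_expT, one_mul]
    exact norm_sum_expT_le (hγ0.trans_le (hθγ _ (by omega) (by omega))) _
  have h3 : ∑ h ∈ Finset.range (K - 1), ‖(h + 1) • θ‖⁻¹ ≤ (2 / γ) ^ (1 + σ) * zetaSum σ := by
    refine le_trans (le_of_eq ?_) (sum_inv_norm_nsmul_le hγ0 hσ hθγ)
    rw [Finset.sum_Ico_eq_sum_range]
    simp only [add_comm]
  have h4 : (2 / γ) ^ (1 + σ) ≤ (2 / c) ^ 2 * (|(l : ℝ)| * K) ^ (1 + 3 * σ) := by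
    have h5 : 2 / γ = 2 / c * (|(l : ℝ)| * K) ^ (1 + σ) := by
      rw [hγ, Real.rpow_neg (by positivity)]; field_simp
    rw [h5, Real.mul_rpow (by positivity) (by positivity), ← Real.rpow_mul (by positivity)]
    gcongr
    · rw [← Real.rpow_natCast]
      exact Real.rpow_le_rpow_of_exponent_le hc2 (by push_cast; linarith)
    · nlinarith
  have h5 : (K : ℝ) ≤ (|(l : ℝ)| * K) ^ (1 + 3 * σ) :=
    calc (K : ℝ) ≤ |(l : ℝ)| * K := by nlinarith
      _ ≤ _ := Real.self_le_rpow_of_one_le hlK (by linarith)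
  calc _ ≤ (K : ℝ) + 2 * ∑ h ∈ Finset.range (K - 1), ‖(h + 1) • θ‖⁻¹ / 2 := by
        gcongr with h hh; exact h1 h hh
    _ = K + ∑ h ∈ Finset.range (K - 1), ‖(h + 1) • θ‖⁻¹ := by
        rw [← Finset.sum_div]; ring
    _ ≤ (|(l : ℝ)| * K) ^ (1 + 3 * σ) +
        (2 / c) ^ 2 * (|(l : ℝ)| * K) ^ (1 + 3 * σ) * zetaSum σ := by
        have := zetaSum_nonneg σ
        refine add_le_add h5 (h3.trans ?_)
        gcongr
    _ = _ := by ring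

/-- A function on `ℤ` whose powers control the exponential sums. -/
def japanese (m : ℤ) : ℝ := 1 + (m : ℝ) ^ 2

lemma one_le_japanese (m : ℤ) : 1 ≤ japanese m := by unfold japanese; nlinarith [sq_nonneg (m : ℝ)]

lemma abs_rpow_le_japanese {m : ℤ} {a : ℝ} (ha : 0 ≤ a) :
    |(m : ℝ)| ^ (2 * a) ≤ japanese m ^ a := by
  rw [Real.rpow_mul (abs_nonneg _), Real.rpow_two, sq_abs]
  exact Real.rpow_le_rpow (sq_nonneg _) (by unfold japanese; linarith) ha

lemma norm_average_skewPhase_sq_le (hω : ω ∈ DiophExp c σ) (hc : 0 < c) (hσ : 0 < σ)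
    (hσ' : σ ≤ 1 / 10) {K : ℕ} (hK : 0 < K) {l m : ℤ} (hlm : l ≠ 0 ∨ m ≠ 0) (p : Torus2) :
    ‖(K : ℂ)⁻¹ * ∑ k ∈ Finset.Icc 1 K, expT (skewPhase ω p l m k)‖ ^ 2 ≤
      (1 + c⁻¹ + zetaSum σ * (2 / c) ^ 2) * (K : ℝ) ^ (-1 + 8 * σ) *
        (japanese l * japanese m) ^ (1 / 2 - σ) := by
  have hK1 : (1:ℝ) ≤ K := by exact_mod_cast hK
  have hK0 : (0:ℝ) < K := by linarith
  have hW1 := norm_inv_mul_sum_expT_le_one K (skewPhase ω p l m)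
  set W := ‖(K : ℂ)⁻¹ * ∑ k ∈ Finset.Icc 1 K, expT (skewPhase ω p l m k)‖ with hW
  have hW0 : 0 ≤ W := norm_nonneg _
  have hjl := one_le_japanese l
  have hjm := one_le_japanese m
  have hz := zetaSum_nonneg σ
  have hinter : ∀ X : ℝ, W ^ 2 ≤ X → W ^ 2 ≤ X ^ (1 - 5 * σ) := fun X hX => by
    calc W ^ 2 ≤ (W ^ 2) ^ (1 - 5 * σ) :=
          Real.self_le_rpow_of_le_one (sq_nonneg _) (by nlinarith) (by linarith)
      _ ≤ _ := Real.rpow_le_rpow (sq_nonneg _) hX (by linarith)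
  have hcst : ∀ A : ℝ, 1 ≤ A → A ≤ 1 + c⁻¹ + zetaSum σ * (2 / c) ^ 2 →
      A ^ (1 - 5 * σ) ≤ 1 + c⁻¹ + zetaSum σ * (2 / c) ^ 2 := fun A hA hA' =>
    (Real.rpow_le_self_of_one_le hA (by linarith)).trans hA'
  have hci : 0 < c⁻¹ := by positivity
  by_cases hl : l = 0
  · subst hl
    have hm : m ≠ 0 := by simpa using hlm
    have hm1 : 1 ≤ |(m : ℝ)| := by exact_mod_cast Int.one_le_abs hm
    have h1 := norm_average_expT_rotation_le hω hc hK hm p.2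
    have h2 : W ≤ c⁻¹ * |(m : ℝ)| ^ (1 + σ) * (K : ℝ)⁻¹ := by
      simpa only [hW, skewPhase, skewShift_iterate, zero_zsmul, zero_add] using h1
    have h3 : W ^ 2 ≤ (1 + c⁻¹) * |(m : ℝ)| ^ (1 + σ) * (K : ℝ)⁻¹ := by
      calc W ^ 2 ≤ W := by nlinarith
        _ ≤ _ := h2
        _ ≤ _ := by gcongr; linarith
    refine (hinter _ h3).trans ?_
    rw [Real.mul_rpow (by positivity) (by positivity), Real.mul_rpow (by positivity) (by positivity),
      Real.inv_rpow hK0.le, ← Real.rpow_neg hK0.le, ← Real.rpow_mul (by positivity), mul_right_comm]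
    gcongr
    · exact hcst _ (by linarith) (by nlinarith [mul_nonneg hz (sq_nonneg (2 / c))])
    · linarith
    · calc |(m : ℝ)| ^ ((1 + σ) * (1 - 5 * σ)) ≤ |(m : ℝ)| ^ (2 * (1 / 2 - σ)) :=
            Real.rpow_le_rpow_of_exponent_le hm1 (by nlinarith)
        _ ≤ japanese m ^ (1 / 2 - σ) := abs_rpow_le_japanese (by linarith)
        _ ≤ _ := by
          refine Real.rpow_le_rpow (by linarith) (by nlinarith) (by linarith)
  · have hl1 : 1 ≤ |(l : ℝ)| := by exact_mod_cast Int.one_le_abs hl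
    have h1 := norm_sum_skewPhase_sq_le hω hc hσ (by linarith) hK hl m p
    have h3 : W ^ 2 ≤ (1 + zetaSum σ * (2 / c) ^ 2) * |(l : ℝ)| ^ (1 + 3 * σ) *
        (K : ℝ) ^ (-1 + 3 * σ) := by
      rw [hW, norm_mul, norm_inv, Complex.norm_natCast, mul_pow, inv_pow, inv_mul_le_iff₀ (by positivity)]
      refine h1.trans (le_of_eq ?_)
      rw [Real.mul_rpow (by positivity) hK0.le, show 1 + 3 * σ = 2 + (-1 + 3 * σ) by ring,
        Real.rpow_add hK0, Real.rpow_two]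
      ring
    refine (hinter _ h3).trans ?_
    rw [Real.mul_rpow (by positivity) (by positivity), Real.mul_rpow (by positivity) (by positivity),
      ← Real.rpow_mul hK0.le, ← Real.rpow_mul (by positivity), mul_right_comm]
    gcongr
    · exact hcst _ (by nlinarith [mul_nonneg hz (sq_nonneg (2 / c))]) (by linarith)
    · nlinarith
    · calc |(l : ℝ)| ^ ((1 + 3 * σ) * (1 - 5 * σ)) ≤ |(l : ℝ)| ^ (2 * (1 / 2 - σ)) :=
            Real.rpow_le_rpow_of_exponent_le hl1 (by nlinarith)
        _ ≤ japanese l ^ (1 / 2 - σ) := abs_rpow_le_japanese (by linarith)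
        _ ≤ _ := by
          refine Real.rpow_le_rpow (by linarith) (by nlinarith) (by linarith)

lemma exists_sum_japanese_rpow_le {s : ℝ} (hs : 1 / 2 < s) :
    ∃ S : ℝ, 0 ≤ S ∧ ∀ F : Finset ℤ, ∑ m ∈ F, japanese m ^ (-s) ≤ S := by
  have hsum : Summable fun z : ℤ => |(z : ℝ)| ^ (-(2 * s)) :=
    Real.summable_abs_int_rpow (by linarith)
  refine ⟨1 + ∑' z : ℤ, |(z : ℝ)| ^ (-(2 * s)), add_nonneg zero_le_one
    (tsum_nonneg fun _ => by positivity), fun F => ?_⟩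
  calc ∑ m ∈ F, japanese m ^ (-s)
      ≤ ∑ m ∈ F, ((if m = 0 then 1 else 0) + |(m : ℝ)| ^ (-(2 * s))) := by
        refine Finset.sum_le_sum fun m _ => ?_
        split_ifs with h
        · have := Real.rpow_le_one_of_one_le_of_nonpos (one_le_japanese m)
            (by linarith : -s ≤ 0)
          have : 0 ≤ |(m : ℝ)| ^ (-(2 * s)) := by positivity
          linarith
        · have hm : 0 < |(m : ℝ)| := abs_pos.2 (by exact_mod_cast h)
          rw [zero_add, Real.rpow_neg (abs_nonneg _),
            Real.rpow_neg (by linarith [one_le_japanese m])]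
          exact inv_anti₀ (by positivity) (abs_rpow_le_japanese (by linarith))
    _ ≤ _ := by
        rw [Finset.sum_add_distrib]
        refine add_le_add ?_ (hsum.sum_le_tsum _ fun _ _ => by positivity)
        rw [Finset.sum_ite_eq']
        split_ifs <;> norm_num

end

lemma sum_mul_apply_fin_two_le {g : ℤ → ℝ} (hg : ∀ m, 0 ≤ g m) {S : ℝ} (hS : 0 ≤ S)
    (h : ∀ F : Finset ℤ, ∑ m ∈ F, g m ≤ S) (F : Finset (Fin 2 → ℤ)) :
    ∑ n ∈ F, g (n 0) * g (n 1) ≤ S ^ 2 := by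
  have hinj : Set.InjOn (fun n : Fin 2 → ℤ => (n 0, n 1)) F := fun a _ b _ hab => by
    rw [Prod.mk.injEq] at hab
    ext i
    fin_cases i
    · exact hab.1
    · exact hab.2
  rw [← Finset.sum_image (f := fun q : ℤ × ℤ => g q.1 * g q.2) hinj]
  calc _ ≤ ∑ q ∈ F.image (fun n => n 0) ×ˢ F.image (fun n => n 1), g q.1 * g q.2 := by
        refine Finset.sum_le_sum_of_subset_of_nonneg (fun q hq => ?_)
          fun q _ _ => mul_nonneg (hg _) (hg _)
        obtain ⟨n, hn, rfl⟩ := Finset.mem_image.1 hq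
        exact Finset.mem_product.2 ⟨Finset.mem_image_of_mem _ hn, Finset.mem_image_of_mem _ hn⟩
    _ = (∑ m ∈ F.image (fun n => n 0), g m) * ∑ m ∈ F.image (fun n => n 1), g m := by
        rw [Finset.sum_mul_sum, Finset.sum_product]
    _ ≤ S ^ 2 := by
        rw [sq]
        exact mul_le_mul (h _) (h _) (Finset.sum_nonneg fun m _ => hg m) hS

/-- Equidistribution of skew-shift orbits for functions with bounded mixed differences. -/
lemma exists_abs_average_skewShift_sub_integral_le {c σ : ℝ} (hc : 0 < c) (hσ : 0 < σ)
    (hσ' : σ ≤ 1 / 10) : ∃ C : ℝ, 0 ≤ C ∧ ∀ ω ∈ DiophExp c σ, ∀ Φ : Torus2 → ℝ, Continuous Φ →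
      (∀ q, |Φ q| ≤ 1) → ∀ L : ℝ, 1 ≤ L →
      (∀ (s : ℝ) (x y : Torus), 0 < s → |Φ (x + s, y) - Φ (x, y)| ≤ L * s) →
      (∀ (s : ℝ) (x y : Torus), 0 < s → |Φ (x, y + s) - Φ (x, y)| ≤ L * s) →
      (∀ (s : ℝ) (x y : Torus), 0 < s →
        |Φ (x + s, y + s) - Φ (x + s, y) - (Φ (x, y + s) - Φ (x, y))| ≤ (L * s) ^ 2) →
      ∀ K : ℕ, 0 < K → ∀ p,
        |(K : ℝ)⁻¹ * ∑ k ∈ Finset.Icc 1 K, Φ ((skewShift ω)^[k] p) - ∫ q, Φ q| ≤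
          C * (L ^ 2 * (K : ℝ) ^ (-1 / 2 + 4 * σ)) := by
  obtain ⟨S, hS0, hS⟩ := exists_sum_japanese_rpow_le (s := 1 / 2 + σ) (by linarith)
  set A := 1 + c⁻¹ + zetaSum σ * (2 / c) ^ 2 with hA
  have hA0 : 0 ≤ A := by have := zetaSum_nonneg σ; positivity
  refine ⟨2 * Real.sqrt A * S, by positivity, ?_⟩
  intro ω hω Φ hΦ hΦ1 L hL hx hy hxy K hK p
  have hK0 : (0:ℝ) < K := by exact_mod_cast hK
  set f : UnitAddTorus (Fin 2) → ℂ := fun t => (Φ (t 0, t 1) : ℂ) with hf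
  have hfc : Continuous f := by
    refine Complex.continuous_ofReal.comp (hΦ.comp ?_)
    fun_prop
  have hj0 := fun m => one_le_japanese m
  have hjp : ∀ l m, 0 < japanese l * japanese m := fun l m =>
    mul_pos (by linarith [hj0 l]) (by linarith [hj0 m])
  have hcoe : ∀ r : ℝ, ‖(r : ℂ)‖ = |r| := fun r => by rw [Complex.norm_real, Real.norm_eq_abs]
  have hwG : ∀ n : Fin 2 → ℤ, japanese (n 0) * japanese (n 1) *
      (japanese (n 0) ^ (-(1 / 2 + σ)) * japanese (n 1) ^ (-(1 / 2 + σ))) =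
      (japanese (n 0) * japanese (n 1)) ^ (1 / 2 - σ) := fun n => by
    rw [← Real.mul_rpow (by linarith [hj0 (n 0)]) (by linarith [hj0 (n 1)]),
      show 1 / 2 - σ = 1 + -(1 / 2 + σ) by ring, Real.rpow_add (hjp _ _), Real.rpow_one]
  have key := UnitAddTorus.norm_average_sub_mFourierCoeff_zero_le hfc (Finset.Icc 1 K)
    (Finset.nonempty_Icc.2 hK)
    (fun k => ![((skewShift ω)^[k] p).1, ((skewShift ω)^[k] p).2])
    (w := fun n => japanese (n 0) * japanese (n 1))
    (G := fun n => japanese (n 0) ^ (-(1 / 2 + σ)) * japanese (n 1) ^ (-(1 / 2 + σ)))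
    (B := 2 * L ^ 2) (D := Real.sqrt A * (K : ℝ) ^ (-1 / 2 + 4 * σ)) (S := S)
    (by positivity) (by positivity) hS0 (fun n => hjp _ _) ?_ ?_ ?_ ?_
  · rw [UnitAddTorus.mFourierCoeff_zero_eq] at key
    have h1 : ∫ t : Fin 2 → Torus, f t ∂Measure.pi (fun _ => (volume : Measure Torus)) =
        ((∫ q, Φ q : ℝ) : ℂ) := by
      rw [← integral_complex_ofReal]
      exact (measurePreserving_finTwoArrow (volume : Measure Torus)).integral_comp'
        (fun q : Torus2 => (Φ q : ℂ))
    rw [h1] at key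
    simp only [hf, Matrix.cons_val_zero, Matrix.cons_val_one, Nat.card_Icc, Nat.add_sub_cancel,
      Prod.mk.eta] at key
    rw [← hcoe]
    push_cast
    refine key.trans (le_of_eq ?_)
    ring
  · intro F
    have h0 := UnitAddTorus.sum_norm_sq_mFourierCoeff_le hfc (M := 1)
      (fun t => by rw [hcoe]; exact hΦ1 _) F
    have h1 := UnitAddTorus.sum_sq_mul_norm_sq_mFourierCoeff_le hfc 0 (L := L) (fun s hs t => by
      simp only [UnitAddTorus.diff, hf]
      rw [← Complex.ofReal_sub, hcoe]
      simpa using hx s (t 0) (t 1) hs) F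
    have h2 := UnitAddTorus.sum_sq_mul_norm_sq_mFourierCoeff_le hfc 1 (L := L) (fun s hs t => by
      simp only [UnitAddTorus.diff, hf]
      rw [← Complex.ofReal_sub, hcoe]
      simpa using hy s (t 0) (t 1) hs) F
    have h3 := UnitAddTorus.sum_sq_mul_sq_mul_norm_sq_mFourierCoeff_le hfc 0 1 (L := L)
      (fun s hs t => by
        simp only [UnitAddTorus.diff, hf]
        rw [← Complex.ofReal_sub, ← Complex.ofReal_sub, ← Complex.ofReal_sub, hcoe]
        simpa using hxy s (t 0) (t 1) hs) F
    calc _ = ∑ n ∈ F, (‖UnitAddTorus.mFourierCoeff f n‖ ^ 2 +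
          (n 0 : ℝ) ^ 2 * ‖UnitAddTorus.mFourierCoeff f n‖ ^ 2 +
          (n 1 : ℝ) ^ 2 * ‖UnitAddTorus.mFourierCoeff f n‖ ^ 2 +
          (n 0 : ℝ) ^ 2 * (n 1 : ℝ) ^ 2 * ‖UnitAddTorus.mFourierCoeff f n‖ ^ 2) := by
          refine Finset.sum_congr rfl fun n _ => ?_
          simp only [japanese]; ring
      _ ≤ 1 ^ 2 + L ^ 2 + L ^ 2 + L ^ 4 := by
          rw [Finset.sum_add_distrib, Finset.sum_add_distrib, Finset.sum_add_distrib]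
          linarith
      _ ≤ _ := by nlinarith [sq_nonneg (L ^ 2 - 1), mul_self_nonneg (L ^ 2), one_le_pow₀ (n := 2) hL]
  · intro n
    rw [hwG]
    exact Real.one_le_rpow (by nlinarith [hj0 (n 0), hj0 (n 1)]) (by linarith)
  · intro F
    exact sum_mul_apply_fin_two_le (g := fun m => japanese m ^ (-(1 / 2 + σ)))
      (fun m => Real.rpow_nonneg (by linarith [hj0 m]) _) hS0 hS F
  · intro n hn
    rw [hwG]
    have h1 := norm_average_skewPhase_sq_le hω hc hσ hσ' hK (l := n 0) (m := n 1) (by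
      by_contra! hcon
      refine hn (funext fun i => ?_)
      fin_cases i
      · exact hcon.1
      · exact hcon.2) p
    have h2 : ∀ k, UnitAddTorus.mFourier n
        ![((skewShift ω)^[k] p).1, ((skewShift ω)^[k] p).2] =
        expT (skewPhase ω p (n 0) (n 1) k) := fun k => by
      rw [skewPhase, expT_add]
      simp [UnitAddTorus.mFourier, Fin.prod_univ_two, fourier_apply, expT]
    simp_rw [h2]
    rw [Nat.card_Icc, Nat.add_sub_cancel]
    refine h1.trans (le_of_eq ?_)
    rw [mul_pow, Real.sq_sqrt hA0, ← Real.rpow_natCast ((K:ℝ) ^ _) 2, ← Real.rpow_mul hK0.le]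
    congr 3
    push_cast
    ring

/-- Equidistribution of rotation orbits for functions with bounded second differences. -/
lemma exists_abs_average_rotation_sub_integral_le {c σ : ℝ} (hc : 0 < c) (hσ : 0 < σ)
    (hσ' : σ ≤ 1 / 10) : ∃ C : ℝ, 0 ≤ C ∧ ∀ ω ∈ DiophExp c σ, ∀ Φ : Torus → ℝ, Continuous Φ →
      (∀ q, |Φ q| ≤ 1) → ∀ L : ℝ, 1 ≤ L →
      (∀ (s : ℝ) (y : Torus), 0 < s → |Φ (y + s + s) - Φ (y + s) - (Φ (y + s) - Φ y)| ≤ (L * s) ^ 2) →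
      ∀ K : ℕ, 0 < K → ∀ y : Torus,
        |(K : ℝ)⁻¹ * ∑ k ∈ Finset.Icc 1 K, Φ (y + k • ω) - ∫ q, Φ q| ≤
          C * (L ^ 2 * (K : ℝ)⁻¹) := by
  obtain ⟨S, hS0, hS⟩ := exists_sum_japanese_rpow_le (s := 1 - σ) (by linarith)
  refine ⟨2 * c⁻¹ * Real.sqrt S, by positivity, ?_⟩
  intro ω hω Φ hΦ hΦ1 L hL hyy K hK y
  have hK0 : (0:ℝ) < K := by exact_mod_cast hK
  set f : UnitAddTorus Unit → ℂ := fun t => (Φ (t ()) : ℂ) with hf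
  have hfc : Continuous f := by
    refine Complex.continuous_ofReal.comp (hΦ.comp ?_)
    fun_prop
  have hj0 := fun m => one_le_japanese m
  have hjp : ∀ m, 0 < japanese m := fun m => by linarith [hj0 m]
  have hcoe : ∀ r : ℝ, ‖(r : ℂ)‖ = |r| := fun r => by rw [Complex.norm_real, Real.norm_eq_abs]
  have hwG : ∀ n : Unit → ℤ, japanese (n ()) ^ 2 * japanese (n ()) ^ (-(1 - σ)) =
      japanese (n ()) ^ (1 + σ) := fun n => by
    rw [← Real.rpow_natCast, ← Real.rpow_add (hjp _)]
    congr 1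
    push_cast
    ring
  have key := UnitAddTorus.norm_average_sub_mFourierCoeff_zero_le hfc (Finset.Icc 1 K)
    (Finset.nonempty_Icc.2 hK) (fun k _ => y + k • ω)
    (w := fun n => japanese (n ()) ^ 2) (G := fun n => japanese (n ()) ^ (-(1 - σ)))
    (B := 2 * L ^ 2) (D := c⁻¹ * (K : ℝ)⁻¹) (S := Real.sqrt S)
    (by positivity) (by positivity) (by positivity) (fun n => pow_pos (hjp _) 2) ?_ ?_ ?_ ?_
  · rw [UnitAddTorus.mFourierCoeff_zero_eq] at key
    have h1 : ∫ t : Unit → Torus, f t ∂Measure.pi (fun _ => (volume : Measure Torus)) =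
        ((∫ q, Φ q : ℝ) : ℂ) := by
      rw [← integral_complex_ofReal]
      exact (measurePreserving_funUnique (volume : Measure Torus) Unit).integral_comp'
        (fun q : Torus => (Φ q : ℂ))
    rw [h1] at key
    simp only [hf, Nat.card_Icc, Nat.add_sub_cancel] at key
    rw [← hcoe]
    push_cast
    refine key.trans (le_of_eq ?_)
    ring
  · intro F
    have h0 := UnitAddTorus.sum_norm_sq_mFourierCoeff_le hfc (M := 1)
      (fun t => by rw [hcoe]; exact hΦ1 _) F
    have h3 := UnitAddTorus.sum_sq_mul_sq_mul_norm_sq_mFourierCoeff_le hfc () () (L := L)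
      (fun s hs t => by
        simp only [UnitAddTorus.diff, hf]
        rw [← Complex.ofReal_sub, ← Complex.ofReal_sub, ← Complex.ofReal_sub, hcoe]
        simpa using hyy s (t ()) hs) F
    calc _ ≤ ∑ n ∈ F, (2 * ‖UnitAddTorus.mFourierCoeff f n‖ ^ 2 +
          2 * ((n () : ℝ) ^ 2 * (n () : ℝ) ^ 2 * ‖UnitAddTorus.mFourierCoeff f n‖ ^ 2)) := by
          refine Finset.sum_le_sum fun n _ => ?_
          simp only [japanese]
          nlinarith [mul_nonneg (sq_nonneg ((n () : ℝ) ^ 2 - 1))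
            (sq_nonneg ‖UnitAddTorus.mFourierCoeff f n‖)]
      _ ≤ 2 * 1 ^ 2 + 2 * L ^ 4 := by
          rw [Finset.sum_add_distrib, ← Finset.mul_sum, ← Finset.mul_sum]
          linarith
      _ ≤ _ := by nlinarith [one_le_pow₀ (n := 4) hL]
  · intro n
    rw [hwG]
    exact Real.one_le_rpow (hj0 _) (by linarith)
  · intro F
    rw [Real.sq_sqrt hS0]
    have hinj : Set.InjOn (fun n : Unit → ℤ => n ()) F := fun a _ b _ hab => funext fun _ => hab
    have := hS (F.image fun n => n ())
    rwa [Finset.sum_image hinj] at this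
  · intro n hn
    rw [hwG]
    have hn' : n () ≠ 0 := fun h => hn (funext fun _ => h)
    have h1 := norm_average_expT_rotation_le hω hc hK hn' y
    have h2 : ∀ k : ℕ, UnitAddTorus.mFourier n (fun _ => y + k • ω) =
        expT (n () • (y + k • ω)) := fun k => by
      simp [UnitAddTorus.mFourier, fourier_apply, expT]
    simp_rw [h2]
    rw [Nat.card_Icc, Nat.add_sub_cancel]
    have h3 := abs_rpow_le_japanese (m := n ()) (a := 1 + σ) (by linarith)
    calc _ ≤ (c⁻¹ * |(n () : ℝ)| ^ (1 + σ) * (K : ℝ)⁻¹) ^ 2 := by gcongr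
      _ = (c⁻¹ * (K : ℝ)⁻¹) ^ 2 * |(n () : ℝ)| ^ (2 * (1 + σ)) := by
        rw [mul_comm 2, Real.rpow_mul (abs_nonneg _), Real.rpow_two]; ring
      _ ≤ _ := by gcongr

lemma abs_discAvg_le {r : ℝ} (hr : 0 < r) {f : ℂ → ℝ} {M : ℝ} (hM : ∀ z, |f z| ≤ M) (w : ℂ) :
    |discAvg r f w| ≤ M := by
  have := isProbabilityMeasure_discMeas hr
  exact abs_integral_le_of_abs_le fun _ => hM _

lemma discAvg_sub {r : ℝ} (hr : 0 < r) {f g : ℂ → ℝ} (hf : Measurable f) (hg : Measurable g)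
    {M : ℝ} (hfM : ∀ z, |f z| ≤ M) (hgM : ∀ z, |g z| ≤ M) (w : ℂ) :
    discAvg r (fun z => f z - g z) w = discAvg r f w - discAvg r g w := by
  have := isProbabilityMeasure_discMeas hr
  exact integral_sub (integrable_of_abs_le (hf.comp (measurable_const_add w)) fun ξ => hfM _)
    (integrable_of_abs_le (hg.comp (measurable_const_add w)) fun ξ => hgM _)

lemma discAvg_le {r : ℝ} (hr : 0 < r) {f : ℂ → ℝ} (hf : Measurable f) {M : ℝ}
    (hM : ∀ z, |f z| ≤ M) {w : ℂ} {c : ℝ} (h : ∀ z, ‖z - w‖ < r → f z ≤ c) :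
    discAvg r f w ≤ c := by
  have := isProbabilityMeasure_discMeas hr
  calc discAvg r f w ≤ ∫ _, c ∂discMeas r := by
        refine integral_mono_ae (integrable_of_abs_le (hf.comp (measurable_const_add w))
          fun ξ => hM _) (integrable_const _) ?_
        filter_upwards [ae_discMeas r] with ξ hξ
        exact h _ (by simpa using hξ)
    _ = c := by rw [integral_const, probReal_univ, one_smul]

lemma integral_discAvg_mul_expT {r : ℝ} (hr : 0 < r) {f : ℂ → ℝ} (hf : Measurable f)
    (hb : ∀ z, |f z| ≤ 1) (w : ℂ) :
    ∫ y : Torus, discAvg r f (w * expT y) = discAvg r (radialMean f) w := by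
  have := isProbabilityMeasure_discMeas hr
  have h1 : ∀ y : Torus, discAvg r f (w * expT y) = ∫ ξ, f ((w + ξ) * expT y) ∂discMeas r :=
    fun y => discAvg_mul_right hr f (norm_expT y) w
  simp only [h1]
  refine integral_integral_swap (integrable_of_abs_le (M := 1)
    (f := Function.uncurry fun (y : Torus) (ξ : ℂ) => f ((w + ξ) * expT y)) ?_ fun _ => hb _)
  exact hf.comp ((measurable_snd.const_add w).mul (continuous_expT.measurable.comp measurable_fst))

lemma abs_abs_norm_sub_one_le {z w : ℂ} {r : ℝ} (h : ‖z - w‖ < r) :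
    |‖z‖ - 1| ≤ |‖w‖ - 1| + r := by
  have h1 : |‖z‖ - ‖w‖| ≤ ‖z - w‖ := abs_norm_sub_norm_le z w
  have h2 : ‖z‖ - 1 = (‖z‖ - ‖w‖) + (‖w‖ - 1) := by ring
  rw [h2]
  linarith [abs_add_le (‖z‖ - ‖w‖) (‖w‖ - 1)]

lemma mem_annulusD_iff {h : ℝ} {w : ℂ} : w ∈ annulusD h ↔ |‖w‖ - 1| < h := by
  rw [abs_lt, annulusD, Set.mem_ofPred_eq]
  constructor <;> rintro ⟨h1, h2⟩ <;> constructor <;> linarith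

lemma closedBall_subset_annulusD {h r : ℝ} {w : ℂ} (hw : |‖w‖ - 1| + r < h) :
    Metric.closedBall w r ⊆ annulusD h := fun z hz => by
  rw [mem_closedBall_iff_norm] at hz
  rw [mem_annulusD_iff]
  have h1 : |‖z‖ - ‖w‖| ≤ ‖z - w‖ := abs_norm_sub_norm_le z w
  have h2 : ‖z‖ - 1 = (‖z‖ - ‖w‖) + (‖w‖ - 1) := by ring
  rw [h2]
  linarith [abs_add_le (‖z‖ - ‖w‖) (‖w‖ - 1)]

lemma integral_discAvg_mul_expT_le {h : ℝ} (hh : 0 < h) (hh' : h ≤ 1 / 2) {r : ℝ} (hr : 0 < r)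
    {f : ℂ → ℝ} (hs : SubharmonicOn f (annulusD h)) (hf : Measurable f) (hb : ∀ z, |f z| ≤ 1)
    {w : ℂ} (hw : |‖w‖ - 1| + r ≤ h / 2) :
    ∫ y : Torus, discAvg r f (w * expT y) ≤ (∫ y : Torus, f (expT y)) + 8 / h * (|‖w‖ - 1| + r) := by
  rw [integral_discAvg_mul_expT hr hf hb]
  refine discAvg_le hr (measurable_radialMean hf) (abs_radialMean_le hb) fun z hz => ?_
  have h1 := abs_abs_norm_sub_one_le hz
  refine (radialMean_le hh hh' hs hf hb (h1.trans hw)).trans ?_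
  simp only [radialMean, one_mul]
  gcongr

lemma norm_mul_expT_sub_le {w : ℂ} (hw : ‖w‖ ≤ 3 / 2) {s : ℝ} (hs : 0 < s) (x : Torus) :
    ‖w * expT (x + s) - w * expT x‖ ≤ 21 / 2 * s := by
  rw [← mul_sub, norm_mul, norm_expT_sub, add_sub_cancel_left]
  have h1 := norm_expT_sub_one_le (s : Torus)
  have h2 := norm_torus_coe_le s
  rw [abs_of_pos hs] at h2
  calc _ ≤ 3 / 2 * (7 * s) := by gcongr; linarith
    _ = _ := by ring

/-- The average of `U` over a product of two discs of radius `r`. -/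
def bidiscAvg (r : ℝ) (U : ℂ → ℂ → ℝ) (w₁ w₂ : ℂ) : ℝ :=
  discAvg r (fun η => discAvg r (fun ξ => U ξ η) w₁) w₂

namespace BddSepSubharmonic

variable {h : ℝ} {U : ℂ → ℂ → ℝ}

lemma measurable_uncurry_discAvg (hU : BddSepSubharmonic h U) (r : ℝ) (hr : 0 < r) :
    Measurable (Function.uncurry fun w η => discAvg r (fun ξ => U ξ η) w) := by
  have := isProbabilityMeasure_discMeas hr
  have h1 : Measurable (Function.uncurry fun (p : ℂ × ℂ) (ξ : ℂ) => U (p.1 + ξ) p.2) :=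
    hU.measurable.comp (((measurable_fst.comp measurable_fst).add measurable_snd).prodMk
      (measurable_snd.comp measurable_fst))
  exact h1.stronglyMeasurable.integral_prod_right.measurable

lemma measurable_discAvg (hU : BddSepSubharmonic h U) {r : ℝ} (hr : 0 < r) (w : ℂ) :
    Measurable fun η => discAvg r (fun ξ => U ξ η) w :=
  (hU.measurable_uncurry_discAvg r hr).comp (measurable_const.prodMk measurable_id)

lemma abs_discAvg_le (hU : BddSepSubharmonic h U) {r : ℝ} (hr : 0 < r) (w η : ℂ) :
    |discAvg r (fun ξ => U ξ η) w| ≤ 1 := _root_.abs_discAvg_le hr (fun _ => hU.bdd _ _) w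

lemma subharmonicOn_discAvg (hU : BddSepSubharmonic h U) {r : ℝ} (hr : 0 < r) (w : ℂ) :
    SubharmonicOn (fun η => discAvg r (fun ξ => U ξ η) w) (annulusD h) := by
  have := isProbabilityMeasure_discMeas hr
  refine SubharmonicOn.integral (f := fun η ξ => U (w + ξ) η) ?_ (fun _ _ => hU.bdd _ _)
    fun ξ => hU.right _
  exact hU.measurable.comp ((measurable_snd.const_add w).prodMk measurable_fst)

lemma abs_bidiscAvg_le (hU : BddSepSubharmonic h U) {r : ℝ} (hr : 0 < r) (w₁ w₂ : ℂ) :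
    |bidiscAvg r U w₁ w₂| ≤ 1 := _root_.abs_discAvg_le hr (hU.abs_discAvg_le hr w₁) w₂

lemma le_bidiscAvg (hU : BddSepSubharmonic h U) {r : ℝ} (hr : 0 < r) {w₁ w₂ : ℂ}
    (h₁ : |‖w₁‖ - 1| + r < h) (h₂ : |‖w₂‖ - 1| + r < h) : U w₁ w₂ ≤ bidiscAvg r U w₁ w₂ := by
  have key : ∀ w : ℂ, |‖w‖ - 1| + r < h → w ∈ annulusD h := fun w hw =>
    mem_annulusD_iff.2 (by linarith)
  calc U w₁ w₂ ≤ discAvg r (fun ξ => U ξ w₂) w₁ :=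
        (hU.left w₂).le_discAvg (hU.measurable_left w₂) (fun _ => hU.bdd _ _) (key _ h₁) hr
          (closedBall_subset_annulusD h₁)
    _ ≤ _ := (hU.subharmonicOn_discAvg hr w₁).le_discAvg (hU.measurable_discAvg hr w₁)
        (hU.abs_discAvg_le hr w₁) (key _ h₂) hr (closedBall_subset_annulusD h₂)

lemma bidiscAvg_sub_left (hU : BddSepSubharmonic h U) {r : ℝ} (hr : 0 < r) (w w' w₂ : ℂ) :
    bidiscAvg r U w w₂ - bidiscAvg r U w' w₂ = discAvg r (fun η => discAvg r (fun ξ => U ξ η) w -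
      discAvg r (fun ξ => U ξ η) w') w₂ :=
  (discAvg_sub hr (hU.measurable_discAvg hr w) (hU.measurable_discAvg hr w')
    (hU.abs_discAvg_le hr w) (hU.abs_discAvg_le hr w') w₂).symm

lemma abs_discAvg_sub_le (hU : BddSepSubharmonic h U) {r : ℝ} (hr : 0 < r) (w w' η : ℂ) :
    |discAvg r (fun ξ => U ξ η) w - discAvg r (fun ξ => U ξ η) w'| ≤ 4 / r * ‖w - w'‖ := by
  simpa using discAvg_sub_abs_le hr (hU.measurable_left η) (fun _ => hU.bdd _ _) w w'

lemma abs_bidiscAvg_sub_left_le (hU : BddSepSubharmonic h U) {r : ℝ} (hr : 0 < r) (w w' w₂ : ℂ) :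
    |bidiscAvg r U w w₂ - bidiscAvg r U w' w₂| ≤ 4 / r * ‖w - w'‖ := by
  rw [hU.bidiscAvg_sub_left hr]
  exact _root_.abs_discAvg_le hr (hU.abs_discAvg_sub_le hr w w') w₂

lemma abs_bidiscAvg_sub_right_le (hU : BddSepSubharmonic h U) {r : ℝ} (hr : 0 < r) (w₁ w w' : ℂ) :
    |bidiscAvg r U w₁ w - bidiscAvg r U w₁ w'| ≤ 4 / r * ‖w - w'‖ := by
  simpa [bidiscAvg] using
    discAvg_sub_abs_le hr (hU.measurable_discAvg hr w₁) (hU.abs_discAvg_le hr w₁) w w'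

lemma abs_bidiscAvg_sub_sub_le (hU : BddSepSubharmonic h U) {r : ℝ} (hr : 0 < r)
    (w w' z z' : ℂ) :
    |bidiscAvg r U w z - bidiscAvg r U w' z - (bidiscAvg r U w z' - bidiscAvg r U w' z')| ≤
      (4 / r * ‖w - w'‖) * (4 / r * ‖z - z'‖) := by
  rw [hU.bidiscAvg_sub_left hr, hU.bidiscAvg_sub_left hr]
  refine (discAvg_sub_abs_le hr ((hU.measurable_discAvg hr w).sub (hU.measurable_discAvg hr w'))
    (hU.abs_discAvg_sub_le hr w w') z z').trans (le_of_eq ?_)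
  ring

lemma continuous_bidiscAvg (hU : BddSepSubharmonic h U) {r : ℝ} (hr : 0 < r) :
    Continuous fun p : ℂ × ℂ => bidiscAvg r U p.1 p.2 := by
  refine LipschitzWith.continuous (K := Real.toNNReal (8 / r)) (LipschitzWith.of_dist_le_mul
    fun p q => ?_)
  rw [Real.coe_toNNReal _ (by positivity), Real.dist_eq, dist_eq_norm]
  have h1 := hU.abs_bidiscAvg_sub_left_le hr p.1 q.1 p.2
  have h2 := hU.abs_bidiscAvg_sub_right_le hr q.1 p.2 q.2
  have h3 := norm_fst_le (p - q)
  have h4 := norm_snd_le (p - q)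
  have h5 := abs_add_le (bidiscAvg r U p.1 p.2 - bidiscAvg r U q.1 p.2)
    (bidiscAvg r U q.1 p.2 - bidiscAvg r U q.1 q.2)
  rw [sub_add_sub_cancel] at h5
  have h6 : 4 / r * ‖p.1 - q.1‖ ≤ 4 / r * ‖p - q‖ := by gcongr; exact h3
  have h7 : 4 / r * ‖p.2 - q.2‖ ≤ 4 / r * ‖p - q‖ := by gcongr; exact h4
  have h8 : 8 / r * ‖p - q‖ = 4 / r * ‖p - q‖ + 4 / r * ‖p - q‖ := by ring
  linarith

lemma integral_bidiscAvg_le (hU : BddSepSubharmonic h U) (hh : 0 < h) (hh' : h ≤ 1 / 2) {r : ℝ}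
    (hr : 0 < r) {w : ℂ} (hw : |‖w‖ - 1| + r ≤ h / 2) :
    ∫ q : Torus2, bidiscAvg r U (w * expT q.1) (expT q.2) ≤
      (∫ y : Torus, ∫ x : Torus, U (expT x) (expT y)) + 8 / h * (|‖w‖ - 1| + 2 * r) := by
  have hwa := abs_nonneg (‖w‖ - 1)
  have hce : Measurable expT := continuous_expT.measurable
  have hmg : Measurable (Function.uncurry fun x y : Torus =>
      discAvg r (fun ξ => U ξ (expT y)) (w * expT x)) :=
    (hU.measurable_uncurry_discAvg r hr).comp (((hce.comp measurable_fst).const_mul w).prodMk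
      (hce.comp measurable_snd))
  have hmU : Measurable (Function.uncurry fun y x : Torus => U (expT x) (expT y)) :=
    hU.measurable.comp ((hce.comp measurable_snd).prodMk (hce.comp measurable_fst))
  have hcb : Continuous fun q : Torus2 => bidiscAvg r U (w * expT q.1) (expT q.2) :=
    (hU.continuous_bidiscAvg hr).comp
      ((continuous_const.mul (continuous_expT.comp continuous_fst)).prodMk
        (continuous_expT.comp continuous_snd))
  rw [Measure.volume_eq_prod, integral_prod _
    (integrable_of_abs_le hcb.measurable fun _ => hU.abs_bidiscAvg_le hr _ _)]
  have h1 : ∀ x : Torus, ∫ y : Torus, bidiscAvg r U (w * expT x) (expT y) ≤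
      (∫ y : Torus, discAvg r (fun ξ => U ξ (expT y)) (w * expT x)) + 8 / h * r := fun x => by
    have := integral_discAvg_mul_expT_le hh hh' hr (hU.subharmonicOn_discAvg hr (w * expT x))
      (hU.measurable_discAvg hr _) (hU.abs_discAvg_le hr _) (w := 1)
      (by rw [norm_one, sub_self, abs_zero]; linarith)
    simpa [bidiscAvg] using this
  have h2 : ∀ y : Torus, ∫ x : Torus, discAvg r (fun ξ => U ξ (expT y)) (w * expT x) ≤
      (∫ x : Torus, U (expT x) (expT y)) + 8 / h * (|‖w‖ - 1| + r) := fun y =>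
    integral_discAvg_mul_expT_le hh hh' hr (hU.left _) (hU.measurable_left _)
      (fun _ => hU.bdd _ _) hw
  have hb1 : ∀ x y : Torus, |discAvg r (fun ξ => U ξ (expT y)) (w * expT x)| ≤ 1 :=
    fun x y => hU.abs_discAvg_le hr _ _
  calc ∫ x : Torus, ∫ y : Torus, bidiscAvg r U (w * expT x) (expT y)
      ≤ ∫ x : Torus, ((∫ y : Torus, discAvg r (fun ξ => U ξ (expT y)) (w * expT x)) + 8 / h * r) := by
        refine integral_mono (integrable_of_abs_le (M := 1)
          hcb.stronglyMeasurable.integral_prod_right'.measurable fun x =>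
            abs_integral_le_of_abs_le fun _ => hU.abs_bidiscAvg_le hr _ _) ?_ h1
        exact (integrable_of_abs_le hmg.stronglyMeasurable.integral_prod_right.measurable fun x =>
          abs_integral_le_of_abs_le fun y => hb1 x y).add (integrable_const _)
    _ = (∫ y : Torus, ∫ x : Torus, discAvg r (fun ξ => U ξ (expT y)) (w * expT x)) + 8 / h * r := by
        rw [integral_add (integrable_of_abs_le hmg.stronglyMeasurable.integral_prod_right.measurable
          fun x => abs_integral_le_of_abs_le fun y => hb1 x y) (integrable_const _),
          integral_integral_swap (integrable_of_abs_le hmg fun p => hb1 p.1 p.2)]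
        simp
    _ ≤ (∫ y : Torus, ((∫ x : Torus, U (expT x) (expT y)) + 8 / h * (|‖w‖ - 1| + r))) + 8 / h * r := by
        refine add_le_add_left (integral_mono (integrable_of_abs_le
          hmg.stronglyMeasurable.integral_prod_left.measurable fun y =>
            abs_integral_le_of_abs_le fun x => hb1 x y) ?_ h2) _
        exact (integrable_of_abs_le hmU.stronglyMeasurable.integral_prod_right.measurable fun y =>
          abs_integral_le_of_abs_le fun x => hU.bdd _ _).add (integrable_const _)
    _ = _ := by
        rw [integral_add (integrable_of_abs_le hmU.stronglyMeasurable.integral_prod_right.measurable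
          fun y => abs_integral_le_of_abs_le fun x => hU.bdd _ _) (integrable_const _)]
        simp
        ring

end BddSepSubharmonic

lemma norm_le_of_abs_norm_sub_one_le {h t : ℝ} (hh' : h ≤ 1 / 2) (ht : 0 ≤ t) {w : ℂ}
    (hw : |‖w‖ - 1| + t ≤ h / 2) : ‖w‖ ≤ 3 / 2 := by
  linarith [le_abs_self (‖w‖ - 1)]

lemma exists_average_skewShift_le {c σ : ℝ} (hc : 0 < c) (hσ : 0 < σ) (hσ' : σ ≤ 1 / 10) :
    ∃ C, 0 ≤ C ∧ ∀ ω ∈ DiophExp c σ, ∀ h U, BddSepSubharmonic h U → 0 < h → h ≤ 1 / 2 →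
      ∀ r, 0 < r → ∀ w : ℂ, |‖w‖ - 1| + 2 * r ≤ h / 2 → ∀ K : ℕ, 0 < K → ∀ p : Torus2,
        (K : ℝ)⁻¹ * ∑ k ∈ Finset.Icc 1 K, U (w * expT ((skewShift ω)^[k] p).1)
          (expT ((skewShift ω)^[k] p).2) ≤ (∫ y : Torus, ∫ x : Torus, U (expT x) (expT y)) +
          8 / h * (|‖w‖ - 1| + 2 * r) + C * (r⁻¹ ^ 2 * (K : ℝ) ^ (-1 / 2 + 4 * σ)) := by
  obtain ⟨C, hC, H⟩ := exists_abs_average_skewShift_sub_integral_le hc hσ hσ'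
  refine ⟨C * 42 ^ 2, by positivity, fun ω hω h U hU hh hh' r hr w hw K hK p => ?_⟩
  have hwa := abs_nonneg (‖w‖ - 1)
  have hw32 := norm_le_of_abs_norm_sub_one_le hh' (by positivity) hw
  have hr8 : r ≤ 1 / 8 := by linarith
  have hL : 1 ≤ 42 / r := by rw [le_div_iff₀ hr]; linarith
  have hx : ∀ (s : ℝ) (x : Torus), 0 < s →
      4 / r * ‖w * expT (x + s) - w * expT x‖ ≤ 42 / r * s := fun s x hs => by
    have := norm_mul_expT_sub_le hw32 hs x
    calc _ ≤ 4 / r * (21 / 2 * s) := by gcongr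
      _ = _ := by ring
  have hy : ∀ (s : ℝ) (x : Torus), 0 < s → 4 / r * ‖expT (x + s) - expT x‖ ≤ 42 / r * s :=
    fun s x hs => by
    have := norm_mul_expT_sub_le (w := 1) (by norm_num) hs x
    rw [one_mul, one_mul] at this
    calc _ ≤ 4 / r * (21 / 2 * s) := by gcongr
      _ = _ := by ring
  have key := H ω hω (fun q => bidiscAvg r U (w * expT q.1) (expT q.2))
    ((hU.continuous_bidiscAvg hr).comp
      ((continuous_const.mul (continuous_expT.comp continuous_fst)).prodMk
        (continuous_expT.comp continuous_snd))) (fun q => hU.abs_bidiscAvg_le hr _ _) (42 / r) hL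
    (fun s x y hs => (hU.abs_bidiscAvg_sub_left_le hr _ _ _).trans (hx s x hs))
    (fun s x y hs => (hU.abs_bidiscAvg_sub_right_le hr _ _ _).trans (hy s y hs))
    (fun s x y hs => by
      refine le_trans (le_of_eq ?_) ((hU.abs_bidiscAvg_sub_sub_le hr (w * expT (x + s)) (w * expT x)
        (expT (y + s)) (expT y)).trans ?_)
      · congr 1; ring
      · rw [sq]
        exact mul_le_mul (hx s x hs) (hy s y hs) (by positivity) (by positivity)) K hK p
  have hmean := hU.integral_bidiscAvg_le hh hh' hr (w := w) (by linarith)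
  have hle : (K : ℝ)⁻¹ * ∑ k ∈ Finset.Icc 1 K, U (w * expT ((skewShift ω)^[k] p).1)
      (expT ((skewShift ω)^[k] p).2) ≤ (K : ℝ)⁻¹ * ∑ k ∈ Finset.Icc 1 K,
      bidiscAvg r U (w * expT ((skewShift ω)^[k] p).1) (expT ((skewShift ω)^[k] p).2) := by
    gcongr with k _
    refine hU.le_bidiscAvg hr ?_ ?_
    · rw [norm_mul, norm_expT, mul_one]; linarith
    · rw [norm_expT, sub_self, abs_zero]; linarith
  have h3 := (abs_le.1 key).2
  have h4 : C * 42 ^ 2 * (r⁻¹ ^ 2 * (K : ℝ) ^ (-1 / 2 + 4 * σ)) =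
      C * ((42 / r) ^ 2 * (K : ℝ) ^ (-1 / 2 + 4 * σ)) := by ring
  rw [h4]
  linarith

section Single

variable {h r : ℝ} {f : ℂ → ℝ}

lemma discAvg_eq_zero (hr' : r ≤ 1 / 2) (h0 : ∀ z : ℂ, 3 / 2 ≤ ‖z‖ → f z = 0) {z : ℂ}
    (hz : 2 ≤ ‖z‖) : discAvg r f z = 0 := by
  have : ∀ᵐ ξ ∂discMeas r, f (z + ξ) = 0 := by
    filter_upwards [ae_discMeas r] with ξ hξ
    refine h0 _ ?_
    have := norm_sub_le_norm_add z ξ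
    linarith
  rw [discAvg, integral_congr_ae this, integral_zero]

lemma abs_discAvg_mul_sub_le (hr : 0 < r) (hr' : r ≤ 1 / 2) (hm : Measurable f)
    (hb : ∀ z, |f z| ≤ 1) (h0 : ∀ z : ℂ, 3 / 2 ≤ ‖z‖ → f z = 0) {s : ℝ} (hs : 0 < s) (z : ℂ) :
    |discAvg r f (z * expT s) - discAvg r f z| ≤ 56 / r * s := by
  rcases le_total 2 ‖z‖ with h | h
  · rw [discAvg_eq_zero hr' h0 h, discAvg_eq_zero hr' h0 (by simpa [norm_expT] using h)]
    simp; positivity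
  · have h1 := discAvg_sub_abs_le hr hm hb (z * expT s) z
    have h2 : ‖z * expT s - z‖ ≤ 2 * (7 * s) := by
      rw [show z * expT s - z = z * (expT s - 1) by ring, norm_mul]
      have h1 := norm_expT_sub_one_le (s : Torus)
      have h2 := norm_torus_coe_le s
      rw [abs_of_pos hs] at h2
      gcongr
      linarith
    calc _ ≤ _ := h1
      _ ≤ 4 * 1 / r * (2 * (7 * s)) := by gcongr
      _ = _ := by ring

lemma integral_discAvg_discAvg_le (hh : 0 < h) (hh' : h ≤ 1 / 2) (hr : 0 < r)
    (hs : SubharmonicOn f (annulusD h)) (hm : Measurable f) (hb : ∀ z, |f z| ≤ 1)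
    {w : ℂ} (hw : |‖w‖ - 1| + 2 * r ≤ h / 2) :
    ∫ y : Torus, discAvg r (discAvg r f) (w * expT y) ≤
      (∫ y : Torus, f (expT y)) + 8 / h * (|‖w‖ - 1| + 2 * r) := by
  have hFm : Measurable (discAvg r f) := (continuous_discAvg hr hm hb).measurable
  have hFb := abs_discAvg_le hr hb
  rw [integral_discAvg_mul_expT hr hFm hFb]
  refine discAvg_le hr (measurable_radialMean hFm) (abs_radialMean_le hFb) fun z hz => ?_
  have h1 := abs_abs_norm_sub_one_le hz
  refine (integral_discAvg_mul_expT_le hh hh' hr hs hm hb (by linarith)).trans ?_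
  have h2 : |‖z‖ - 1| + r ≤ |‖w‖ - 1| + 2 * r := by linarith
  gcongr

lemma SubharmonicOn.le_discAvg_discAvg (hr : 0 < r)
    (hs : SubharmonicOn f (annulusD h)) (hm : Measurable f) (hb : ∀ z, |f z| ≤ 1)
    {w : ℂ} (hw : |‖w‖ - 1| + 2 * r < h) : f w ≤ discAvg r (discAvg r f) w := by
  have hFm : Measurable (discAvg r f) := (continuous_discAvg hr hm hb).measurable
  have hFb := abs_discAvg_le hr hb
  have key : ∀ z : ℂ, |‖z‖ - 1| + r < h → f z ≤ discAvg r f z := fun z hz =>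
    hs.le_discAvg hm hb (mem_annulusD_iff.2 (by linarith)) hr (closedBall_subset_annulusD hz)
  refine (key w (by linarith)).trans (sub_nonpos.1 ?_)
  rw [← discAvg_sub hr hm hFm hb hFb]
  refine discAvg_le hr (hm.sub hFm) (M := 2) (fun z => ?_) fun z hz => ?_
  · have h1 := hb z
    have h2 := hFb z
    simp only [Pi.sub_apply]
    exact (abs_sub _ _).trans (by linarith)
  · have h1 := abs_abs_norm_sub_one_le hz
    have h2 := key z (by linarith)
    simp only [Pi.sub_apply]
    linarith

end Single

lemma exists_average_rotation_le {c σ : ℝ} (hc : 0 < c) (hσ : 0 < σ) (hσ' : σ ≤ 1 / 10) :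
    ∃ C, 0 ≤ C ∧ ∀ ω ∈ DiophExp c σ, ∀ h f, SubharmonicOn f (annulusD h) → Measurable f →
      (∀ z, |f z| ≤ 1) → (∀ z ∉ annulusD h, f z = 0) → 0 < h → h ≤ 1 / 2 →
      ∀ r, 0 < r → ∀ w : ℂ, |‖w‖ - 1| + 2 * r ≤ h / 2 → ∀ K : ℕ, 0 < K → ∀ y : Torus,
        (K : ℝ)⁻¹ * ∑ k ∈ Finset.Icc 1 K, f (w * expT (y + k • ω)) ≤
          (∫ y : Torus, f (expT y)) + 8 / h * (|‖w‖ - 1| + 2 * r) + C * (r⁻¹ ^ 2 * (K : ℝ)⁻¹) := by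
  obtain ⟨C, hC, H⟩ := exists_abs_average_rotation_sub_integral_le hc hσ hσ'
  refine ⟨C * 56 ^ 2, by positivity, fun ω hω h f hs hm hb h0 hh hh' r hr w hw K hK y => ?_⟩
  have hwa := abs_nonneg (‖w‖ - 1)
  have hw32 := norm_le_of_abs_norm_sub_one_le hh' (by positivity) hw
  have hr8 : r ≤ 1 / 8 := by linarith
  have hL : 1 ≤ 56 / r := by rw [le_div_iff₀ hr]; linarith
  have h0' : ∀ z : ℂ, 3 / 2 ≤ ‖z‖ → f z = 0 := fun z hz => h0 z fun hz' => by
    have := hz'.2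
    linarith
  have hFm : Measurable (discAvg r f) := (continuous_discAvg hr hm hb).measurable
  have hFb := abs_discAvg_le hr hb
  have hG : Continuous (discAvg r (discAvg r f)) := continuous_discAvg hr hFm hFb
  have hdiff : ∀ (s : ℝ) (z : ℂ), discAvg r (discAvg r f) (z * expT s) - discAvg r (discAvg r f) z =
      discAvg r (fun z => discAvg r f (z * expT s) - discAvg r f z) z := fun s z => by
    rw [discAvg_mul_right hr _ (norm_expT _)]
    exact (discAvg_sub hr (hFm.comp (measurable_id.mul_const _)) hFm (fun _ => hFb _) hFb z).symm
  have key := H ω hω (fun y => discAvg r (discAvg r f) (w * expT y))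
    (hG.comp (continuous_const.mul continuous_expT)) (fun y => abs_discAvg_le hr hFb _)
    (56 / r) hL (fun s y hs => by
      have e1 : w * expT (y + s + s) = w * expT (y + s) * expT s := by rw [expT_add (y + s), mul_assoc]
      have e2 : w * expT (y + s) = w * expT y * expT s := by rw [expT_add, mul_assoc]
      have e3 : discAvg r (discAvg r f) (w * expT (y + s)) - discAvg r (discAvg r f) (w * expT y) =
          discAvg r (fun z => discAvg r f (z * expT s) - discAvg r f z) (w * expT y) := by
        rw [e2, hdiff]
      rw [e1, hdiff, e3]
      refine (discAvg_sub_abs_le hr ((hFm.comp (measurable_id.mul_const _)).sub hFm)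
        (abs_discAvg_mul_sub_le hr (by linarith) hm hb h0' hs) _ _).trans ?_
      have := norm_mul_expT_sub_le hw32 hs y
      calc _ ≤ 4 * (56 / r * s) / r * (21 / 2 * s) := by gcongr
        _ ≤ 4 * (56 / r * s) / r * (14 * s) := by gcongr; norm_num
        _ = _ := by ring) K hK y
  have hmean := integral_discAvg_discAvg_le hh hh' hr hs hm hb hw
  have hle : (K : ℝ)⁻¹ * ∑ k ∈ Finset.Icc 1 K, f (w * expT (y + k • ω)) ≤
      (K : ℝ)⁻¹ * ∑ k ∈ Finset.Icc 1 K, discAvg r (discAvg r f) (w * expT (y + k • ω)) := by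
    gcongr with k _
    refine hs.le_discAvg_discAvg hr hm hb ?_
    rw [norm_mul, norm_expT, mul_one]; linarith
  have h3 := (abs_le.1 key).2
  have h4 : C * 56 ^ 2 * (r⁻¹ ^ 2 * (K : ℝ)⁻¹) = C * ((56 / r) ^ 2 * (K : ℝ)⁻¹) := by ring
  rw [h4]
  linarith

lemma SubharmonicOn.average {D : Set ℂ} {v : ℕ → ℂ → ℝ} (K : ℕ) (hm : ∀ k, Measurable (v k))
    (hb : ∀ k z, |v k z| ≤ 1) (hs : ∀ k, SubharmonicOn (v k) D) :
    SubharmonicOn (fun z => (K : ℝ)⁻¹ * ∑ k ∈ Finset.Icc 1 K, v k z) D := by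
  rcases K.eq_zero_or_pos with rfl | hK
  · refine ⟨by simpa using upperSemicontinuousOn_const, fun w _ r _ _ => by simp⟩
  have hfin : IsFiniteMeasure ((K : ℝ≥0∞)⁻¹ • (Measure.count : Measure (Finset.Icc 1 K))) :=
    Measure.smul_finite _ (ENNReal.inv_ne_top.2 (by exact_mod_cast hK.ne'))
  have h := SubharmonicOn.integral (ν := (K : ℝ≥0∞)⁻¹ • (Measure.count : Measure (Finset.Icc 1 K)))
    (D := D) (f := fun z (k : Finset.Icc 1 K) => v k z)
    (measurable_from_prod_countable_left fun k => hm k) (fun z k => hb k z) fun k => hs k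
  refine h.congr fun z _ => ?_
  rw [integral_smul_measure, integral_count]
  simp only [ENNReal.toReal_inv, ENNReal.toReal_natCast, smul_eq_mul]
  rw [Finset.sum_coe_sort (Finset.Icc 1 K) fun k => v k z]

lemma abs_average_le {v : ℕ → ℝ} {K : ℕ} (hK : 0 < K) (hb : ∀ k, |v k| ≤ 1) :
    |(K : ℝ)⁻¹ * ∑ k ∈ Finset.Icc 1 K, v k| ≤ 1 := by
  have hK' : (0 : ℝ) < K := by exact_mod_cast hK
  rw [abs_mul, abs_of_pos (by positivity), inv_mul_le_iff₀ hK']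
  calc |∑ k ∈ Finset.Icc 1 K, v k| ≤ ∑ k ∈ Finset.Icc 1 K, |v k| := Finset.abs_sum_le_sum_abs _ _
    _ ≤ ∑ k ∈ Finset.Icc 1 K, (1 : ℝ) := Finset.sum_le_sum fun k _ => hb k
    _ = _ := by simp

lemma integral_average {α : Type*} [MeasurableSpace α] {μ : Measure α} {v : ℕ → α → ℝ} {K : ℕ}
    (hi : ∀ k, Integrable (v k) μ) :
    ∫ x, (K : ℝ)⁻¹ * ∑ k ∈ Finset.Icc 1 K, v k x ∂μ =
      (K : ℝ)⁻¹ * ∑ k ∈ Finset.Icc 1 K, ∫ x, v k x ∂μ := by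
  rw [integral_const_mul, integral_finsetSum _ fun k _ => hi k]

lemma measurable_average {α : Type*} [MeasurableSpace α] {v : ℕ → α → ℝ} (K : ℕ)
    (hm : ∀ k, Measurable (v k)) :
    Measurable fun x => (K : ℝ)⁻¹ * ∑ k ∈ Finset.Icc 1 K, v k x :=
  (Finset.measurable_fun_sum _ fun k _ => hm k).const_mul _

lemma exists_nat_mem_Icc_two_mul {x : ℝ} (hx : 1 ≤ x) : ∃ N : ℕ, x ≤ N ∧ (N : ℝ) ≤ 2 * x :=
  ⟨⌈x⌉₊, Nat.le_ceil x, by linarith [Nat.ceil_lt_add_one (show 0 ≤ x by linarith)]⟩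

lemma exists_volume_average_rotation_lt_le {c σ h : ℝ} (hc : 0 < c) (hσ : 0 < σ) (hσ' : σ ≤ 1 / 10)
    (hh : 0 < h) (hh' : h ≤ 1 / 2) :
    ∃ C, 0 < C ∧ ∀ ω ∈ DiophExp c σ, ∀ f, SubharmonicOn f (annulusD h) → Measurable f →
      (∀ z, |f z| ≤ 1) → (∀ z ∉ annulusD h, f z = 0) → ∀ K : ℕ, 0 < K → ∀ q : ℝ, 0 < q →
      q ^ 6 = (K : ℝ)⁻¹ → ∀ lam : ℝ, 0 ≤ lam →
      volume.real {y : Torus | (K : ℝ)⁻¹ * ∑ k ∈ Finset.Icc 1 K, f (expT (y + k • ω)) <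
        (∫ y : Torus, f (expT y)) - lam} ≤ C * q⁻¹ * Real.exp (-lam / (C * q)) := by
  obtain ⟨C, hC, H⟩ := exists_average_rotation_le hc hσ hσ'
  set A : ℝ := 4 + C * (64 / h ^ 2) with hA
  have hA0 : 0 < A := by positivity
  set C₁ : ℝ := 320 / h * Real.exp (potentialConst / 2) with hC₁
  set C₂ : ℝ := 4 * (A + 320 / h * A) with hC₂
  have hC₁0 : 0 < C₁ := by positivity
  have hC₂0 : 0 < C₂ := by positivity
  refine ⟨C₁ + C₂, by positivity, fun ω hω f hs hm hb h0 K hK q hq hqK lam hlam => ?_⟩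
  have hK' : (1 : ℝ) ≤ K := by exact_mod_cast hK
  have hq1 : q ≤ 1 := by
    by_contra! hcon
    have h1 : 1 < q ^ 6 := one_lt_pow₀ hcon (by norm_num)
    rw [hqK] at h1
    exact absurd (inv_le_one_of_one_le₀ hK') (not_le.2 h1)
  have hq2 : q ^ 2 ≤ q := by nlinarith
  have hr : 0 < h / 8 * q ^ 2 := by positivity
  have hrK : (h / 8 * q ^ 2)⁻¹ ^ 2 * (K : ℝ)⁻¹ = 64 / h ^ 2 * q ^ 2 := by
    rw [← hqK]; field_simp; norm_num
  set W : ℂ → ℝ := fun z => (K : ℝ)⁻¹ * ∑ k ∈ Finset.Icc 1 K, f (z * expT (k • ω)) with hW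
  have hWs : SubharmonicOn W (annulusD h) :=
    SubharmonicOn.average K (fun k => hm.comp (measurable_id.mul_const _)) (fun _ _ => hb _)
      fun k => hs.comp_mul_right _
  have hWm : Measurable W := measurable_average K fun k => hm.comp (measurable_id.mul_const _)
  have hWb : ∀ z, |W z| ≤ 1 := fun z => abs_average_le hK fun _ => hb _
  have hup : ∀ z : ℂ, |‖z‖ - 1| + 2 * (h / 8 * q ^ 2) ≤ h / 2 → W z ≤ (∫ y : Torus, f (expT y)) +
      (8 / h * |‖z‖ - 1| + (2 + C * (64 / h ^ 2)) * q ^ 2) := fun z hz => by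
    have := H ω hω h f hs hm hb h0 hh hh' _ hr z hz K hK 0
    rw [hrK] at this
    simp only [zero_add] at this
    refine this.trans (le_of_eq ?_)
    field_simp
    ring
  have hint : ∫ x : Torus, W (expT x) = ∫ y : Torus, f (expT y) := by
    have hfi : ∀ k : ℕ, Integrable fun x : Torus => f (expT x * expT (k • ω)) := fun k =>
      integrable_of_abs_le (hm.comp (continuous_expT.measurable.mul_const _)) fun _ => hb _
    simp only [hW]
    rw [integral_average hfi]
    have : ∀ k : ℕ, ∫ x : Torus, f (expT x * expT (k • ω)) = ∫ y : Torus, f (expT y) := fun k => by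
      simp only [← expT_add]
      exact integral_add_right_eq_self (fun x => f (expT x)) _
    simp only [this]
    simp [hK.ne']
  obtain ⟨N, hN1, hN2⟩ := exists_nat_mem_Icc_two_mul (x := 160 / h / q) (by
    rw [le_div_iff₀ hq, le_div_iff₀ hh]; nlinarith)
  have hN0 : (0 : ℝ) < N := lt_of_lt_of_le (by positivity) hN1
  have h40 : 40 / (N : ℝ) ≤ h / 4 * q := by
    calc 40 / (N : ℝ) ≤ 40 / (160 / h / q) := by gcongr
      _ = h / 4 * q := by field_simp; norm_num
  have key := volume_expT_lt_le (V := W) (h := h) (b := ∫ y : Torus, f (expT y)) (s := A * q)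
    (s₀ := A * q ^ 2) (κ := 0) (lam := lam) (N := N) hh' hWs hWm hWb
    (lt_of_le_of_lt h40 (by nlinarith)) (by exact_mod_cast hN0) (by positivity) (by positivity) (by positivity) hlam
    (fun z hz => by
      replace hz := hz.trans h40
      have hz' : |‖z‖ - 1| + 2 * (h / 8 * q ^ 2) ≤ h / 2 := by nlinarith
      refine (hup z hz').trans (add_le_add_right ?_ _)
      have h1 : 8 / h * |‖z‖ - 1| ≤ 8 / h * (h / 4 * q) := by gcongr
      have h2 : 8 / h * (h / 4 * q) = 2 * q := by field_simp; norm_num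
      have h3 : (2 + C * (64 / h ^ 2)) * q ^ 2 ≤ (2 + C * (64 / h ^ 2)) * q := by gcongr
      rw [hA]
      linarith)
    (fun x => by
      refine (hup (expT x) ?_).trans (add_le_add_right ?_ _)
      · rw [norm_expT, sub_self, abs_zero]; nlinarith
      · rw [norm_expT, sub_self, abs_zero, mul_zero, zero_add, hA]
        gcongr
        norm_num)
    (by rw [hint, sub_zero])
  have hset : {y : Torus | (K : ℝ)⁻¹ * ∑ k ∈ Finset.Icc 1 K, f (expT (y + k • ω)) <
      (∫ y : Torus, f (expT y)) - lam} = {x | W (expT x) < (∫ y : Torus, f (expT y)) - lam} := by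
    simp only [hW, expT_add]
  rw [hset]
  have e1 : 4 * (A * q + 2 * (160 / h / q) * (0 + A * q ^ 2)) = C₂ * q := by
    rw [hC₂]; field_simp; ring
  have e2 : 2 * (160 / h / q) * (Real.exp (potentialConst / 2) * Real.exp (-lam / (C₂ * q))) =
      C₁ * q⁻¹ * Real.exp (-lam / (C₂ * q)) := by rw [hC₁]; ring
  have e3 : -lam / (4 * (A * q + N * (0 + A * q ^ 2))) ≤ -lam / (C₂ * q) := by
    rw [← e1, neg_div, neg_div, neg_le_neg_iff]
    gcongr
  have e4 : -lam / (C₂ * q) ≤ -lam / ((C₁ + C₂) * q) := by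
    rw [neg_div, neg_div, neg_le_neg_iff]
    gcongr
    linarith
  calc _ ≤ _ := key
    _ ≤ 2 * (160 / h / q) * (Real.exp (potentialConst / 2) * Real.exp (-lam / (C₂ * q))) := by
        gcongr
    _ = C₁ * q⁻¹ * Real.exp (-lam / (C₂ * q)) := e2
    _ ≤ _ := by
        gcongr
        linarith

namespace BddSepSubharmonic

variable {h : ℝ} {U : ℂ → ℂ → ℝ}

lemma measurable_integral_left (hU : BddSepSubharmonic h U) :
    Measurable fun w₂ => ∫ x : Torus, U (expT x) w₂ := by
  have h1 : Measurable (Function.uncurry fun (w₂ : ℂ) (x : Torus) => U (expT x) w₂) :=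
    hU.measurable.comp ((continuous_expT.measurable.comp measurable_snd).prodMk measurable_fst)
  exact h1.stronglyMeasurable.integral_prod_right.measurable

lemma subharmonicOn_integral_left (hU : BddSepSubharmonic h U) :
    SubharmonicOn (fun w₂ => ∫ x : Torus, U (expT x) w₂) (annulusD h) :=
  SubharmonicOn.integral (f := fun w₂ (x : Torus) => U (expT x) w₂)
    (hU.measurable.comp ((continuous_expT.measurable.comp measurable_snd).prodMk measurable_fst))
    (fun _ _ => hU.bdd _ _) fun _ => hU.right _

end BddSepSubharmonic

set_option maxHeartbeats 800000 in
lemma exists_volume_average_skewShift_lt_le {c σ h : ℝ} (hc : 0 < c) (hσ : 0 < σ)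
    (hσ' : σ ≤ 1 / 10) (hh : 0 < h) (hh' : h ≤ 1 / 2) :
    ∃ C, 0 < C ∧ ∀ ω ∈ DiophExp c σ, ∀ U, BddSepSubharmonic h U → ∀ K : ℕ, 0 < K → ∀ q : ℝ,
      0 < q → q ≤ 1 → (K : ℝ) ^ (-1 / 6 + 4 * σ) ≤ q ^ 2 →
      (∀ p : Torus2, (K : ℝ)⁻¹ * ∑ k ∈ Finset.Icc 1 K, U (expT ((skewShift ω)^[k] p).1)
        (expT ((skewShift ω)^[k] p).2) ≤ (∫ y : Torus, ∫ x : Torus, U (expT x) (expT y)) +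
          C * q ^ 2) ∧
      ∀ y : Torus, (∫ y : Torus, ∫ x : Torus, U (expT x) (expT y)) - q ^ 2 ≤
        (K : ℝ)⁻¹ * ∑ k ∈ Finset.Icc 1 K, ∫ x : Torus, U (expT x) (expT (y + k • ω)) →
      ∀ lam : ℝ, 0 ≤ lam →
      volume.real {x : Torus | (K : ℝ)⁻¹ * ∑ k ∈ Finset.Icc 1 K,
        U (expT ((skewShift ω)^[k] (x, y)).1) (expT ((skewShift ω)^[k] (x, y)).2) <
        (∫ y : Torus, ∫ x : Torus, U (expT x) (expT y)) - lam} ≤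
        C * q⁻¹ * Real.exp (-lam / (C * q)) := by
  obtain ⟨C, hC, H⟩ := exists_average_skewShift_le hc hσ hσ'
  set A : ℝ := 4 + C * (64 / h ^ 2) with hA
  have hA0 : 0 < A := by positivity
  set C₁ : ℝ := 320 / h * Real.exp (potentialConst / 2) with hC₁
  set C₂ : ℝ := 4 * (A + 320 / h * (1 + A)) with hC₂
  have hC₁0 : 0 < C₁ := by positivity
  have hC₂0 : 0 < C₂ := by positivity
  have hAC : A ≤ C₁ + C₂ := by
    have : 0 ≤ 320 / h * (1 + A) := by positivity
    rw [hC₂]; linarith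
  refine ⟨C₁ + C₂, by positivity, fun ω hω U hU K hK q hq hq1 hqK => ?_⟩
  have hK' : (1 : ℝ) ≤ K := by exact_mod_cast hK
  have hK0 : (0 : ℝ) < K := by linarith
  have hq2 : q ^ 2 ≤ q := by nlinarith
  set ρ : ℝ := (K : ℝ) ^ (-1 / 6 : ℝ) with hρ
  have hρ0 : 0 < ρ := by positivity
  have hρq : ρ ≤ q ^ 2 := le_trans (Real.rpow_le_rpow_of_exponent_le hK' (by linarith)) hqK
  have hr : 0 < h / 8 * ρ := by positivity
  have hrK : (h / 8 * ρ)⁻¹ ^ 2 * (K : ℝ) ^ (-1 / 2 + 4 * σ) ≤ 64 / h ^ 2 * q ^ 2 := by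
    have h1 : (K : ℝ) ^ (-1 / 2 + 4 * σ) = ρ ^ 2 * (K : ℝ) ^ (-1 / 6 + 4 * σ) := by
      rw [hρ, ← Real.rpow_natCast, ← Real.rpow_mul hK0.le, ← Real.rpow_add hK0]
      congr 1
      push_cast
      ring
    have h2 : (h / 8 * ρ)⁻¹ ^ 2 * (K : ℝ) ^ (-1 / 2 + 4 * σ) =
        64 / h ^ 2 * (K : ℝ) ^ (-1 / 6 + 4 * σ) := by
      rw [h1]; field_simp; norm_num
    rw [h2]
    gcongr
  set b : ℝ := ∫ y : Torus, ∫ x : Torus, U (expT x) (expT y) with hb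
  have hup : ∀ (z : ℂ) (p : Torus2), |‖z‖ - 1| + 2 * (h / 8 * ρ) ≤ h / 2 →
      (K : ℝ)⁻¹ * ∑ k ∈ Finset.Icc 1 K, U (z * expT ((skewShift ω)^[k] p).1)
        (expT ((skewShift ω)^[k] p).2) ≤
      b + (8 / h * |‖z‖ - 1| + (2 + C * (64 / h ^ 2)) * q ^ 2) := fun z p hz => by
    refine (H ω hω h U hU hh hh' _ hr z hz K hK p).trans ?_
    have h1 : C * ((h / 8 * ρ)⁻¹ ^ 2 * (K : ℝ) ^ (-1 / 2 + 4 * σ)) ≤ C * (64 / h ^ 2 * q ^ 2) := by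
      gcongr
    have h2 : 8 / h * (|‖z‖ - 1| + 2 * (h / 8 * ρ)) = 8 / h * |‖z‖ - 1| + 2 * ρ := by
      field_simp
    rw [h2]
    linarith
  have hup₁ : ∀ p : Torus2, (K : ℝ)⁻¹ * ∑ k ∈ Finset.Icc 1 K, U (expT ((skewShift ω)^[k] p).1)
      (expT ((skewShift ω)^[k] p).2) ≤ b + A * q ^ 2 := fun p => by
    have := hup 1 p (by rw [norm_one, sub_self, abs_zero]; nlinarith)
    simp only [one_mul] at this
    refine this.trans (add_le_add_right ?_ _)
    rw [norm_one, sub_self, abs_zero, mul_zero, zero_add, hA]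
    gcongr
    norm_num
  refine ⟨fun p => (hup₁ p).trans (by gcongr), fun y hy lam hlam => ?_⟩
  set W : ℂ → ℝ := fun z => (K : ℝ)⁻¹ * ∑ k ∈ Finset.Icc 1 K,
    U (z * expT ((skewShift ω)^[k] (0, y)).1) (expT ((skewShift ω)^[k] (0, y)).2) with hW
  have hWe : ∀ x : Torus, W (expT x) = (K : ℝ)⁻¹ * ∑ k ∈ Finset.Icc 1 K,
      U (expT ((skewShift ω)^[k] (x, y)).1) (expT ((skewShift ω)^[k] (x, y)).2) := fun x => by
    simp only [hW, skewShift_iterate, ← expT_add, zero_add, add_assoc]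
  have hVm : ∀ k : ℕ, Measurable fun z => U (z * expT ((skewShift ω)^[k] (0, y)).1)
      (expT ((skewShift ω)^[k] (0, y)).2) := fun k =>
    (hU.measurable_left _).comp (measurable_id.mul_const _)
  have hWs : SubharmonicOn W (annulusD h) :=
    SubharmonicOn.average K hVm (fun _ _ => hU.bdd _ _) fun k => (hU.left _).comp_mul_right _
  have hWm : Measurable W := measurable_average K hVm
  have hWb : ∀ z, |W z| ≤ 1 := fun z => abs_average_le hK fun _ => hU.bdd _ _
  have hint : ∫ x : Torus, W (expT x) =
      (K : ℝ)⁻¹ * ∑ k ∈ Finset.Icc 1 K, ∫ x : Torus, U (expT x) (expT (y + k • ω)) := by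
    simp only [hW]
    rw [integral_average (v := fun k (x : Torus) => U (expT x * expT ((skewShift ω)^[k] (0, y)).1)
      (expT ((skewShift ω)^[k] (0, y)).2)) fun k => integrable_of_abs_le
        ((hVm k).comp continuous_expT.measurable) fun _ => hU.bdd _ _]
    congr 1
    refine Finset.sum_congr rfl fun k _ => ?_
    simp only [← expT_add]
    rw [integral_add_right_eq_self (fun x => U (expT x) (expT ((skewShift ω)^[k] (0, y)).2))]
    simp only [skewShift_iterate]
  obtain ⟨N, hN1, hN2⟩ := exists_nat_mem_Icc_two_mul (x := 160 / h / q) (by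
    rw [le_div_iff₀ hq, le_div_iff₀ hh]; nlinarith)
  have hN0 : (0 : ℝ) < N := lt_of_lt_of_le (by positivity) hN1
  have h40 : 40 / (N : ℝ) ≤ h / 4 * q := by
    calc 40 / (N : ℝ) ≤ 40 / (160 / h / q) := by gcongr
      _ = h / 4 * q := by field_simp; norm_num
  have key := volume_expT_lt_le (V := W) (h := h) (b := b) (s := A * q)
    (s₀ := A * q ^ 2) (κ := q ^ 2) (lam := lam) (N := N) hh' hWs hWm hWb
    (lt_of_le_of_lt h40 (by nlinarith)) (by exact_mod_cast hN0) (by positivity) (by positivity) (by positivity) hlam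
    (fun z hz => by
      replace hz := hz.trans h40
      have hz' : |‖z‖ - 1| + 2 * (h / 8 * ρ) ≤ h / 2 := by nlinarith
      refine (hup z _ hz').trans (add_le_add_right ?_ _)
      have h1 : 8 / h * |‖z‖ - 1| ≤ 8 / h * (h / 4 * q) := by gcongr
      have h2 : 8 / h * (h / 4 * q) = 2 * q := by field_simp; norm_num
      have h3 : (2 + C * (64 / h ^ 2)) * q ^ 2 ≤ (2 + C * (64 / h ^ 2)) * q := by gcongr
      rw [hA]
      linarith)
    (fun x => by rw [hWe]; exact hup₁ (x, y))
    (by rw [hint]; exact hy)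
  simp only [hWe] at key
  have e1 : 4 * (A * q + 2 * (160 / h / q) * (q ^ 2 + A * q ^ 2)) = C₂ * q := by
    rw [hC₂]; field_simp; ring
  have e2 : 2 * (160 / h / q) * (Real.exp (potentialConst / 2) * Real.exp (-lam / (C₂ * q))) =
      C₁ * q⁻¹ * Real.exp (-lam / (C₂ * q)) := by rw [hC₁]; ring
  have e3 : -lam / (4 * (A * q + N * (q ^ 2 + A * q ^ 2))) ≤ -lam / (C₂ * q) := by
    rw [← e1, neg_div, neg_div, neg_le_neg_iff]
    gcongr
  have e4 : -lam / (C₂ * q) ≤ -lam / ((C₁ + C₂) * q) := by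
    rw [neg_div, neg_div, neg_le_neg_iff]
    gcongr
    linarith
  calc _ ≤ _ := key
    _ ≤ 2 * (160 / h / q) * (Real.exp (potentialConst / 2) * Real.exp (-lam / (C₂ * q))) := by
        gcongr
    _ = C₁ * q⁻¹ * Real.exp (-lam / (C₂ * q)) := e2
    _ ≤ _ := by
        gcongr
        linarith

lemma measureReal_le_add_of_section {E : Set Torus2} (hE : MeasurableSet E) {B : Set Torus}
    (hB : MeasurableSet B) {α β : ℝ} (hα : volume.real B ≤ α) (hβ0 : 0 ≤ β)
    (hβ : ∀ y ∉ B, volume.real {x : Torus | (x, y) ∈ E} ≤ β) : volume.real E ≤ α + β := by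
  have h1 : E ⊆ (Set.univ ×ˢ B) ∪ (E \ (Set.univ ×ˢ B)) := by
    intro p hp
    by_cases h : p ∈ Set.univ ×ˢ B
    exacts [Or.inl h, Or.inr ⟨hp, h⟩]
  have h2 : volume.real (Set.univ ×ˢ B : Set Torus2) = volume.real B := by
    rw [Measure.volume_eq_prod, measureReal_prod_prod, probReal_univ, one_mul]
  have h3 : volume.real (E \ (Set.univ ×ˢ B)) ≤ β := by
    refine ENNReal.toReal_le_of_le_ofReal hβ0 ?_
    rw [Measure.volume_eq_prod, Measure.prod_apply_symm (hE.diff (MeasurableSet.univ.prod hB))]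
    calc _ ≤ ∫⁻ _ : Torus, ENNReal.ofReal β := by
          refine lintegral_mono fun y => ?_
          by_cases hy : y ∈ B
          · have : (fun x : Torus => (x, y)) ⁻¹' (E \ (Set.univ ×ˢ B)) = ∅ := by
              ext x; simp [hy]
            rw [this, measure_empty]
            exact zero_le
          · refine (measure_mono (t := {x : Torus | (x, y) ∈ E}) fun x hx => hx.1).trans ?_
            rw [← ofReal_measureReal]
            exact ENNReal.ofReal_le_ofReal (hβ y hy)
      _ = ENNReal.ofReal β := by simp
  calc volume.real E ≤ _ := measureReal_mono h1
    _ ≤ _ := measureReal_union_le _ _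
    _ ≤ α + β := by rw [h2]; exact add_le_add hα h3

lemma rpow_le_mul_exp {a t δ x : ℝ} (ha : 0 < a) (ht : 0 < t) (hδ : 0 < δ) (hx : 0 ≤ x) :
    x ^ a ≤ (a / δ / t) ^ (a / δ) * Real.exp (t * x ^ δ) := by
  set m : ℝ := a / δ with hm
  have hm0 : 0 < m := by positivity
  set y : ℝ := x ^ δ with hy
  have hy0 : 0 ≤ y := Real.rpow_nonneg hx _
  have h1 : y ≤ m / t * Real.exp (t * y / m) := by
    have := Real.add_one_le_exp (t * y / m)
    calc y = m / t * (t * y / m) := by field_simp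
      _ ≤ _ := by gcongr; linarith
  calc x ^ a = y ^ m := by
        rw [hy, hm, ← Real.rpow_mul hx]
        congr 1; field_simp
    _ ≤ (m / t * Real.exp (t * y / m)) ^ m := by gcongr
    _ = (m / t) ^ m * Real.exp (t * y) := by
        rw [Real.mul_rpow (by positivity) (by positivity), ← Real.exp_mul]
        congr 2; field_simp

lemma one_le_exp_mul_exp_neg {c x y : ℝ} (hc : 0 ≤ c) (h : x ≤ y) :
    1 ≤ Real.exp (c * y) * Real.exp (-c * x) := by
  rw [← Real.exp_add]
  refine Real.one_le_exp ?_
  nlinarith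

lemma exists_volume_abs_average_skewShift_sub_gt_le {ε δ h : ℝ} (hε : 0 < ε) (hδ : 0 < δ)
    (hδ' : δ ≤ 1 / 24) (hh : 0 < h) (hh' : h ≤ 1 / 2) :
    ∃ c, 0 < c ∧ ∃ C, 0 < C ∧ ∀ ω ∈ DiophSet ε, ∀ U, BddSepSubharmonic h U → ∀ K : ℕ, 0 < K →
      volume.real {p : Torus2 | (K : ℝ) ^ (2 * δ - 1 / 12) < |(K : ℝ)⁻¹ * ∑ k ∈ Finset.Icc 1 K,
        U (expT ((skewShift ω)^[k] p).1) (expT ((skewShift ω)^[k] p).2) -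
        ∫ y : Torus, ∫ x : Torus, U (expT x) (expT y)|} ≤ C * Real.exp (-c * (K : ℝ) ^ δ) := by
  have hσ : 0 < δ / 2 := by positivity
  have hσ' : δ / 2 ≤ 1 / 10 := by linarith
  have hc₀ : 0 < ε / (1 + 2 / (δ / 2)) ^ 2 := by positivity
  obtain ⟨C₁, hC₁, H₁⟩ := exists_volume_average_rotation_lt_le hc₀ hσ hσ' hh hh'
  obtain ⟨C₂, hC₂, H₂⟩ := exists_volume_average_skewShift_lt_le hc₀ hσ hσ' hh hh'
  set c : ℝ := 1 / (2 * (C₁ + C₂)) with hc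
  have hc0 : 0 < c := by positivity
  set D : ℝ := (1 / 6 / δ / c) ^ (1 / 6 / δ) with hD
  have hD0 : 0 < D := by positivity
  set C₃ : ℝ := Real.exp (c * (C₂ ^ 12) ^ δ) with hC₃
  refine ⟨c, hc0, (C₁ + C₂) * D + C₃, by positivity, fun ω hω U hU K hK => ?_⟩
  have hω' := diophSet_subset_diophExp hε hσ hω
  have hK1 : (1 : ℝ) ≤ K := by exact_mod_cast hK
  have hK0 : (0 : ℝ) < K := by linarith
  rcases lt_or_ge ((K : ℝ) ^ (1 / 12 : ℝ)) C₂ with hsmall | hlarge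
  · have h1 : (K : ℝ) ^ δ ≤ (C₂ ^ 12) ^ δ := by
      have h2 : (K : ℝ) = ((K : ℝ) ^ (1 / 12 : ℝ)) ^ 12 := by
        rw [← Real.rpow_natCast, ← Real.rpow_mul hK0.le]
        norm_num
      have h3 : (K : ℝ) ≤ C₂ ^ 12 := by
        rw [h2]
        gcongr
      gcongr
    calc _ ≤ (1 : ℝ) := measureReal_le_one
      _ ≤ C₃ * Real.exp (-c * (K : ℝ) ^ δ) := one_le_exp_mul_exp_neg hc0.le h1
      _ ≤ _ := by
        gcongr
        have : 0 ≤ (C₁ + C₂) * D := by positivity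
        linarith
  set lam : ℝ := (K : ℝ) ^ (2 * δ - 1 / 12) with hlam
  have hlam0 : 0 ≤ lam := by positivity
  set q₁ : ℝ := (K : ℝ) ^ (-1 / 6 : ℝ) with hq₁
  set q₂ : ℝ := (K : ℝ) ^ (δ - 1 / 12) with hq₂
  have hq₁0 : 0 < q₁ := by positivity
  have hq₂0 : 0 < q₂ := by positivity
  have hq₂1 : q₂ ≤ 1 := Real.rpow_le_one_of_one_le_of_nonpos hK1 (by linarith)
  have hq₁6 : q₁ ^ 6 = (K : ℝ)⁻¹ := by
    rw [hq₁, ← Real.rpow_natCast, ← Real.rpow_mul hK0.le, ← Real.rpow_neg_one]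
    norm_num
  have hq₂2 : q₂ ^ 2 = (K : ℝ) ^ (-1 / 6 + 2 * δ) := by
    rw [hq₂, ← Real.rpow_natCast, ← Real.rpow_mul hK0.le]
    congr 1
    push_cast
    ring
  have hq₂2' : (K : ℝ) ^ (-1 / 6 + 4 * (δ / 2)) ≤ q₂ ^ 2 := by
    rw [hq₂2]
    exact le_of_eq (by congr 1; ring)
  have hC₂q : C₂ * q₂ ^ 2 ≤ lam := by
    calc C₂ * q₂ ^ 2 ≤ (K : ℝ) ^ (1 / 12 : ℝ) * q₂ ^ 2 := by gcongr
      _ = lam := by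
        rw [hq₂2, hlam, ← Real.rpow_add hK0]
        congr 1
        ring
  have hx₁ : q₂ ^ 2 / q₁ = (K : ℝ) ^ (2 * δ) := by
    rw [hq₂2, hq₁, ← Real.rpow_sub hK0]
    congr 1
    ring
  have hx₂ : lam / q₂ = (K : ℝ) ^ δ := by
    rw [hlam, hq₂, ← Real.rpow_sub hK0]
    congr 1
    ring
  set b : ℝ := ∫ y : Torus, ∫ x : Torus, U (expT x) (expT y) with hb
  set a : ℂ → ℝ := fun w₂ => ∫ x : Torus, U (expT x) w₂ with ha
  have ham : Measurable a := hU.measurable_integral_left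
  obtain ⟨hup, hlow⟩ := H₂ ω hω' U hU K hK q₂ hq₂0 hq₂1 hq₂2'
  set B : Set Torus := {y | (K : ℝ)⁻¹ * ∑ k ∈ Finset.Icc 1 K, a (expT (y + k • ω)) < b - q₂ ^ 2}
    with hB
  have hBm : MeasurableSet B := by
    refine measurableSet_lt (measurable_average K fun k => ?_) measurable_const
    exact ham.comp (continuous_expT.measurable.comp (measurable_add_const _))
  have hBvol : volume.real B ≤ C₁ * q₁⁻¹ * Real.exp (-q₂ ^ 2 / (C₁ * q₁)) :=
    H₁ ω hω' a hU.subharmonicOn_integral_left ham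
      (fun _ => abs_integral_le_of_abs_le fun _ => hU.bdd _ _)
      (fun z hz => by simp [ha, hU.zero_right _ z hz]) K hK q₁ hq₁0 hq₁6 (q₂ ^ 2) (by positivity)
  have hbad : ∀ y ∉ B, volume.real {x : Torus | (K : ℝ)⁻¹ * ∑ k ∈ Finset.Icc 1 K,
      U (expT ((skewShift ω)^[k] (x, y)).1) (expT ((skewShift ω)^[k] (x, y)).2) < b - lam} ≤
      C₂ * q₂⁻¹ * Real.exp (-lam / (C₂ * q₂)) := fun y hy =>
    hlow y (not_lt.1 hy) lam hlam0
  have hmeas : Measurable fun p : Torus2 => (K : ℝ)⁻¹ * ∑ k ∈ Finset.Icc 1 K,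
      U (expT ((skewShift ω)^[k] p).1) (expT ((skewShift ω)^[k] p).2) := by
    refine measurable_average K fun k => ?_
    have hT : Measurable ((skewShift ω)^[k]) := by
      refine Measurable.iterate ?_ k
      exact (measurable_fst.add measurable_snd).prodMk (measurable_snd.add_const _)
    exact hU.measurable.comp ((continuous_expT.measurable.comp (measurable_fst.comp hT)).prodMk
      (continuous_expT.measurable.comp (measurable_snd.comp hT)))
  have hsub : {p : Torus2 | lam < |(K : ℝ)⁻¹ * ∑ k ∈ Finset.Icc 1 K,
      U (expT ((skewShift ω)^[k] p).1) (expT ((skewShift ω)^[k] p).2) - b|} ⊆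
      {p : Torus2 | (K : ℝ)⁻¹ * ∑ k ∈ Finset.Icc 1 K,
      U (expT ((skewShift ω)^[k] p).1) (expT ((skewShift ω)^[k] p).2) < b - lam} := fun p hp => by
    rcases lt_abs.1 (show lam < |_| from hp) with h1 | h1
    · linarith [hup p]
    · show _ < b - lam
      linarith
  have key := measureReal_le_add_of_section (measurableSet_lt hmeas measurable_const) hBm hBvol
    (by positivity) hbad
  have hexp₁ : Real.exp (-q₂ ^ 2 / (C₁ * q₁)) ≤ Real.exp (-(2 * c) * (K : ℝ) ^ δ) := by
    refine Real.exp_le_exp.2 ?_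
    have h1 : (K : ℝ) ^ δ ≤ (K : ℝ) ^ (2 * δ) :=
      Real.rpow_le_rpow_of_exponent_le hK1 (by linarith)
    have h2 : -q₂ ^ 2 / (C₁ * q₁) = -(1 / C₁ * (q₂ ^ 2 / q₁)) := by ring
    have h3 : 2 * c = 1 / (C₁ + C₂) := by rw [hc]; field_simp
    rw [h2, hx₁, h3, neg_mul, neg_le_neg_iff]
    gcongr
    linarith
  have hexp₂ : Real.exp (-lam / (C₂ * q₂)) ≤ Real.exp (-(2 * c) * (K : ℝ) ^ δ) := by
    refine Real.exp_le_exp.2 ?_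
    have h2 : -lam / (C₂ * q₂) = -(1 / C₂ * (lam / q₂)) := by ring
    have h3 : 2 * c = 1 / (C₁ + C₂) := by rw [hc]; field_simp
    rw [h2, hx₂, h3, neg_mul, neg_le_neg_iff]
    gcongr
    linarith
  have hq₁i : q₁⁻¹ = (K : ℝ) ^ (1 / 6 : ℝ) := by
    rw [hq₁, ← Real.rpow_neg hK0.le]
    norm_num
  have hq₂i : q₂⁻¹ ≤ (K : ℝ) ^ (1 / 6 : ℝ) := by
    rw [hq₂, ← Real.rpow_neg hK0.le]
    exact Real.rpow_le_rpow_of_exponent_le hK1 (by linarith)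
  have hpow := rpow_le_mul_exp (a := 1 / 6) (t := c) (δ := δ) (by norm_num) hc0 hδ hK0.le
  calc _ ≤ _ := measureReal_mono hsub
    _ ≤ _ := key
    _ ≤ C₁ * (K : ℝ) ^ (1 / 6 : ℝ) * Real.exp (-(2 * c) * (K : ℝ) ^ δ) +
        C₂ * (K : ℝ) ^ (1 / 6 : ℝ) * Real.exp (-(2 * c) * (K : ℝ) ^ δ) := by
      rw [hq₁i]
      gcongr
    _ = (C₁ + C₂) * ((K : ℝ) ^ (1 / 6 : ℝ) * Real.exp (-(2 * c) * (K : ℝ) ^ δ)) := by ring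
    _ ≤ (C₁ + C₂) * (D * Real.exp (c * (K : ℝ) ^ δ) * Real.exp (-(2 * c) * (K : ℝ) ^ δ)) := by
      gcongr
    _ = (C₁ + C₂) * D * Real.exp (-c * (K : ℝ) ^ δ) := by
      rw [mul_assoc D, ← Real.exp_add, mul_assoc]
      congr 3
      ring
    _ ≤ _ := by
      gcongr
      exact le_add_of_nonneg_right (Real.exp_pos _).le

lemma exists_volume_abs_average_skewShift_sub_gt_le_of_lt {ε δ h : ℝ} (hδ' : 1 / 24 < δ) :
    ∃ c, 0 < c ∧ ∃ C, 0 < C ∧ ∀ ω ∈ DiophSet ε, ∀ U, BddSepSubharmonic h U → ∀ K : ℕ, 0 < K →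
      volume.real {p : Torus2 | (K : ℝ) ^ (2 * δ - 1 / 12) < |(K : ℝ)⁻¹ * ∑ k ∈ Finset.Icc 1 K,
        U (expT ((skewShift ω)^[k] p).1) (expT ((skewShift ω)^[k] p).2) -
        ∫ y : Torus, ∫ x : Torus, U (expT x) (expT y)|} ≤ C * Real.exp (-c * (K : ℝ) ^ δ) := by
  set a : ℝ := 2 * δ - 1 / 12 with ha
  have ha0 : 0 < a := by linarith
  refine ⟨1, one_pos, Real.exp (1 * ((2 : ℝ) ^ (1 / a)) ^ δ), Real.exp_pos _,
    fun ω _ U hU K hK => ?_⟩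
  have hK0 : (0 : ℝ) < K := by exact_mod_cast hK
  rcases lt_or_ge ((K : ℝ) ^ a) 2 with hsmall | hlarge
  · refine measureReal_le_one.trans (one_le_exp_mul_exp_neg zero_le_one ?_)
    have h2 : (K : ℝ) = ((K : ℝ) ^ a) ^ (1 / a) := by
      rw [← Real.rpow_mul hK0.le, mul_one_div_cancel ha0.ne', Real.rpow_one]
    have h3 : (K : ℝ) ≤ 2 ^ (1 / a) := by
      rw [h2]
      gcongr
    have : 0 < δ := by linarith
    gcongr
  · have hempty : {p : Torus2 | (K : ℝ) ^ a < |(K : ℝ)⁻¹ * ∑ k ∈ Finset.Icc 1 K,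
        U (expT ((skewShift ω)^[k] p).1) (expT ((skewShift ω)^[k] p).2) -
        ∫ y : Torus, ∫ x : Torus, U (expT x) (expT y)|} = ∅ := by
      refine Set.eq_empty_of_forall_notMem fun p hp => ?_
      have h1 := abs_average_le (v := fun k => U (expT ((skewShift ω)^[k] p).1)
        (expT ((skewShift ω)^[k] p).2)) hK fun k => hU.bdd _ _
      have h2 : |∫ y : Torus, ∫ x : Torus, U (expT x) (expT y)| ≤ 1 :=
        abs_integral_le_of_abs_le fun y => abs_integral_le_of_abs_le fun x => hU.bdd _ _
      have h3 := (abs_sub _ _).trans (add_le_add h1 h2)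
      have h4 : (K : ℝ) ^ a < _ := hp
      linarith
    rw [hempty, measureReal_empty]
    positivity

/-- **Lemma B.2** (large deviation estimate for skew-shift ergodic averages of separately
subharmonic functions). Let `h₁, h₂ > 0`, fix `ε > 0` small, `ω ∈ Ω_ε` and `δ > 0`. There
are constants `c, C > 0` (depending only on `h₁, h₂, δ, ε`) such that for every `K ≥ 1`:
if `u : 𝕋² → ℝ` extends as a separately subharmonic function `U` to `𝒟_{h₁} × 𝒟_{h₂}`
with `sup|U| ≤ 1`, then
`mes[|(1/K)·Σ_{k=1}^{K} u(T_ω^k(x,y)) − ⟨u⟩| > K^{2δ−1/12}] ≤ C·exp(−c·K^δ)`. -/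
theorem subharmonic_skew_shift_deviation :
    ∀ h₁ h₂ : ℝ, 0 < h₁ → 0 < h₂ → ∀ ε : ℝ, 0 < ε → ∀ δ : ℝ, 0 < δ →
    ∃ c > (0:ℝ), ∃ C > (0:ℝ),
      ∀ ω ∈ DiophSet ε, ∀ u : Torus2 → ℝ, ∀ U : ℂ × ℂ → ℝ,
      SepSubharmonicExt u h₁ h₂ U →
      (∀ w₁ ∈ annulusD h₁, ∀ w₂ ∈ annulusD h₂, |U (w₁, w₂)| ≤ 1) →
      ∀ K : ℕ, 0 < K →
        volume {p : Torus2 |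
            |(K : ℝ)⁻¹ * (∑ k ∈ Finset.Icc 1 K, u ((skewShift ω)^[k] p)) -
              ∫ q : Torus2, u q| > (K : ℝ) ^ (2 * δ - 1/12)}
          ≤ ENNReal.ofReal (C * Real.exp (-c * (K : ℝ) ^ δ)) := by
  intro h₁ h₂ hh₁ hh₂ ε hε δ hδ
  have hh : 0 < min (min h₁ h₂) (1 / 2) := by positivity
  have hh' : min (min h₁ h₂) (1 / 2) ≤ 1 / 2 := min_le_right _ _
  obtain ⟨c, hc, C, hC, H⟩ : ∃ c, 0 < c ∧ ∃ C, 0 < C ∧ ∀ ω ∈ DiophSet ε,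
      ∀ U, BddSepSubharmonic (min (min h₁ h₂) (1 / 2)) U → ∀ K : ℕ, 0 < K →
      volume.real {p : Torus2 | (K : ℝ) ^ (2 * δ - 1 / 12) < |(K : ℝ)⁻¹ * ∑ k ∈ Finset.Icc 1 K,
        U (expT ((skewShift ω)^[k] p).1) (expT ((skewShift ω)^[k] p).2) -
        ∫ y : Torus, ∫ x : Torus, U (expT x) (expT y)|} ≤ C * Real.exp (-c * (K : ℝ) ^ δ) := by
    rcases le_or_gt δ (1 / 24) with hδ' | hδ'
    · exact exists_volume_abs_average_skewShift_sub_gt_le hε hδ hδ' hh hh'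
    · exact exists_volume_abs_average_skewShift_sub_gt_le_of_lt hδ'
  refine ⟨c, hc, C, hC, fun ω hω u U hU hb K hK => ?_⟩
  obtain ⟨V, hV, huV⟩ := hU.exists_bddSepSubharmonic hb hh ((min_le_left _ _).trans (min_le_left _ _))
    ((min_le_left _ _).trans (min_le_right _ _))
  have hmV : Measurable fun p : Torus2 => V (expT p.1) (expT p.2) :=
    hV.measurable.comp ((continuous_expT.measurable.comp measurable_fst).prodMk
      (continuous_expT.measurable.comp measurable_snd))
  have hint : ∫ q : Torus2, u q = ∫ y : Torus, ∫ x : Torus, V (expT x) (expT y) := by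
    simp only [huV]
    rw [Measure.volume_eq_prod, integral_prod_symm _ (integrable_of_abs_le hmV fun _ => hV.bdd _ _)]
  have key := H ω hω V hV K hK
  rw [hint, ← ofReal_measureReal]
  simp only [huV, gt_iff_lt]
  exact ENNReal.ofReal_le_ofReal key
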